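/- Involution property of the self-translation (stoup-term part): suppose R̲ is either a computation-type constant or the type I̲. If Γ | z:A̲ ⊢ t : B̲ is derivable in EEC, then Γ | z:A̲ ⊢ t = ι_B̲[ (tᶜ)ᶜ ][ ι_A̲⁻¹[z] / k_{k_z} ][ι⁻¹(Γ)] : B̲ in the equational theory of EEC, where square-bracket application denotes linear application, [ι⁻¹(Γ)] denotes the substitution replacing each variable xᵢ:Cᵢ of Γ by ι_{Cᵢ}⁻¹(xᵢ), and k_{k_z} is the stoup variable of the doubly translated term. -/

import Mathlib

set_option autoImplicit false

namespace EEC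

/-! # The enriched effect calculus (EEC)

A deep embedding of the enriched effect calculus of Egger, Møgelberg and
Simpson: value types and computation types, raw terms (de Bruijn indices for
value variables, together with a designated stoup variable `svar`), typing
derivations with an (at most singleton) stoup, the βη-equational theory, the
simply-typed λ-calculus together with βη-equality and Moggi's computational
λ-calculus equality, the standard cbv/cbn translations of typed λ-calculus
into EEC, Hasegawa's linear-use CPS translations, and the generic linear-use
CPS self-translation of EEC. -/

mutual
  /-- Value types of EEC. -/
  inductive VType : Type
    | base : ℕ → VType                 -- value type constants α
    | unit : VType                     -- 1
    | prod : VType → VType → VType     -- A × B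
    | arr : VType → VType → VType      -- A → B
    | comp : CType → VType             -- every computation type is a value type
    | lin : CType → CType → VType      -- A̲ ⊸ B̲
  /-- Computation types of EEC. -/
  inductive CType : Type
    | base : ℕ → CType                 -- computation type constants α̲
    | cunit : CType                    -- 1̲
    | cand : CType → CType → CType     -- A̲ & B̲
    | carr : VType → CType → CType     -- A ⇒ B̲
    | iunit : CType                    -- I̲
    | bang : VType → CType             -- !A
    | copow : VType → CType → CType    -- !A ⊗ B̲
    | czero : CType                    -- 0̲
    | csum : CType → CType → CType     -- A̲ ⊕ B̲
end

/-- Raw terms of EEC.  Value variables are de Bruijn indices (`var n`, with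
`var 0` the innermost bound variable); the unique stoup variable is `svar`
(the constructs `llam`, `copowlet` (in its body) and `ccase` (in its
branches) bind the stoup variable). -/
inductive Tm : Type
  | var : ℕ → Tm                -- value variable
  | svar : Tm                   -- the stoup variable
  | unit : Tm                   -- * : 1
  | vpair : Tm → Tm → Tm        -- ⟨t,u⟩
  | vfst : Tm → Tm
  | vsnd : Tm → Tm
  | vlam : VType → Tm → Tm      -- λx:A. t
  | vapp : Tm → Tm → Tm
  | cunit : Tm                  -- ⋆ : 1̲
  | cpair : Tm → Tm → Tm        -- ⟨t,u⟩ : A̲ & B̲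
  | cfst : Tm → Tm
  | csnd : Tm → Tm
  | clam : VType → Tm → Tm      -- λx:A ⇒ t
  | capp : Tm → Tm → Tm         -- s ⋅ t
  | top : Tm                    -- ⊤ : I̲
  | ilet : Tm → Tm → Tm         -- t to ⊤. u
  | bang : Tm → Tm              -- !t
  | banglet : Tm → Tm → Tm      -- let !x = t in u   (binds a value variable in u)
  | copow : Tm → Tm → Tm        -- !t ⊗ u
  | copowlet : Tm → Tm → Tm     -- let !x⊗y = s in t (binds a value variable and the stoup variable in t)
  | cimage : CType → Tm → Tm    -- image_{A̲}(t)
  | cinl : Tm → Tm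
  | cinr : Tm → Tm
  | ccase : Tm → Tm → Tm → Tm   -- case s of (x. t | y. u)  (branches bind the stoup variable)
  | llam : CType → Tm → Tm      -- λ°z:A̲. t (binds the stoup variable)
  | lapp : Tm → Tm → Tm         -- s[t]

namespace Tm

/-- Lift a renaming of value variables under a binder. -/
def liftN (f : ℕ → ℕ) : ℕ → ℕ
  | 0 => 0
  | n + 1 => f n + 1

/-- Renaming of value variables. -/
def rename (f : ℕ → ℕ) : Tm → Tm
  | .var n => .var (f n)
  | .svar => .svar
  | .unit => .unit
  | .vpair t u => .vpair (rename f t) (rename f u)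
  | .vfst t => .vfst (rename f t)
  | .vsnd t => .vsnd (rename f t)
  | .vlam A t => .vlam A (rename (liftN f) t)
  | .vapp s t => .vapp (rename f s) (rename f t)
  | .cunit => .cunit
  | .cpair t u => .cpair (rename f t) (rename f u)
  | .cfst t => .cfst (rename f t)
  | .csnd t => .csnd (rename f t)
  | .clam A t => .clam A (rename (liftN f) t)
  | .capp s t => .capp (rename f s) (rename f t)
  | .top => .top
  | .ilet t u => .ilet (rename f t) (rename f u)
  | .bang t => .bang (rename f t)
  | .banglet t u => .banglet (rename f t) (rename (liftN f) u)
  | .copow t u => .copow (rename f t) (rename f u)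
  | .copowlet s t => .copowlet (rename f s) (rename (liftN f) t)
  | .cimage A t => .cimage A (rename f t)
  | .cinl t => .cinl (rename f t)
  | .cinr t => .cinr (rename f t)
  | .ccase s t u => .ccase (rename f s) (rename f t) (rename f u)
  | .llam A t => .llam A (rename f t)
  | .lapp s t => .lapp (rename f s) (rename f t)

/-- Weakening of value variables. -/
def shift (t : Tm) : Tm := rename Nat.succ t

/-- Lift a parallel substitution of value variables under a binder. -/
def liftS (σ : ℕ → Tm) : ℕ → Tm
  | 0 => .var 0
  | n + 1 => shift (σ n)

/-- Parallel (capture-avoiding) substitution for value variables. -/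
def psubst (σ : ℕ → Tm) : Tm → Tm
  | .var n => σ n
  | .svar => .svar
  | .unit => .unit
  | .vpair t u => .vpair (psubst σ t) (psubst σ u)
  | .vfst t => .vfst (psubst σ t)
  | .vsnd t => .vsnd (psubst σ t)
  | .vlam A t => .vlam A (psubst (liftS σ) t)
  | .vapp s t => .vapp (psubst σ s) (psubst σ t)
  | .cunit => .cunit
  | .cpair t u => .cpair (psubst σ t) (psubst σ u)
  | .cfst t => .cfst (psubst σ t)
  | .csnd t => .csnd (psubst σ t)
  | .clam A t => .clam A (psubst (liftS σ) t)
  | .capp s t => .capp (psubst σ s) (psubst σ t)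
  | .top => .top
  | .ilet t u => .ilet (psubst σ t) (psubst σ u)
  | .bang t => .bang (psubst σ t)
  | .banglet t u => .banglet (psubst σ t) (psubst (liftS σ) u)
  | .copow t u => .copow (psubst σ t) (psubst σ u)
  | .copowlet s t => .copowlet (psubst σ s) (psubst (liftS σ) t)
  | .cimage A t => .cimage A (psubst σ t)
  | .cinl t => .cinl (psubst σ t)
  | .cinr t => .cinr (psubst σ t)
  | .ccase s t u => .ccase (psubst σ s) (psubst σ t) (psubst σ u)
  | .llam A t => .llam A (psubst σ t)
  | .lapp s t => .lapp (psubst σ s) (psubst σ t)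

/-- Capture-avoiding substitution `t[u/x]` of a term `u` for the innermost
value variable of `t`. -/
def subst0 (u : Tm) (t : Tm) : Tm :=
  psubst (fun n => match n with | 0 => u | m + 1 => .var m) t

/-- Capture-avoiding substitution `t[u/z]` of a term `u` for the stoup
variable of `t`.  The substitution stops at the stoup-variable binders
(`llam`-bodies, `copowlet`-bodies and `ccase`-branches). -/
def ssubst (u : Tm) : Tm → Tm
  | .var n => .var n
  | .svar => u
  | .unit => .unit
  | .vpair t t' => .vpair (ssubst u t) (ssubst u t')
  | .vfst t => .vfst (ssubst u t)
  | .vsnd t => .vsnd (ssubst u t)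
  | .vlam A t => .vlam A (ssubst (shift u) t)
  | .vapp s t => .vapp (ssubst u s) (ssubst u t)
  | .cunit => .cunit
  | .cpair t t' => .cpair (ssubst u t) (ssubst u t')
  | .cfst t => .cfst (ssubst u t)
  | .csnd t => .csnd (ssubst u t)
  | .clam A t => .clam A (ssubst (shift u) t)
  | .capp s t => .capp (ssubst u s) (ssubst u t)
  | .top => .top
  | .ilet t t' => .ilet (ssubst u t) (ssubst u t')
  | .bang t => .bang (ssubst u t)
  | .banglet t t' => .banglet (ssubst u t) (ssubst (shift u) t')
  | .copow t t' => .copow (ssubst u t) (ssubst u t')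
  | .copowlet s t => .copowlet (ssubst u s) t
  | .cimage A t => .cimage A (ssubst u t)
  | .cinl t => .cinl (ssubst u t)
  | .cinr t => .cinr (ssubst u t)
  | .ccase s t t' => .ccase (ssubst u s) t t'
  | .llam A t => .llam A t
  | .lapp s t => .lapp (ssubst u s) (ssubst u t)

end Tm

/-- Typing derivations of EEC (Figure 1 of the paper).  `Deriv Γ none t A`
is the judgement `Γ ⊢ t : A` (empty stoup); `Deriv Γ (some A̲) t (.comp B̲)`
is the judgement `Γ | z:A̲ ⊢ t : B̲`.  In the rules below `Δ` ranges over an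
arbitrary (possibly empty) stoup. -/
inductive Deriv : List VType → Option CType → Tm → VType → Type
  | var (Γ : List VType) (n : ℕ) (A : VType) :
      Γ[n]? = some A → Deriv Γ none (.var n) A
  | svar (Γ : List VType) (A : CType) : Deriv Γ (some A) .svar (.comp A)
  | unit (Γ : List VType) : Deriv Γ none .unit .unit
  | vpair (Γ : List VType) (t u : Tm) (A B : VType) :
      Deriv Γ none t A → Deriv Γ none u B → Deriv Γ none (.vpair t u) (.prod A B)
  | vfst (Γ : List VType) (t : Tm) (A B : VType) :
      Deriv Γ none t (.prod A B) → Deriv Γ none (.vfst t) A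
  | vsnd (Γ : List VType) (t : Tm) (A B : VType) :
      Deriv Γ none t (.prod A B) → Deriv Γ none (.vsnd t) B
  | vlam (Γ : List VType) (t : Tm) (A B : VType) :
      Deriv (A :: Γ) none t B → Deriv Γ none (.vlam A t) (.arr A B)
  | vapp (Γ : List VType) (s t : Tm) (A B : VType) :
      Deriv Γ none s (.arr A B) → Deriv Γ none t A → Deriv Γ none (.vapp s t) B
  | cunit (Γ : List VType) (Δ : Option CType) : Deriv Γ Δ .cunit (.comp .cunit)
  | cpair (Γ : List VType) (Δ : Option CType) (t u : Tm) (A B : CType) :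
      Deriv Γ Δ t (.comp A) → Deriv Γ Δ u (.comp B) →
      Deriv Γ Δ (.cpair t u) (.comp (.cand A B))
  | cfst (Γ : List VType) (Δ : Option CType) (t : Tm) (A B : CType) :
      Deriv Γ Δ t (.comp (.cand A B)) → Deriv Γ Δ (.cfst t) (.comp A)
  | csnd (Γ : List VType) (Δ : Option CType) (t : Tm) (A B : CType) :
      Deriv Γ Δ t (.comp (.cand A B)) → Deriv Γ Δ (.csnd t) (.comp B)
  | clam (Γ : List VType) (Δ : Option CType) (t : Tm) (A : VType) (B : CType) :
      Deriv (A :: Γ) Δ t (.comp B) → Deriv Γ Δ (.clam A t) (.comp (.carr A B))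
  | capp (Γ : List VType) (Δ : Option CType) (s t : Tm) (A : VType) (B : CType) :
      Deriv Γ Δ s (.comp (.carr A B)) → Deriv Γ none t A →
      Deriv Γ Δ (.capp s t) (.comp B)
  | top (Γ : List VType) : Deriv Γ none .top (.comp .iunit)
  | ilet (Γ : List VType) (Δ : Option CType) (t u : Tm) (A : CType) :
      Deriv Γ Δ t (.comp .iunit) → Deriv Γ none u (.comp A) →
      Deriv Γ Δ (.ilet t u) (.comp A)
  | bang (Γ : List VType) (t : Tm) (A : VType) :
      Deriv Γ none t A → Deriv Γ none (.bang t) (.comp (.bang A))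
  | banglet (Γ : List VType) (Δ : Option CType) (t u : Tm) (A : VType) (B : CType) :
      Deriv Γ Δ t (.comp (.bang A)) → Deriv (A :: Γ) none u (.comp B) →
      Deriv Γ Δ (.banglet t u) (.comp B)
  | copow (Γ : List VType) (Δ : Option CType) (t u : Tm) (A : VType) (B : CType) :
      Deriv Γ none t A → Deriv Γ Δ u (.comp B) →
      Deriv Γ Δ (.copow t u) (.comp (.copow A B))
  | copowlet (Γ : List VType) (Δ : Option CType) (s t : Tm) (A : VType) (B C : CType) :
      Deriv Γ Δ s (.comp (.copow A B)) → Deriv (A :: Γ) (some B) t (.comp C) →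
      Deriv Γ Δ (.copowlet s t) (.comp C)
  | cimage (Γ : List VType) (Δ : Option CType) (t : Tm) (A : CType) :
      Deriv Γ Δ t (.comp .czero) → Deriv Γ Δ (.cimage A t) (.comp A)
  | cinl (Γ : List VType) (Δ : Option CType) (t : Tm) (A B : CType) :
      Deriv Γ Δ t (.comp A) → Deriv Γ Δ (.cinl t) (.comp (.csum A B))
  | cinr (Γ : List VType) (Δ : Option CType) (t : Tm) (A B : CType) :
      Deriv Γ Δ t (.comp B) → Deriv Γ Δ (.cinr t) (.comp (.csum A B))
  | ccase (Γ : List VType) (Δ : Option CType) (s t u : Tm) (A B C : CType) :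
      Deriv Γ Δ s (.comp (.csum A B)) → Deriv Γ (some A) t (.comp C) →
      Deriv Γ (some B) u (.comp C) → Deriv Γ Δ (.ccase s t u) (.comp C)
  | llam (Γ : List VType) (t : Tm) (A B : CType) :
      Deriv Γ (some A) t (.comp B) → Deriv Γ none (.llam A t) (.lin A B)
  | lapp (Γ : List VType) (Δ : Option CType) (s t : Tm) (A B : CType) :
      Deriv Γ none s (.lin A B) → Deriv Γ Δ t (.comp A) →
      Deriv Γ Δ (.lapp s t) (.comp B)

/-- The equational theory of EEC: the smallest type-respecting congruence
containing the βη-equalities of Figure 2 of the paper. -/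
inductive EEq : List VType → Option CType → Tm → Tm → VType → Prop
  -- equivalence
  | refl {Γ Δ t A} : Deriv Γ Δ t A → EEq Γ Δ t t A
  | symm {Γ Δ t u A} : EEq Γ Δ t u A → EEq Γ Δ u t A
  | trans {Γ Δ t u v A} : EEq Γ Δ t u A → EEq Γ Δ u v A → EEq Γ Δ t v A
  -- congruence rules
  | vpair_cong {Γ t t' u u' A B} : EEq Γ none t t' A → EEq Γ none u u' B →
      EEq Γ none (.vpair t u) (.vpair t' u') (.prod A B)
  | vfst_cong {Γ t t' A B} : EEq Γ none t t' (.prod A B) →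
      EEq Γ none (.vfst t) (.vfst t') A
  | vsnd_cong {Γ t t' A B} : EEq Γ none t t' (.prod A B) →
      EEq Γ none (.vsnd t) (.vsnd t') B
  | vlam_cong {Γ t t' A B} : EEq (A :: Γ) none t t' B →
      EEq Γ none (.vlam A t) (.vlam A t') (.arr A B)
  | vapp_cong {Γ s s' t t' A B} : EEq Γ none s s' (.arr A B) → EEq Γ none t t' A →
      EEq Γ none (.vapp s t) (.vapp s' t') B
  | cpair_cong {Γ Δ t t' u u' A B} : EEq Γ Δ t t' (.comp A) → EEq Γ Δ u u' (.comp B) →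
      EEq Γ Δ (.cpair t u) (.cpair t' u') (.comp (.cand A B))
  | cfst_cong {Γ Δ t t' A B} : EEq Γ Δ t t' (.comp (.cand A B)) →
      EEq Γ Δ (.cfst t) (.cfst t') (.comp A)
  | csnd_cong {Γ Δ t t' A B} : EEq Γ Δ t t' (.comp (.cand A B)) →
      EEq Γ Δ (.csnd t) (.csnd t') (.comp B)
  | clam_cong {Γ Δ t t' A B} : EEq (A :: Γ) Δ t t' (.comp B) →
      EEq Γ Δ (.clam A t) (.clam A t') (.comp (.carr A B))
  | capp_cong {Γ Δ s s' t t' A B} : EEq Γ Δ s s' (.comp (.carr A B)) → EEq Γ none t t' A →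
      EEq Γ Δ (.capp s t) (.capp s' t') (.comp B)
  | ilet_cong {Γ Δ t t' u u' A} : EEq Γ Δ t t' (.comp .iunit) → EEq Γ none u u' (.comp A) →
      EEq Γ Δ (.ilet t u) (.ilet t' u') (.comp A)
  | bang_cong {Γ t t' A} : EEq Γ none t t' A →
      EEq Γ none (.bang t) (.bang t') (.comp (.bang A))
  | banglet_cong {Γ Δ t t' u u' A B} : EEq Γ Δ t t' (.comp (.bang A)) →
      EEq (A :: Γ) none u u' (.comp B) →
      EEq Γ Δ (.banglet t u) (.banglet t' u') (.comp B)
  | copow_cong {Γ Δ t t' u u' A B} : EEq Γ none t t' A → EEq Γ Δ u u' (.comp B) →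
      EEq Γ Δ (.copow t u) (.copow t' u') (.comp (.copow A B))
  | copowlet_cong {Γ Δ s s' t t' A B C} : EEq Γ Δ s s' (.comp (.copow A B)) →
      EEq (A :: Γ) (some B) t t' (.comp C) →
      EEq Γ Δ (.copowlet s t) (.copowlet s' t') (.comp C)
  | cimage_cong {Γ Δ t t' A} : EEq Γ Δ t t' (.comp .czero) →
      EEq Γ Δ (.cimage A t) (.cimage A t') (.comp A)
  | cinl_cong {Γ Δ t t' A B} : EEq Γ Δ t t' (.comp A) →
      EEq Γ Δ (.cinl t) (.cinl t') (.comp (.csum A B))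
  | cinr_cong {Γ Δ t t' A B} : EEq Γ Δ t t' (.comp B) →
      EEq Γ Δ (.cinr t) (.cinr t') (.comp (.csum A B))
  | ccase_cong {Γ Δ s s' t t' u u' A B C} : EEq Γ Δ s s' (.comp (.csum A B)) →
      EEq Γ (some A) t t' (.comp C) → EEq Γ (some B) u u' (.comp C) →
      EEq Γ Δ (.ccase s t u) (.ccase s' t' u') (.comp C)
  | llam_cong {Γ t t' A B} : EEq Γ (some A) t t' (.comp B) →
      EEq Γ none (.llam A t) (.llam A t') (.lin A B)
  | lapp_cong {Γ Δ s s' t t' A B} : EEq Γ none s s' (.lin A B) → EEq Γ Δ t t' (.comp A) →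
      EEq Γ Δ (.lapp s t) (.lapp s' t') (.comp B)
  -- the equalities of Figure 2
  | unit_eta {Γ t} : Deriv Γ none t .unit → EEq Γ none t .unit .unit
  | vfst_beta {Γ t u A B} : Deriv Γ none t A → Deriv Γ none u B →
      EEq Γ none (.vfst (.vpair t u)) t A
  | vsnd_beta {Γ t u A B} : Deriv Γ none t A → Deriv Γ none u B →
      EEq Γ none (.vsnd (.vpair t u)) u B
  | vpair_eta {Γ t A B} : Deriv Γ none t (.prod A B) →
      EEq Γ none (.vpair (.vfst t) (.vsnd t)) t (.prod A B)
  | vlam_beta {Γ t u A B} : Deriv (A :: Γ) none t B → Deriv Γ none u A →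
      EEq Γ none (.vapp (.vlam A t) u) (Tm.subst0 u t) B
  | vlam_eta {Γ t A B} : Deriv Γ none t (.arr A B) →
      EEq Γ none (.vlam A (.vapp (Tm.shift t) (.var 0))) t (.arr A B)
  | cunit_eta {Γ Δ t} : Deriv Γ Δ t (.comp .cunit) → EEq Γ Δ t .cunit (.comp .cunit)
  | cfst_beta {Γ Δ t u A B} : Deriv Γ Δ t (.comp A) → Deriv Γ Δ u (.comp B) →
      EEq Γ Δ (.cfst (.cpair t u)) t (.comp A)
  | csnd_beta {Γ Δ t u A B} : Deriv Γ Δ t (.comp A) → Deriv Γ Δ u (.comp B) →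
      EEq Γ Δ (.csnd (.cpair t u)) u (.comp B)
  | cpair_eta {Γ Δ t A B} : Deriv Γ Δ t (.comp (.cand A B)) →
      EEq Γ Δ (.cpair (.cfst t) (.csnd t)) t (.comp (.cand A B))
  | clam_beta {Γ Δ t u A B} : Deriv (A :: Γ) Δ t (.comp B) → Deriv Γ none u A →
      EEq Γ Δ (.capp (.clam A t) u) (Tm.subst0 u t) (.comp B)
  | clam_eta {Γ Δ t A B} : Deriv Γ Δ t (.comp (.carr A B)) →
      EEq Γ Δ (.clam A (.capp (Tm.shift t) (.var 0))) t (.comp (.carr A B))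
  | ilet_beta {Γ t A} : Deriv Γ none t (.comp A) →
      EEq Γ none (.ilet .top t) t (.comp A)
  | ilet_eta {Γ Δ t u A} : Deriv Γ Δ t (.comp .iunit) → Deriv Γ (some .iunit) u (.comp A) →
      EEq Γ Δ (.ilet t (Tm.ssubst .top u)) (Tm.ssubst t u) (.comp A)
  | bang_beta {Γ t u A B} : Deriv Γ none t A → Deriv (A :: Γ) none u (.comp B) →
      EEq Γ none (.banglet (.bang t) u) (Tm.subst0 t u) (.comp B)
  | bang_eta {Γ Δ t u A B} : Deriv Γ Δ t (.comp (.bang A)) →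
      Deriv Γ (some (.bang A)) u (.comp B) →
      EEq Γ Δ (.banglet t (Tm.ssubst (.bang (.var 0)) (Tm.shift u))) (Tm.ssubst t u) (.comp B)
  | copow_beta {Γ Δ t s u A B C} : Deriv Γ none t A → Deriv Γ Δ s (.comp B) →
      Deriv (A :: Γ) (some B) u (.comp C) →
      EEq Γ Δ (.copowlet (.copow t s) u) (Tm.ssubst s (Tm.subst0 t u)) (.comp C)
  | copow_eta {Γ Δ t u A B C} : Deriv Γ Δ t (.comp (.copow A B)) →
      Deriv Γ (some (.copow A B)) u (.comp C) →
      EEq Γ Δ (.copowlet t (Tm.ssubst (.copow (.var 0) .svar) (Tm.shift u))) (Tm.ssubst t u) (.comp C)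
  | czero_eta {Γ Δ t u A} : Deriv Γ Δ t (.comp .czero) → Deriv Γ (some .czero) u (.comp A) →
      EEq Γ Δ (.cimage A t) (Tm.ssubst t u) (.comp A)
  | csum_beta_inl {Γ Δ t u u' A B C} : Deriv Γ (some A) u (.comp C) →
      Deriv Γ (some B) u' (.comp C) → Deriv Γ Δ t (.comp A) →
      EEq Γ Δ (.ccase (.cinl t) u u') (Tm.ssubst t u) (.comp C)
  | csum_beta_inr {Γ Δ t u u' A B C} : Deriv Γ (some A) u (.comp C) →
      Deriv Γ (some B) u' (.comp C) → Deriv Γ Δ t (.comp B) →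
      EEq Γ Δ (.ccase (.cinr t) u u') (Tm.ssubst t u') (.comp C)
  | csum_eta {Γ Δ t u A B C} : Deriv Γ Δ t (.comp (.csum A B)) →
      Deriv Γ (some (.csum A B)) u (.comp C) →
      EEq Γ Δ (.ccase t (Tm.ssubst (.cinl .svar) u) (Tm.ssubst (.cinr .svar) u)) (Tm.ssubst t u) (.comp C)
  | llam_beta {Γ Δ t u A B} : Deriv Γ (some A) t (.comp B) → Deriv Γ Δ u (.comp A) →
      EEq Γ Δ (.lapp (.llam A t) u) (Tm.ssubst u t) (.comp B)
  | llam_eta {Γ t A B} : Deriv Γ none t (.lin A B) →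
      EEq Γ none (.llam A (.lapp t .svar)) t (.lin A B)

end EEC

namespace EEC

/-! ## The generic linear-use CPS self-translation of EEC (Figures 4–6) -/

mutual
  /-- CPS translation `Aᶜ` of value types, relative to the result type `R̲`. -/
  def cpsV (R : CType) : VType → VType
    | .base a => .base a
    | .unit => .unit
    | .prod A B => .prod (cpsV R A) (cpsV R B)
    | .arr A B => .arr (cpsV R A) (cpsV R B)
    | .comp A => .lin (cpsC R A) R
    | .lin A B => .lin (cpsC R B) (cpsC R A)
  /-- CPS translation `A̲ᶜ` of computation types, relative to the result type
  `R̲` (a computation-type constant equal to `R̲` is translated to `I̲`). -/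
  def cpsC (R : CType) : CType → CType
    | .base a =>
        match R with
        | .base b => if b = a then .iunit else .base a
        | _ => .base a
    | .cunit => .czero
    | .cand A B => .csum (cpsC R A) (cpsC R B)
    | .carr A B => .copow (cpsV R A) (cpsC R B)
    | .iunit => R
    | .bang A => .carr (cpsV R A) R
    | .copow A B => .carr (cpsV R A) (cpsC R B)
    | .czero => .cunit
    | .csum A B => .cand (cpsC R A) (cpsC R B)
end

/-- Pointwise CPS translation `Γᶜ` of a context. -/
def cpsCtx (R : CType) (Γ : List VType) : List VType := Γ.map (cpsV R)

/-- The generic linear-use CPS self-translation on terms (Figures 5 and 6 of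
the paper), defined by recursion on typing derivations.  A value judgement
`Γ ⊢ t : A` is sent to a term `tᶜ` with `Γᶜ ⊢ tᶜ : Aᶜ`, and a stoup
judgement `Γ | z:A̲ ⊢ t : B̲` is sent (contravariantly) to a term `tᶜ` with
`Γᶜ | k_z:B̲ᶜ ⊢ tᶜ : A̲ᶜ`. -/
def cps (R : CType) : {Γ : List VType} → {Δ : Option CType} → {t : Tm} → {A : VType} →
    Deriv Γ Δ t A → Tm
  | _, _, _, _, .var _ n _ _ => .var n
  | _, _, _, _, .svar _ _ => .svar
  | _, _, _, _, .unit _ => .unit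
  | _, _, _, _, .vpair _ _ _ _ _ d1 d2 => .vpair (cps R d1) (cps R d2)
  | _, _, _, _, .vfst _ _ _ _ d => .vfst (cps R d)
  | _, _, _, _, .vsnd _ _ _ _ d => .vsnd (cps R d)
  | _, _, _, _, .vlam _ _ A _ d => .vlam (cpsV R A) (cps R d)
  | _, _, _, _, .vapp _ _ _ _ _ d1 d2 => .vapp (cps R d1) (cps R d2)
  | _, _, _, _, .cunit _ none => .llam .czero (.cimage R .svar)
  | _, _, _, _, .cunit _ (some D) => .cimage (cpsC R D) .svar
  | _, _, _, _, .cpair _ none _ _ A B d1 d2 =>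
      .llam (.csum (cpsC R A) (cpsC R B))
        (.ccase .svar (.lapp (cps R d1) .svar) (.lapp (cps R d2) .svar))
  | _, _, _, _, .cpair _ (some _) _ _ _ _ d1 d2 => .ccase .svar (cps R d1) (cps R d2)
  | _, _, _, _, .cfst _ none _ A _ d => .llam (cpsC R A) (.lapp (cps R d) (.cinl .svar))
  | _, _, _, _, .cfst _ (some _) _ _ _ d => Tm.ssubst (.cinl .svar) (cps R d)
  | _, _, _, _, .csnd _ none _ _ B d => .llam (cpsC R B) (.lapp (cps R d) (.cinr .svar))
  | _, _, _, _, .csnd _ (some _) _ _ _ d => Tm.ssubst (.cinr .svar) (cps R d)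
  | _, _, _, _, .clam _ none _ A B d =>
      .llam (.copow (cpsV R A) (cpsC R B)) (.copowlet .svar (.lapp (cps R d) .svar))
  | _, _, _, _, .clam _ (some _) _ _ _ d => .copowlet .svar (cps R d)
  | _, _, _, _, .capp _ none _ _ _ B d1 d2 =>
      .llam (cpsC R B) (.lapp (cps R d1) (.copow (cps R d2) .svar))
  | _, _, _, _, .capp _ (some _) _ _ _ _ d1 d2 =>
      Tm.ssubst (.copow (cps R d2) .svar) (cps R d1)
  | _, _, _, _, .top _ => .llam R .svar
  | _, _, _, _, .ilet _ none _ _ A d1 d2 =>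
      .llam (cpsC R A) (.lapp (cps R d1) (.lapp (cps R d2) .svar))
  | _, _, _, _, .ilet _ (some _) _ _ _ d1 d2 =>
      Tm.ssubst (.lapp (cps R d2) .svar) (cps R d1)
  | _, _, _, _, .bang _ _ A d => .llam (.carr (cpsV R A) R) (.capp .svar (cps R d))
  | _, _, _, _, .banglet _ none _ _ A B d1 d2 =>
      .llam (cpsC R B) (.lapp (cps R d1) (.clam (cpsV R A) (.lapp (cps R d2) .svar)))
  | _, _, _, _, .banglet _ (some _) _ _ A _ d1 d2 =>
      Tm.ssubst (.clam (cpsV R A) (.lapp (cps R d2) .svar)) (cps R d1)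
  | _, _, _, _, .copow _ none _ _ A B d1 d2 =>
      .llam (.carr (cpsV R A) (cpsC R B)) (.lapp (cps R d2) (.capp .svar (cps R d1)))
  | _, _, _, _, .copow _ (some _) _ _ _ _ d1 d2 =>
      Tm.ssubst (.capp .svar (cps R d1)) (cps R d2)
  | _, _, _, _, .copowlet _ none _ _ A _ C d1 d2 =>
      .llam (cpsC R C) (.lapp (cps R d1) (.clam (cpsV R A) (cps R d2)))
  | _, _, _, _, .copowlet _ (some _) _ _ A _ _ d1 d2 =>
      Tm.ssubst (.clam (cpsV R A) (cps R d2)) (cps R d1)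
  | _, _, _, _, .cimage _ none _ A d => .llam (cpsC R A) (.lapp (cps R d) .cunit)
  | _, _, _, _, .cimage _ (some _) _ _ d => Tm.ssubst .cunit (cps R d)
  | _, _, _, _, .cinl _ none _ A B d =>
      .llam (.cand (cpsC R A) (cpsC R B)) (.lapp (cps R d) (.cfst .svar))
  | _, _, _, _, .cinl _ (some _) _ _ _ d => Tm.ssubst (.cfst .svar) (cps R d)
  | _, _, _, _, .cinr _ none _ A B d =>
      .llam (.cand (cpsC R A) (cpsC R B)) (.lapp (cps R d) (.csnd .svar))
  | _, _, _, _, .cinr _ (some _) _ _ _ d => Tm.ssubst (.csnd .svar) (cps R d)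
  | _, _, _, _, .ccase _ none _ _ _ _ _ C d1 d2 d3 =>
      .llam (cpsC R C) (.lapp (cps R d1) (.cpair (cps R d2) (cps R d3)))
  | _, _, _, _, .ccase _ (some _) _ _ _ _ _ _ d1 d2 d3 =>
      Tm.ssubst (.cpair (cps R d2) (cps R d3)) (cps R d1)
  | _, _, _, _, .llam _ _ _ B d => .llam (cpsC R B) (cps R d)
  | _, _, _, _, .lapp _ none _ _ _ B d1 d2 =>
      .llam (cpsC R B) (.lapp (cps R d2) (.lapp (cps R d1) .svar))
  | _, _, _, _, .lapp _ (some _) _ _ _ _ d1 d2 =>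
      Tm.ssubst (.lapp (cps R d1) .svar) (cps R d2)

end EEC

namespace EEC

/-! ## The type isomorphisms `ι` of Figure 7, with explicit inverses -/

mutual
  /-- The closed term `ι_A : (Aᶜ)ᶜ → A` (Figure 7). -/
  def iotaV (R : CType) : VType → Tm
    | .base a => .vlam (.base a) (.var 0)
    | .unit => .vlam .unit .unit
    | .prod A B => .vlam (cpsV R (cpsV R (.prod A B)))
        (.vpair (.vapp (iotaV R A) (.vfst (.var 0))) (.vapp (iotaV R B) (.vsnd (.var 0))))
    | .arr A B => .vlam (cpsV R (cpsV R (.arr A B)))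
        (.vlam A (.vapp (iotaV R B) (.vapp (.var 1) (.vapp (iotaVinv R A) (.var 0)))))
    | .comp A => .vlam (cpsV R (cpsV R (.comp A)))
        (.lapp (iotaC R A) (.lapp (.var 0) .top))
    | .lin A B => .vlam (cpsV R (cpsV R (.lin A B)))
        (.llam A (.lapp (iotaC R B) (.lapp (.var 0) (.lapp (iotaCinv R A) .svar))))
  /-- The closed term `ι_A⁻¹ : A → (Aᶜ)ᶜ`. -/
  def iotaVinv (R : CType) : VType → Tm
    | .base a => .vlam (.base a) (.var 0)
    | .unit => .vlam .unit .unit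
    | .prod A B => .vlam (.prod A B)
        (.vpair (.vapp (iotaVinv R A) (.vfst (.var 0))) (.vapp (iotaVinv R B) (.vsnd (.var 0))))
    | .arr A B => .vlam (.arr A B)
        (.vlam (cpsV R (cpsV R A)) (.vapp (iotaVinv R B) (.vapp (.var 1) (.vapp (iotaV R A) (.var 0)))))
    | .comp A => .vlam (.comp A)
        (.llam .iunit (.ilet .svar (.lapp (iotaCinv R A) (.var 0))))
    | .lin A B => .vlam (.lin A B)
        (.llam (cpsC R (cpsC R A)) (.lapp (iotaCinv R B) (.lapp (.var 0) (.lapp (iotaC R A) .svar))))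
  /-- The closed term `ι_A̲ : (A̲ᶜ)ᶜ ⊸ A̲` (Figure 7). -/
  def iotaC (R : CType) : CType → Tm
    | .base a => .llam (cpsC R (cpsC R (.base a))) .svar
    | .cunit => .llam (cpsC R (cpsC R .cunit)) .cunit
    | .cand A B => .llam (cpsC R (cpsC R (.cand A B)))
        (.cpair (.lapp (iotaC R A) (.cfst .svar)) (.lapp (iotaC R B) (.csnd .svar)))
    | .carr A B => .llam (cpsC R (cpsC R (.carr A B)))
        (.clam A (.lapp (iotaC R B) (.capp .svar (.vapp (iotaVinv R A) (.var 0)))))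
    | .iunit => .llam (cpsC R (cpsC R .iunit)) .svar
    | .bang A => .llam (cpsC R (cpsC R (.bang A)))
        (.copowlet .svar (.ilet .svar (.bang (.vapp (iotaV R A) (.var 0)))))
    | .copow A B => .llam (cpsC R (cpsC R (.copow A B)))
        (.copowlet .svar (.copow (.vapp (iotaV R A) (.var 0)) (.lapp (iotaC R B) .svar)))
    | .czero => .llam (cpsC R (cpsC R .czero)) .svar
    | .csum A B => .llam (cpsC R (cpsC R (.csum A B)))
        (.ccase .svar (.cinl (.lapp (iotaC R A) .svar)) (.cinr (.lapp (iotaC R B) .svar)))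
  /-- The closed term `ι_A̲⁻¹ : A̲ ⊸ (A̲ᶜ)ᶜ`. -/
  def iotaCinv (R : CType) : CType → Tm
    | .base a => .llam (.base a) .svar
    | .cunit => .llam .cunit .cunit
    | .cand A B => .llam (.cand A B)
        (.cpair (.lapp (iotaCinv R A) (.cfst .svar)) (.lapp (iotaCinv R B) (.csnd .svar)))
    | .carr A B => .llam (.carr A B)
        (.clam (cpsV R (cpsV R A)) (.lapp (iotaCinv R B) (.capp .svar (.vapp (iotaV R A) (.var 0)))))
    | .iunit => .llam .iunit .svar
    | .bang A => .llam (.bang A)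
        (.banglet .svar (.copow (.vapp (iotaVinv R A) (.var 0)) .top))
    | .copow A B => .llam (.copow A B)
        (.copowlet .svar (.copow (.vapp (iotaVinv R A) (.var 0)) (.lapp (iotaCinv R B) .svar)))
    | .czero => .llam .czero .svar
    | .csum A B => .llam (.csum A B)
        (.ccase .svar (.cinl (.lapp (iotaCinv R A) .svar)) (.cinr (.lapp (iotaCinv R B) .svar)))
end

/-- The substitution `[ι⁻¹(Γ)]`, replacing each variable `xᵢ : Cᵢ` of `Γ` by
`ι_{Cᵢ}⁻¹(xᵢ)`. -/
def iotaSubst (R : CType) (Γ : List VType) (t : Tm) : Tm :=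
  Tm.psubst (fun n =>
    match Γ[n]? with
    | some C => .vapp (iotaVinv R C) (.var n)
    | none => .var n) t

/-! ## The simply-typed λ-calculus -/

/-- Simple types. -/
inductive STy : Type
  | base : ℕ → STy
  | unit : STy
  | prod : STy → STy → STy
  | arr : STy → STy → STy

/-- Raw simply-typed λ-terms (de Bruijn indices). -/
inductive LTm : Type
  | var : ℕ → LTm
  | unit : LTm
  | pair : LTm → LTm → LTm
  | fst : LTm → LTm
  | snd : LTm → LTm
  | lam : STy → LTm → LTm
  | app : LTm → LTm → LTm

namespace LTm

/-- Renaming of variables. -/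
def rename (f : ℕ → ℕ) : LTm → LTm
  | .var n => .var (f n)
  | .unit => .unit
  | .pair M N => .pair (rename f M) (rename f N)
  | .fst M => .fst (rename f M)
  | .snd M => .snd (rename f M)
  | .lam σ M => .lam σ (rename (Tm.liftN f) M)
  | .app M N => .app (rename f M) (rename f N)

/-- Weakening. -/
def shift (M : LTm) : LTm := rename Nat.succ M

/-- Parallel capture-avoiding substitution. -/
def psubst (σ : ℕ → LTm) : LTm → LTm
  | .var n => σ n
  | .unit => .unit
  | .pair M N => .pair (psubst σ M) (psubst σ N)
  | .fst M => .fst (psubst σ M)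
  | .snd M => .snd (psubst σ M)
  | .lam τ M => .lam τ (psubst (fun n => match n with | 0 => .var 0 | m + 1 => shift (σ m)) M)
  | .app M N => .app (psubst σ M) (psubst σ N)

/-- Capture-avoiding substitution `M[N/x]` for the innermost variable. -/
def subst0 (N : LTm) (M : LTm) : LTm :=
  psubst (fun n => match n with | 0 => N | m + 1 => .var m) M

end LTm

/-- Typing derivations of the simply-typed λ-calculus (Figure 3). -/
inductive LDeriv : List STy → LTm → STy → Type
  | var (Θ : List STy) (n : ℕ) (σ : STy) : Θ[n]? = some σ → LDeriv Θ (.var n) σ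
  | unit (Θ : List STy) : LDeriv Θ .unit .unit
  | pair (Θ : List STy) (M N : LTm) (σ τ : STy) :
      LDeriv Θ M σ → LDeriv Θ N τ → LDeriv Θ (.pair M N) (.prod σ τ)
  | fst (Θ : List STy) (M : LTm) (σ τ : STy) :
      LDeriv Θ M (.prod σ τ) → LDeriv Θ (.fst M) σ
  | snd (Θ : List STy) (M : LTm) (σ τ : STy) :
      LDeriv Θ M (.prod σ τ) → LDeriv Θ (.snd M) τ
  | lam (Θ : List STy) (M : LTm) (σ τ : STy) :
      LDeriv (σ :: Θ) M τ → LDeriv Θ (.lam σ M) (.arr σ τ)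
  | app (Θ : List STy) (M N : LTm) (σ τ : STy) :
      LDeriv Θ M (.arr σ τ) → LDeriv Θ N σ → LDeriv Θ (.app M N) τ

/-- Values of the (call-by-value) λ-calculus. -/
inductive LVal : LTm → Prop
  | var (n : ℕ) : LVal (.var n)
  | unit : LVal .unit
  | lam (σ : STy) (M : LTm) : LVal (.lam σ M)
  | pair {M N : LTm} : LVal M → LVal N → LVal (.pair M N)

/-- βη-equality of the simply-typed λ-calculus. -/
inductive LBetaEta : List STy → LTm → LTm → STy → Prop
  | refl {Θ M σ} : LDeriv Θ M σ → LBetaEta Θ M M σ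
  | symm {Θ M N σ} : LBetaEta Θ M N σ → LBetaEta Θ N M σ
  | trans {Θ M N P σ} : LBetaEta Θ M N σ → LBetaEta Θ N P σ → LBetaEta Θ M P σ
  | pair_cong {Θ M M' N N' σ τ} : LBetaEta Θ M M' σ → LBetaEta Θ N N' τ →
      LBetaEta Θ (.pair M N) (.pair M' N') (.prod σ τ)
  | fst_cong {Θ M M' σ τ} : LBetaEta Θ M M' (.prod σ τ) → LBetaEta Θ (.fst M) (.fst M') σ
  | snd_cong {Θ M M' σ τ} : LBetaEta Θ M M' (.prod σ τ) → LBetaEta Θ (.snd M) (.snd M') τ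
  | lam_cong {Θ M M' σ τ} : LBetaEta (σ :: Θ) M M' τ →
      LBetaEta Θ (.lam σ M) (.lam σ M') (.arr σ τ)
  | app_cong {Θ M M' N N' σ τ} : LBetaEta Θ M M' (.arr σ τ) → LBetaEta Θ N N' σ →
      LBetaEta Θ (.app M N) (.app M' N') τ
  | beta {Θ M N σ τ} : LDeriv (σ :: Θ) M τ → LDeriv Θ N σ →
      LBetaEta Θ (.app (.lam σ M) N) (LTm.subst0 N M) τ
  | eta {Θ M σ τ} : LDeriv Θ M (.arr σ τ) →
      LBetaEta Θ (.lam σ (.app (LTm.shift M) (.var 0))) M (.arr σ τ)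
  | fst_beta {Θ M N σ τ} : LDeriv Θ M σ → LDeriv Θ N τ →
      LBetaEta Θ (.fst (.pair M N)) M σ
  | snd_beta {Θ M N σ τ} : LDeriv Θ M σ → LDeriv Θ N τ →
      LBetaEta Θ (.snd (.pair M N)) N τ
  | pair_eta {Θ M σ τ} : LDeriv Θ M (.prod σ τ) →
      LBetaEta Θ (.pair (.fst M) (.snd M)) M (.prod σ τ)
  | unit_eta {Θ M} : LDeriv Θ M .unit → LBetaEta Θ M .unit .unit

/-- Equality in Moggi's computational λ-calculus `λc` (call-by-value
βη-equalities restricted to values, together with the `let`-laws, expressed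
via the standard encoding `let x = M in N := (λx.N) M`). -/
inductive LamC : List STy → LTm → LTm → STy → Prop
  | refl {Θ M σ} : LDeriv Θ M σ → LamC Θ M M σ
  | symm {Θ M N σ} : LamC Θ M N σ → LamC Θ N M σ
  | trans {Θ M N P σ} : LamC Θ M N σ → LamC Θ N P σ → LamC Θ M P σ
  | pair_cong {Θ M M' N N' σ τ} : LamC Θ M M' σ → LamC Θ N N' τ →
      LamC Θ (.pair M N) (.pair M' N') (.prod σ τ)
  | fst_cong {Θ M M' σ τ} : LamC Θ M M' (.prod σ τ) → LamC Θ (.fst M) (.fst M') σ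
  | snd_cong {Θ M M' σ τ} : LamC Θ M M' (.prod σ τ) → LamC Θ (.snd M) (.snd M') τ
  | lam_cong {Θ M M' σ τ} : LamC (σ :: Θ) M M' τ →
      LamC Θ (.lam σ M) (.lam σ M') (.arr σ τ)
  | app_cong {Θ M M' N N' σ τ} : LamC Θ M M' (.arr σ τ) → LamC Θ N N' σ →
      LamC Θ (.app M N) (.app M' N') τ
  | beta_v {Θ M V σ τ} : LDeriv (σ :: Θ) M τ → LDeriv Θ V σ → LVal V →
      LamC Θ (.app (.lam σ M) V) (LTm.subst0 V M) τ
  | eta_v {Θ V σ τ} : LVal V → LDeriv Θ V (.arr σ τ) →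
      LamC Θ (.lam σ (.app (LTm.shift V) (.var 0))) V (.arr σ τ)
  | fst_beta_v {Θ V W σ τ} : LVal V → LVal W → LDeriv Θ V σ → LDeriv Θ W τ →
      LamC Θ (.fst (.pair V W)) V σ
  | snd_beta_v {Θ V W σ τ} : LVal V → LVal W → LDeriv Θ V σ → LDeriv Θ W τ →
      LamC Θ (.snd (.pair V W)) W τ
  | pair_eta_v {Θ V σ τ} : LVal V → LDeriv Θ V (.prod σ τ) →
      LamC Θ (.pair (.fst V) (.snd V)) V (.prod σ τ)
  | unit_eta_v {Θ V} : LVal V → LDeriv Θ V .unit → LamC Θ V .unit .unit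
  | let_eta {Θ M σ} : LDeriv Θ M σ → LamC Θ (.app (.lam σ (.var 0)) M) M σ
  | let_assoc {Θ M N L σ ρ τ} : LDeriv (σ :: Θ) M τ → LDeriv (ρ :: Θ) N σ →
      LDeriv Θ L ρ →
      LamC Θ (.app (.lam σ M) (.app (.lam ρ N) L))
        (.app (.lam ρ (.app (.lam σ (LTm.rename (Tm.liftN Nat.succ) M)) N)) L) τ
  | app_left {Θ M N σ τ} : LDeriv Θ M (.arr σ τ) → LDeriv Θ N σ →
      LamC Θ (.app M N) (.app (.lam (.arr σ τ) (.app (.var 0) (LTm.shift N))) M) τ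
  | app_right {Θ V N σ τ} : LVal V → LDeriv Θ V (.arr σ τ) → LDeriv Θ N σ →
      LamC Θ (.app V N) (.app (.lam σ (.app (LTm.shift V) (.var 0))) N) τ
  | pair_left {Θ M N σ τ} : LDeriv Θ M σ → LDeriv Θ N τ →
      LamC Θ (.pair M N) (.app (.lam σ (.pair (.var 0) (LTm.shift N))) M) (.prod σ τ)
  | pair_right {Θ V N σ τ} : LVal V → LDeriv Θ V σ → LDeriv Θ N τ →
      LamC Θ (.pair V N) (.app (.lam τ (.pair (LTm.shift V) (.var 0))) N) (.prod σ τ)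
  | fst_cc {Θ M σ τ} : LDeriv Θ M (.prod σ τ) →
      LamC Θ (.fst M) (.app (.lam (.prod σ τ) (.fst (.var 0))) M) σ
  | snd_cc {Θ M σ τ} : LDeriv Θ M (.prod σ τ) →
      LamC Θ (.snd M) (.app (.lam (.prod σ τ) (.snd (.var 0))) M) τ

end EEC

namespace EEC

/-! ## The standard cbv and cbn translations of typed λ-calculus into EEC -/

/-- The computation-type constant `α̲` associated with a simply-typed
λ-calculus type constant `α` (the association is injective but not
surjective, so that some computation-type constants of EEC are different
from `α̲` for every λ-calculus type constant `α`). -/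
def assocC (a : ℕ) : CType := .base (a + 1)

/-- The call-by-value translation `σᵛ` on types. -/
def cbvT : STy → VType
  | .base a => .base a
  | .unit => .unit
  | .prod σ τ => .prod (cbvT σ) (cbvT τ)
  | .arr σ τ => .arr (cbvT σ) (.comp (.bang (cbvT τ)))

/-- The call-by-value translation `Θᵛ` on contexts. -/
def cbvCtx (Θ : List STy) : List VType := Θ.map cbvT

/-- The call-by-value translation on terms: `Θ ⊢ M : τ` is sent to
`Θᵛ ⊢ Mᵛ : !(τᵛ)`. -/
def cbvTm : LTm → Tm
  | .var n => .bang (.var n)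
  | .unit => .bang .unit
  | .pair M N => .banglet (cbvTm M) (.banglet (Tm.shift (cbvTm N)) (.bang (.vpair (.var 1) (.var 0))))
  | .fst M => .banglet (cbvTm M) (.bang (.vfst (.var 0)))
  | .snd M => .banglet (cbvTm M) (.bang (.vsnd (.var 0)))
  | .lam σ M => .bang (.vlam (cbvT σ) (cbvTm M))
  | .app M N => .banglet (cbvTm M) (.banglet (Tm.shift (cbvTm N)) (.vapp (.var 1) (.var 0)))

/-- The call-by-name translation `σⁿ` on types. -/
def cbnT : STy → CType
  | .base a => assocC a
  | .unit => .cunit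
  | .prod σ τ => .cand (cbnT σ) (cbnT τ)
  | .arr σ τ => .carr (.comp (cbnT σ)) (cbnT τ)

/-- The call-by-name translation `Θⁿ` on contexts. -/
def cbnCtx (Θ : List STy) : List VType := Θ.map (fun σ => .comp (cbnT σ))

/-- The call-by-name translation on terms: `Θ ⊢ M : τ` is sent to
`Θⁿ ⊢ Mⁿ : τⁿ`, mimicking each construct by the corresponding
computation-type construct of EEC. -/
def cbnTm : LTm → Tm
  | .var n => .var n
  | .unit => .cunit
  | .pair M N => .cpair (cbnTm M) (cbnTm N)
  | .fst M => .cfst (cbnTm M)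
  | .snd M => .csnd (cbnTm M)
  | .lam σ M => .clam (.comp (cbnT σ)) (cbnTm M)
  | .app M N => .capp (cbnTm M) (cbnTm N)

/-! ## Hasegawa's linear-use CPS translations (Section 4) -/

/-- The call-by-value linear-use CPS translation `σᵛᶜ` on types. -/
def cbvcpsT (R : CType) : STy → VType
  | .base a => .base a
  | .unit => .unit
  | .prod σ τ => .prod (cbvcpsT R σ) (cbvcpsT R τ)
  | .arr σ τ => .arr (cbvcpsT R σ) (.lin (.carr (cbvcpsT R τ) R) R)

/-- `Θᵛᶜ`. -/
def cbvcpsCtx (R : CType) (Θ : List STy) : List VType := Θ.map (cbvcpsT R)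

/-- The call-by-value linear-use CPS translation on terms: `Θ ⊢ M : τ` is
sent to `Θᵛᶜ ⊢ Mᵛᶜ : (τᵛᶜ ⇒ R̲) ⊸ R̲`. -/
def cbvcps (R : CType) : {Θ : List STy} → {M : LTm} → {σ : STy} → LDeriv Θ M σ → Tm
  | _, _, _, .var _ n σ _ => .llam (.carr (cbvcpsT R σ) R) (.capp .svar (.var n))
  | _, _, _, .unit _ => .llam (.carr .unit R) (.capp .svar .unit)
  | _, _, _, .pair _ _ _ σ τ dM dN =>
      .llam (.carr (.prod (cbvcpsT R σ) (cbvcpsT R τ)) R)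
        (.lapp (cbvcps R dM)
          (.clam (cbvcpsT R σ)
            (.lapp (Tm.shift (cbvcps R dN))
              (.clam (cbvcpsT R τ) (.capp .svar (.vpair (.var 1) (.var 0)))))))
  | _, _, _, .fst _ _ σ τ dM =>
      .llam (.carr (cbvcpsT R σ) R)
        (.lapp (cbvcps R dM)
          (.clam (.prod (cbvcpsT R σ) (cbvcpsT R τ)) (.capp .svar (.vfst (.var 0)))))
  | _, _, _, .snd _ _ σ τ dM =>
      .llam (.carr (cbvcpsT R τ) R)
        (.lapp (cbvcps R dM)
          (.clam (.prod (cbvcpsT R σ) (cbvcpsT R τ)) (.capp .svar (.vsnd (.var 0)))))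
  | _, _, _, .lam _ _ σ τ dM =>
      .llam (.carr (.arr (cbvcpsT R σ) (.lin (.carr (cbvcpsT R τ) R) R)) R)
        (.capp .svar (.vlam (cbvcpsT R σ) (cbvcps R dM)))
  | _, _, _, .app _ _ _ σ τ dM dN =>
      .llam (.carr (cbvcpsT R τ) R)
        (.lapp (cbvcps R dM)
          (.clam (.arr (cbvcpsT R σ) (.lin (.carr (cbvcpsT R τ) R) R))
            (.lapp (Tm.shift (cbvcps R dN))
              (.clam (cbvcpsT R σ) (.lapp (.vapp (.var 1) (.var 0)) .svar)))))

/-- The call-by-name linear-use CPS translation `σⁿᶜ` on types. -/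
def cbncpsT (R : CType) : STy → CType
  | .base a => assocC a
  | .unit => .czero
  | .prod σ τ => .csum (cbncpsT R σ) (cbncpsT R τ)
  | .arr σ τ => .copow (.lin (cbncpsT R σ) R) (cbncpsT R τ)

/-- `Θⁿᶜ ⊸ R̲`, assigning each variable `xᵢ : σᵢ` the type `σᵢⁿᶜ ⊸ R̲`. -/
def cbncpsCtx (R : CType) (Θ : List STy) : List VType :=
  Θ.map (fun σ => .lin (cbncpsT R σ) R)

/-- The call-by-name linear-use CPS translation on terms: `Θ ⊢ M : τ` is
sent to `Θⁿᶜ ⊸ R̲ ⊢ Mⁿᶜ : τⁿᶜ ⊸ R̲`. -/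
def cbncps (R : CType) : {Θ : List STy} → {M : LTm} → {σ : STy} → LDeriv Θ M σ → Tm
  | _, _, _, .var _ n _ _ => .var n
  | _, _, _, .unit _ => .llam .czero (.cimage R .svar)
  | _, _, _, .pair _ _ _ σ τ dM dN =>
      .llam (.csum (cbncpsT R σ) (cbncpsT R τ))
        (.ccase .svar (.lapp (cbncps R dM) .svar) (.lapp (cbncps R dN) .svar))
  | _, _, _, .fst _ _ σ _τ dM => .llam (cbncpsT R σ) (.lapp (cbncps R dM) (.cinl .svar))
  | _, _, _, .snd _ _ _ τ dM => .llam (cbncpsT R τ) (.lapp (cbncps R dM) (.cinr .svar))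
  | _, _, _, .lam _ _ σ τ dM =>
      .llam (.copow (.lin (cbncpsT R σ) R) (cbncpsT R τ))
        (.copowlet .svar (.lapp (cbncps R dM) .svar))
  | _, _, _, .app _ _ _ σ τ dM dN =>
      .llam (cbncpsT R τ) (.lapp (cbncps R dM) (.copow (cbncps R dN) .svar))

end EEC

namespace EEC

/-! ## Simultaneous substitution -/

namespace Tm

/-- Simultaneous substitution of `σ` for the value variables and of `u` for the stoup variable. -/
def full (σ : ℕ → Tm) (u : Tm) : Tm → Tm
  | .var n => σ n
  | .svar => u
  | .unit => .unit
  | .vpair t t' => .vpair (full σ u t) (full σ u t')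
  | .vfst t => .vfst (full σ u t)
  | .vsnd t => .vsnd (full σ u t)
  | .vlam A t => .vlam A (full (liftS σ) (shift u) t)
  | .vapp s t => .vapp (full σ u s) (full σ u t)
  | .cunit => .cunit
  | .cpair t t' => .cpair (full σ u t) (full σ u t')
  | .cfst t => .cfst (full σ u t)
  | .csnd t => .csnd (full σ u t)
  | .clam A t => .clam A (full (liftS σ) (shift u) t)
  | .capp s t => .capp (full σ u s) (full σ u t)
  | .top => .top
  | .ilet t t' => .ilet (full σ u t) (full σ u t')
  | .bang t => .bang (full σ u t)
  | .banglet t t' => .banglet (full σ u t) (full (liftS σ) (shift u) t')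
  | .copow t t' => .copow (full σ u t) (full σ u t')
  | .copowlet s t => .copowlet (full σ u s) (full (liftS σ) .svar t)
  | .cimage A t => .cimage A (full σ u t)
  | .cinl t => .cinl (full σ u t)
  | .cinr t => .cinr (full σ u t)
  | .ccase s t t' => .ccase (full σ u s) (full σ .svar t) (full σ .svar t')
  | .llam A t => .llam A (full σ .svar t)
  | .lapp s t => .lapp (full σ u s) (full σ u t)

/-- The substitution sending the innermost variable to `u` and fixing the others. -/
def scons (u : Tm) : ℕ → Tm
  | 0 => u
  | n + 1 => .var n

@[simp] theorem scons_zero (u : Tm) : scons u 0 = u := rfl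

@[simp] theorem scons_succ (u : Tm) (n : ℕ) : scons u (n + 1) = .var n := rfl

@[simp] theorem liftS_zero (σ : ℕ → Tm) : liftS σ 0 = .var 0 := rfl

@[simp] theorem liftS_succ (σ : ℕ → Tm) (n : ℕ) : liftS σ (n + 1) = shift (σ n) := rfl

@[simp] theorem liftN_zero (f : ℕ → ℕ) : liftN f 0 = 0 := rfl

@[simp] theorem liftN_succ (f : ℕ → ℕ) (n : ℕ) : liftN f (n + 1) = f n + 1 := rfl

@[simp] theorem shift_svar : shift .svar = .svar := rfl

@[simp] theorem shift_var (n : ℕ) : shift (.var n) = .var (n + 1) := rfl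

theorem liftN_comp (f g : ℕ → ℕ) (n : ℕ) : liftN g (liftN f n) = liftN (fun n => g (f n)) n := by
  cases n <;> rfl

theorem rename_rename (f g : ℕ → ℕ) (t : Tm) :
    rename g (rename f t) = rename (fun n => g (f n)) t := by
  induction t generalizing f g <;> simp_all [rename, liftN_comp]

theorem rename_shift (f : ℕ → ℕ) (t : Tm) :
    rename (liftN f) (shift t) = shift (rename f t) := by
  simp [shift, rename_rename]

theorem liftS_liftN (σ : ℕ → Tm) (f : ℕ → ℕ) :
    (fun n => liftS σ (liftN f n)) = liftS (fun n => σ (f n)) := by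
  funext n; cases n <;> rfl

theorem full_rename (σ : ℕ → Tm) (u : Tm) (f : ℕ → ℕ) (t : Tm) :
    full σ u (rename f t) = full (fun n => σ (f n)) u t := by
  induction t generalizing σ u f <;> simp_all [rename, full, liftS_liftN]

theorem full_shift (σ : ℕ → Tm) (u : Tm) (t : Tm) :
    full σ u (shift t) = full (fun n => σ (n + 1)) u t := full_rename ..

theorem rename_liftS (σ : ℕ → Tm) (f : ℕ → ℕ) :
    (fun n => rename (liftN f) (liftS σ n)) = liftS (fun n => rename f (σ n)) := by
  funext n
  cases n with
  | zero => rfl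
  | succ n => exact rename_shift f (σ n)

theorem rename_full (σ : ℕ → Tm) (u : Tm) (f : ℕ → ℕ) (t : Tm) :
    rename f (full σ u t) = full (fun n => rename f (σ n)) (rename f u) t := by
  induction t generalizing σ u f <;> simp_all [rename, full, rename_liftS, rename_shift]

theorem shift_full (σ : ℕ → Tm) (u t : Tm) :
    shift (full σ u t) = full (fun n => shift (σ n)) (shift u) t := rename_full ..

theorem full_liftS_shift (σ : ℕ → Tm) (u t : Tm) :
    full (liftS σ) (shift u) (shift t) = shift (full σ u t) := by
  simp [full_shift, shift_full]

theorem full_liftS_shift' (σ : ℕ → Tm) (t : Tm) :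
    full (liftS σ) .svar (shift t) = shift (full σ .svar t) := full_liftS_shift σ .svar t

@[simp] theorem liftS_var : liftS .var = .var := by
  funext n; cases n <;> rfl

@[simp] theorem full_var_svar (t : Tm) : full .var .svar t = t := by
  induction t <;> simp_all [full]

/-- A term without free occurrences of the stoup variable. -/
def SFree (t : Tm) : Prop := ∀ σ u v, full σ u t = full σ v t

theorem SFree.var (n : ℕ) : SFree (.var n) := fun _ _ _ => rfl

theorem SFree.rename {t : Tm} (h : SFree t) (f : ℕ → ℕ) : SFree (rename f t) := by
  intro σ u v
  simpa only [full_rename] using h _ u v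

theorem SFree.liftS {τ : ℕ → Tm} (h : ∀ n, SFree (τ n)) (n : ℕ) : SFree (liftS τ n) := by
  cases n with
  | zero => exact .var 0
  | succ n => exact (h n).rename _

theorem SFree.ssubst_eq {t : Tm} (h : SFree t) (u : Tm) : full .var u t = t := by
  rw [h _ _ .svar, full_var_svar]

theorem full_liftS {τ : ℕ → Tm} (σ : ℕ → Tm) (u : Tm) :
    (fun n => full (liftS σ) (shift u) (liftS τ n)) = liftS (fun n => full σ u (τ n)) := by
  funext n
  cases n with
  | zero => rfl
  | succ n => exact full_liftS_shift σ u (τ n)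

theorem full_full {τ : ℕ → Tm} (h : ∀ n, SFree (τ n)) (σ : ℕ → Tm) (u v t : Tm) :
    full σ u (full τ v t) = full (fun n => full σ u (τ n)) (full σ u v) t := by
  have e : ∀ {τ : ℕ → Tm}, (∀ n, SFree (τ n)) → ∀ (σ : ℕ → Tm) (u : Tm),
      (fun n => full σ .svar (τ n)) = fun n => full σ u (τ n) :=
    fun h σ u => funext fun n => h n σ _ _
  have e' : ∀ {τ : ℕ → Tm}, (∀ n, SFree (τ n)) → ∀ (σ : ℕ → Tm) (u : Tm),
      (fun n => full (liftS σ) .svar (liftS τ n)) = liftS fun n => full σ u (τ n) :=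
    fun h σ u => (e (SFree.liftS h) _ (shift u)).trans (full_liftS σ u)
  induction t generalizing τ σ u v with
  | copowlet s t ihs iht => simp [full, ihs h, iht (SFree.liftS h), e' h σ u]
  | ccase s t t' ihs iht iht' => simp [full, ihs h, iht h, iht' h, e h σ u]
  | llam A t ih => simp [full, ih h, e h σ u]
  | vlam A t ih => simp [full, ih (SFree.liftS h), full_liftS, full_liftS_shift]
  | clam A t ih => simp [full, ih (SFree.liftS h), full_liftS, full_liftS_shift]
  | banglet s t ihs iht =>
      simp [full, ihs h, iht (SFree.liftS h), full_liftS, full_liftS_shift]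
  | _ => simp_all [full]

theorem psubst_eq_full (σ : ℕ → Tm) (t : Tm) : psubst σ t = full σ .svar t := by
  induction t generalizing σ <;> simp_all [full, psubst]

theorem ssubst_eq_full (u t : Tm) : ssubst u t = full .var u t := by
  induction t generalizing u <;> simp_all [full, ssubst]

theorem subst0_eq_full (u t : Tm) : subst0 u t = full (scons u) .svar t := by
  rw [subst0, psubst_eq_full]
  congr 1

theorem rename_eq_full (f : ℕ → ℕ) (t : Tm) : rename f t = full (fun n => .var (f n)) .svar t := by
  have := rename_full .var .svar f t
  simpa [rename] using this

@[simp] theorem full_scons_shift (a u t : Tm) : full (scons a) u (shift t) = full .var u t := by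
  simp [full_shift]

/-- Replace all type annotations by a fixed one. -/
def erase : Tm → Tm
  | .var n => .var n
  | .svar => .svar
  | .unit => .unit
  | .vpair t u => .vpair (erase t) (erase u)
  | .vfst t => .vfst (erase t)
  | .vsnd t => .vsnd (erase t)
  | .vlam _ t => .vlam .unit (erase t)
  | .vapp s t => .vapp (erase s) (erase t)
  | .cunit => .cunit
  | .cpair t u => .cpair (erase t) (erase u)
  | .cfst t => .cfst (erase t)
  | .csnd t => .csnd (erase t)
  | .clam _ t => .clam .unit (erase t)
  | .capp s t => .capp (erase s) (erase t)
  | .top => .top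
  | .ilet t u => .ilet (erase t) (erase u)
  | .bang t => .bang (erase t)
  | .banglet t u => .banglet (erase t) (erase u)
  | .copow t u => .copow (erase t) (erase u)
  | .copowlet s t => .copowlet (erase s) (erase t)
  | .cimage _ t => .cimage .cunit (erase t)
  | .cinl t => .cinl (erase t)
  | .cinr t => .cinr (erase t)
  | .ccase s t u => .ccase (erase s) (erase t) (erase u)
  | .llam _ t => .llam .cunit (erase t)
  | .lapp s t => .lapp (erase s) (erase t)

@[simp] theorem erase_erase (t : Tm) : erase (erase t) = erase t := by
  induction t <;> simp_all [erase]

theorem erase_rename (f : ℕ → ℕ) (t : Tm) : erase (rename f t) = rename f (erase t) := by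
  induction t generalizing f <;> simp_all [erase, rename]

theorem erase_shift (t : Tm) : erase (shift t) = shift (erase t) := erase_rename _ t

theorem erase_liftS (σ : ℕ → Tm) :
    (fun n => erase (liftS σ n)) = liftS (fun n => erase (σ n)) := by
  funext n
  cases n with
  | zero => rfl
  | succ n => exact erase_rename _ _

theorem erase_full (σ : ℕ → Tm) (u t : Tm) :
    erase (full σ u t) = full (fun n => erase (σ n)) (erase u) (erase t) := by
  induction t generalizing σ u <;> simp_all [erase, full, erase_liftS, erase_shift]

theorem erase_scons (u : Tm) : (fun n => erase (scons u n)) = scons (erase u) := by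
  funext n; cases n <;> rfl

theorem erase_subst0 (u t : Tm) : erase (subst0 u t) = subst0 (erase u) (erase t) := by
  simp [subst0_eq_full, erase_full, erase_scons, erase]

theorem erase_ssubst (u t : Tm) : erase (ssubst u t) = ssubst (erase u) (erase t) := by
  simp [ssubst_eq_full, erase_full, erase]

end Tm

/-! ## Typing with and without annotations -/

/-- Typing as a proposition.  `Ty true` is inhabitedness of `Deriv`, while `Ty false` ignores the
type annotations occurring in terms. -/
inductive Ty (b : Bool) : List VType → Option CType → Tm → VType → Prop
  | var {Γ n A} : Γ[n]? = some A → Ty b Γ none (.var n) A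
  | svar {Γ A} : Ty b Γ (some A) .svar (.comp A)
  | unit {Γ} : Ty b Γ none .unit .unit
  | vpair {Γ t u A B} : Ty b Γ none t A → Ty b Γ none u B → Ty b Γ none (.vpair t u) (.prod A B)
  | vfst {Γ t A B} : Ty b Γ none t (.prod A B) → Ty b Γ none (.vfst t) A
  | vsnd {Γ t A B} : Ty b Γ none t (.prod A B) → Ty b Γ none (.vsnd t) B
  | vlam {Γ t X A B} : (b = true → X = A) → Ty b (A :: Γ) none t B →
      Ty b Γ none (.vlam X t) (.arr A B)
  | vapp {Γ s t A B} : Ty b Γ none s (.arr A B) → Ty b Γ none t A → Ty b Γ none (.vapp s t) B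
  | cunit {Γ Δ} : Ty b Γ Δ .cunit (.comp .cunit)
  | cpair {Γ Δ t u A B} : Ty b Γ Δ t (.comp A) → Ty b Γ Δ u (.comp B) →
      Ty b Γ Δ (.cpair t u) (.comp (.cand A B))
  | cfst {Γ Δ t A B} : Ty b Γ Δ t (.comp (.cand A B)) → Ty b Γ Δ (.cfst t) (.comp A)
  | csnd {Γ Δ t A B} : Ty b Γ Δ t (.comp (.cand A B)) → Ty b Γ Δ (.csnd t) (.comp B)
  | clam {Γ Δ t X A B} : (b = true → X = A) → Ty b (A :: Γ) Δ t (.comp B) →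
      Ty b Γ Δ (.clam X t) (.comp (.carr A B))
  | capp {Γ Δ s t A B} : Ty b Γ Δ s (.comp (.carr A B)) → Ty b Γ none t A →
      Ty b Γ Δ (.capp s t) (.comp B)
  | top {Γ} : Ty b Γ none .top (.comp .iunit)
  | ilet {Γ Δ t u A} : Ty b Γ Δ t (.comp .iunit) → Ty b Γ none u (.comp A) →
      Ty b Γ Δ (.ilet t u) (.comp A)
  | bang {Γ t A} : Ty b Γ none t A → Ty b Γ none (.bang t) (.comp (.bang A))
  | banglet {Γ Δ t u A B} : Ty b Γ Δ t (.comp (.bang A)) → Ty b (A :: Γ) none u (.comp B) →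
      Ty b Γ Δ (.banglet t u) (.comp B)
  | copow {Γ Δ t u A B} : Ty b Γ none t A → Ty b Γ Δ u (.comp B) →
      Ty b Γ Δ (.copow t u) (.comp (.copow A B))
  | copowlet {Γ Δ s t A B C} : Ty b Γ Δ s (.comp (.copow A B)) →
      Ty b (A :: Γ) (some B) t (.comp C) → Ty b Γ Δ (.copowlet s t) (.comp C)
  | cimage {Γ Δ t X A} : (b = true → X = A) → Ty b Γ Δ t (.comp .czero) →
      Ty b Γ Δ (.cimage X t) (.comp A)
  | cinl {Γ Δ t A B} : Ty b Γ Δ t (.comp A) → Ty b Γ Δ (.cinl t) (.comp (.csum A B))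
  | cinr {Γ Δ t A B} : Ty b Γ Δ t (.comp B) → Ty b Γ Δ (.cinr t) (.comp (.csum A B))
  | ccase {Γ Δ s t u A B C} : Ty b Γ Δ s (.comp (.csum A B)) → Ty b Γ (some A) t (.comp C) →
      Ty b Γ (some B) u (.comp C) → Ty b Γ Δ (.ccase s t u) (.comp C)
  | llam {Γ t X A B} : (b = true → X = A) → Ty b Γ (some A) t (.comp B) →
      Ty b Γ none (.llam X t) (.lin A B)
  | lapp {Γ Δ s t A B} : Ty b Γ none s (.lin A B) → Ty b Γ Δ t (.comp A) →
      Ty b Γ Δ (.lapp s t) (.comp B)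

theorem Deriv.ty {b : Bool} {Γ Δ t A} (d : Deriv Γ Δ t A) : Ty b Γ Δ t A := by
  induction d with
  | vlam => exact .vlam (fun _ => rfl) ‹_›
  | clam => exact .clam (fun _ => rfl) ‹_›
  | llam => exact .llam (fun _ => rfl) ‹_›
  | cimage => exact .cimage (fun _ => rfl) ‹_›
  | _ => constructor <;> assumption

namespace Ty

variable {b : Bool} {Γ : List VType} {Δ : Option CType} {t : Tm} {A : VType}

/-- Annotations can be completed along a typing. -/
theorem lift (h : Ty b Γ Δ t A) :
    ∃ s, Tm.erase s = Tm.erase t ∧ Nonempty (Deriv Γ Δ s A) := by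
  induction h with
  | var h => exact ⟨_, rfl, ⟨.var _ _ _ h⟩⟩
  | svar => exact ⟨_, rfl, ⟨.svar _ _⟩⟩
  | unit => exact ⟨_, rfl, ⟨.unit _⟩⟩
  | cunit => exact ⟨_, rfl, ⟨.cunit _ _⟩⟩
  | top => exact ⟨_, rfl, ⟨.top _⟩⟩
  | vfst _ ih => obtain ⟨_, e, ⟨d⟩⟩ := ih; exact ⟨.vfst _, by simp [Tm.erase, e], ⟨.vfst _ _ _ _ d⟩⟩
  | vsnd _ ih => obtain ⟨_, e, ⟨d⟩⟩ := ih; exact ⟨.vsnd _, by simp [Tm.erase, e], ⟨.vsnd _ _ _ _ d⟩⟩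
  | cfst _ ih => obtain ⟨_, e, ⟨d⟩⟩ := ih; exact ⟨.cfst _, by simp [Tm.erase, e], ⟨.cfst _ _ _ _ _ d⟩⟩
  | csnd _ ih => obtain ⟨_, e, ⟨d⟩⟩ := ih; exact ⟨.csnd _, by simp [Tm.erase, e], ⟨.csnd _ _ _ _ _ d⟩⟩
  | cinl _ ih => obtain ⟨_, e, ⟨d⟩⟩ := ih; exact ⟨.cinl _, by simp [Tm.erase, e], ⟨.cinl _ _ _ _ _ d⟩⟩
  | cinr _ ih => obtain ⟨_, e, ⟨d⟩⟩ := ih; exact ⟨.cinr _, by simp [Tm.erase, e], ⟨.cinr _ _ _ _ _ d⟩⟩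
  | bang _ ih => obtain ⟨_, e, ⟨d⟩⟩ := ih; exact ⟨.bang _, by simp [Tm.erase, e], ⟨.bang _ _ _ d⟩⟩
  | vlam _ _ ih =>
      obtain ⟨_, e, ⟨d⟩⟩ := ih; exact ⟨.vlam _ _, by simp [Tm.erase, e], ⟨.vlam _ _ _ _ d⟩⟩
  | clam _ _ ih =>
      obtain ⟨_, e, ⟨d⟩⟩ := ih; exact ⟨.clam _ _, by simp [Tm.erase, e], ⟨.clam _ _ _ _ _ d⟩⟩
  | llam _ _ ih =>
      obtain ⟨_, e, ⟨d⟩⟩ := ih; exact ⟨.llam _ _, by simp [Tm.erase, e], ⟨.llam _ _ _ _ d⟩⟩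
  | cimage _ _ ih =>
      obtain ⟨_, e, ⟨d⟩⟩ := ih; exact ⟨.cimage _ _, by simp [Tm.erase, e], ⟨.cimage _ _ _ _ d⟩⟩
  | vpair _ _ ih ih' =>
      obtain ⟨_, e, ⟨d⟩⟩ := ih; obtain ⟨_, e', ⟨d'⟩⟩ := ih'
      exact ⟨.vpair _ _, by simp [Tm.erase, e, e'], ⟨.vpair _ _ _ _ _ d d'⟩⟩
  | vapp _ _ ih ih' =>
      obtain ⟨_, e, ⟨d⟩⟩ := ih; obtain ⟨_, e', ⟨d'⟩⟩ := ih'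
      exact ⟨.vapp _ _, by simp [Tm.erase, e, e'], ⟨.vapp _ _ _ _ _ d d'⟩⟩
  | cpair _ _ ih ih' =>
      obtain ⟨_, e, ⟨d⟩⟩ := ih; obtain ⟨_, e', ⟨d'⟩⟩ := ih'
      exact ⟨.cpair _ _, by simp [Tm.erase, e, e'], ⟨.cpair _ _ _ _ _ _ d d'⟩⟩
  | capp _ _ ih ih' =>
      obtain ⟨_, e, ⟨d⟩⟩ := ih; obtain ⟨_, e', ⟨d'⟩⟩ := ih'
      exact ⟨.capp _ _, by simp [Tm.erase, e, e'], ⟨.capp _ _ _ _ _ _ d d'⟩⟩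
  | ilet _ _ ih ih' =>
      obtain ⟨_, e, ⟨d⟩⟩ := ih; obtain ⟨_, e', ⟨d'⟩⟩ := ih'
      exact ⟨.ilet _ _, by simp [Tm.erase, e, e'], ⟨.ilet _ _ _ _ _ d d'⟩⟩
  | banglet _ _ ih ih' =>
      obtain ⟨_, e, ⟨d⟩⟩ := ih; obtain ⟨_, e', ⟨d'⟩⟩ := ih'
      exact ⟨.banglet _ _, by simp [Tm.erase, e, e'], ⟨.banglet _ _ _ _ _ _ d d'⟩⟩
  | copow _ _ ih ih' =>
      obtain ⟨_, e, ⟨d⟩⟩ := ih; obtain ⟨_, e', ⟨d'⟩⟩ := ih'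
      exact ⟨.copow _ _, by simp [Tm.erase, e, e'], ⟨.copow _ _ _ _ _ _ d d'⟩⟩
  | copowlet _ _ ih ih' =>
      obtain ⟨_, e, ⟨d⟩⟩ := ih; obtain ⟨_, e', ⟨d'⟩⟩ := ih'
      exact ⟨.copowlet _ _, by simp [Tm.erase, e, e'], ⟨.copowlet _ _ _ _ _ _ _ d d'⟩⟩
  | lapp _ _ ih ih' =>
      obtain ⟨_, e, ⟨d⟩⟩ := ih; obtain ⟨_, e', ⟨d'⟩⟩ := ih'
      exact ⟨.lapp _ _, by simp [Tm.erase, e, e'], ⟨.lapp _ _ _ _ _ _ d d'⟩⟩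
  | ccase _ _ _ ih ih' ih'' =>
      obtain ⟨_, e, ⟨d⟩⟩ := ih; obtain ⟨_, e', ⟨d'⟩⟩ := ih'; obtain ⟨_, e'', ⟨d''⟩⟩ := ih''
      exact ⟨.ccase _ _ _, by simp [Tm.erase, e, e', e''], ⟨.ccase _ _ _ _ _ _ _ _ d d' d''⟩⟩

theorem deriv (h : Ty true Γ Δ t A) : Nonempty (Deriv Γ Δ t A) := by
  induction h with
  | vlam e _ ih => obtain rfl := e rfl; exact ih.elim fun d => ⟨.vlam _ _ _ _ d⟩
  | clam e _ ih => obtain rfl := e rfl; exact ih.elim fun d => ⟨.clam _ _ _ _ _ d⟩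
  | llam e _ ih => obtain rfl := e rfl; exact ih.elim fun d => ⟨.llam _ _ _ _ d⟩
  | cimage e _ ih => obtain rfl := e rfl; exact ih.elim fun d => ⟨.cimage _ _ _ _ d⟩
  | ccase _ _ _ ih ih' ih'' =>
      obtain ⟨d⟩ := ih; obtain ⟨d'⟩ := ih'; obtain ⟨d''⟩ := ih''
      exact ⟨.ccase _ _ _ _ _ _ _ _ d d' d''⟩
  | var h => exact ⟨.var _ _ _ h⟩
  | svar => exact ⟨.svar _ _⟩
  | unit => exact ⟨.unit _⟩
  | cunit => exact ⟨.cunit _ _⟩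
  | top => exact ⟨.top _⟩
  | vfst _ ih => exact ih.elim fun d => ⟨.vfst _ _ _ _ d⟩
  | vsnd _ ih => exact ih.elim fun d => ⟨.vsnd _ _ _ _ d⟩
  | cfst _ ih => exact ih.elim fun d => ⟨.cfst _ _ _ _ _ d⟩
  | csnd _ ih => exact ih.elim fun d => ⟨.csnd _ _ _ _ _ d⟩
  | cinl _ ih => exact ih.elim fun d => ⟨.cinl _ _ _ _ _ d⟩
  | cinr _ ih => exact ih.elim fun d => ⟨.cinr _ _ _ _ _ d⟩
  | bang _ ih => exact ih.elim fun d => ⟨.bang _ _ _ d⟩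
  | vpair _ _ ih ih' => exact ih.elim fun d => ih'.elim fun d' => ⟨.vpair _ _ _ _ _ d d'⟩
  | vapp _ _ ih ih' => exact ih.elim fun d => ih'.elim fun d' => ⟨.vapp _ _ _ _ _ d d'⟩
  | cpair _ _ ih ih' => exact ih.elim fun d => ih'.elim fun d' => ⟨.cpair _ _ _ _ _ _ d d'⟩
  | capp _ _ ih ih' => exact ih.elim fun d => ih'.elim fun d' => ⟨.capp _ _ _ _ _ _ d d'⟩
  | ilet _ _ ih ih' => exact ih.elim fun d => ih'.elim fun d' => ⟨.ilet _ _ _ _ _ d d'⟩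
  | banglet _ _ ih ih' => exact ih.elim fun d => ih'.elim fun d' => ⟨.banglet _ _ _ _ _ _ d d'⟩
  | copow _ _ ih ih' => exact ih.elim fun d => ih'.elim fun d' => ⟨.copow _ _ _ _ _ _ d d'⟩
  | copowlet _ _ ih ih' =>
      exact ih.elim fun d => ih'.elim fun d' => ⟨.copowlet _ _ _ _ _ _ _ d d'⟩
  | lapp _ _ ih ih' => exact ih.elim fun d => ih'.elim fun d' => ⟨.lapp _ _ _ _ _ _ d d'⟩

/-- Typing without annotations only depends on the erasure. -/
theorem of_erase_eq {s : Tm} (h : Ty b Γ Δ t A) (e : Tm.erase s = Tm.erase t) :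
    Ty false Γ Δ s A := by
  induction h generalizing s <;> cases s <;> simp only [Tm.erase, reduceCtorEq, Tm.vpair.injEq,
    Tm.vfst.injEq, Tm.vsnd.injEq, Tm.vlam.injEq, Tm.vapp.injEq, Tm.cpair.injEq, Tm.cfst.injEq,
    Tm.csnd.injEq, Tm.clam.injEq, Tm.capp.injEq, Tm.ilet.injEq, Tm.bang.injEq, Tm.banglet.injEq,
    Tm.copow.injEq, Tm.copowlet.injEq, Tm.cimage.injEq, Tm.cinl.injEq, Tm.cinr.injEq,
    Tm.ccase.injEq, Tm.llam.injEq, Tm.lapp.injEq, Tm.var.injEq, true_and] at e <;>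
    first
    | (subst e; constructor; assumption)
    | (constructor <;> first | (intro h; cases h) | (apply_assumption; first | exact e | exact e.1 | exact e.2 | exact e.2.1 | exact e.2.2))

/-- Terms typed in the empty stoup do not contain the stoup variable. -/
theorem sfree (h : Ty b Γ none t A) : Tm.SFree t := by
  generalize e : none = Δ at h
  induction h with
  | svar => cases e
  | _ => intro σ u v; subst_vars; simp_all [Tm.full, Tm.SFree] <;> grind

theorem rename {Γ' : List VType} {f : ℕ → ℕ} (h : Ty b Γ Δ t A)
    (hf : ∀ n B, Γ[n]? = some B → Γ'[f n]? = some B) : Ty b Γ' Δ (Tm.rename f t) A := by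
  have lift : ∀ {Γ Γ' : List VType} {f : ℕ → ℕ} (A),
      (∀ n B, Γ[n]? = some B → Γ'[f n]? = some B) →
      ∀ n B, (A :: Γ)[n]? = some B → (A :: Γ')[Tm.liftN f n]? = some B := by
    intro Γ Γ' f A hf n B hn
    cases n with
    | zero => simpa using hn
    | succ n => simpa using hf n B (by simpa using hn)
  induction h generalizing Γ' f with
  | var h => exact .var (hf _ _ h)
  | vlam e _ ih => exact .vlam e (ih (lift _ hf))
  | clam e _ ih => exact .clam e (ih (lift _ hf))
  | banglet _ _ ih ih' => exact .banglet (ih hf) (ih' (lift _ hf))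
  | copowlet _ _ ih ih' => exact .copowlet (ih hf) (ih' (lift _ hf))
  | _ => constructor <;> first | assumption | (apply_assumption; assumption)

theorem shift (h : Ty b Γ Δ t A) (B : VType) : Ty b (B :: Γ) Δ (Tm.shift t) A :=
  h.rename fun n C hn => by simpa using hn

end Ty

/-- `σ` is a well-typed substitution from `Γ` to `Γ'`. -/
def TySub (b : Bool) (Γ Γ' : List VType) (σ : ℕ → Tm) : Prop :=
  ∀ n A, Γ[n]? = some A → Ty b Γ' none (σ n) A

/-- `u` is a well-typed substitution from the stoup `Δ` to the stoup `Δ'`. -/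
def TyStoup (b : Bool) (Γ' : List VType) (Δ Δ' : Option CType) (u : Tm) : Prop :=
  match Δ with
  | none => Δ' = none
  | some D => Ty b Γ' Δ' u (.comp D)

theorem TySub.lift {b : Bool} {Γ Γ' : List VType} {σ : ℕ → Tm} (h : TySub b Γ Γ' σ) (A : VType) :
    TySub b (A :: Γ) (A :: Γ') (Tm.liftS σ) := by
  intro n B hn
  cases n with
  | zero => exact .var (by simpa using hn)
  | succ n => exact (h n B (by simpa using hn)).shift A

theorem TySub.var {b : Bool} {Γ : List VType} : TySub b Γ Γ .var := fun _ _ h => .var h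

theorem TySub.scons {b : Bool} {Γ : List VType} {u : Tm} {A : VType} (h : Ty b Γ none u A) :
    TySub b (A :: Γ) Γ (Tm.scons u) := by
  intro n B hn
  cases n with
  | zero => simp only [List.getElem?_cons_zero, Option.some.injEq] at hn; exact hn ▸ h
  | succ n => exact .var (by simpa using hn)

theorem TyStoup.shift {b : Bool} {Γ' : List VType} {Δ Δ' : Option CType} {u : Tm}
    (h : TyStoup b Γ' Δ Δ' u) (A : VType) : TyStoup b (A :: Γ') Δ Δ' (Tm.shift u) := by
  cases Δ with
  | none => exact h
  | some D => exact Ty.shift h A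

theorem TyStoup.svar {b : Bool} {Γ : List VType} {Δ : Option CType} : TyStoup b Γ Δ Δ .svar := by
  cases Δ with
  | none => rfl
  | some D => exact Ty.svar

theorem TyStoup.none {b : Bool} {Γ : List VType} {u : Tm} : TyStoup b Γ none none u := rfl

namespace Ty

variable {b : Bool} {Γ Γ' : List VType} {Δ Δ' : Option CType} {t u : Tm} {A : VType}

theorem full {σ : ℕ → Tm} (h : Ty b Γ Δ t A) (hσ : TySub b Γ Γ' σ) (hu : TyStoup b Γ' Δ Δ' u) :
    Ty b Γ' Δ' (Tm.full σ u t) A := by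
  induction h generalizing Γ' Δ' σ u with
  | var h => cases hu; exact hσ _ _ h
  | svar => exact hu
  | unit => cases hu; exact .unit
  | top => cases hu; exact .top
  | cunit => exact .cunit
  | vpair _ _ ih ih' => cases hu; exact .vpair (ih hσ .none) (ih' hσ .none)
  | vfst _ ih => cases hu; exact .vfst (ih hσ .none)
  | vsnd _ ih => cases hu; exact .vsnd (ih hσ .none)
  | vlam e _ ih => cases hu; exact .vlam e (ih (hσ.lift _) .none)
  | vapp _ _ ih ih' => cases hu; exact .vapp (ih hσ .none) (ih' hσ .none)
  | cpair _ _ ih ih' => exact .cpair (ih hσ hu) (ih' hσ hu)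
  | cfst _ ih => exact .cfst (ih hσ hu)
  | csnd _ ih => exact .csnd (ih hσ hu)
  | clam e _ ih => exact .clam e (ih (hσ.lift _) (hu.shift _))
  | capp _ _ ih ih' => exact .capp (ih hσ hu) (ih' hσ .none)
  | ilet _ _ ih ih' => exact .ilet (ih hσ hu) (ih' hσ .none)
  | bang _ ih => cases hu; exact .bang (ih hσ .none)
  | banglet _ _ ih ih' => exact .banglet (ih hσ hu) (ih' (hσ.lift _) .none)
  | copow _ _ ih ih' => exact .copow (ih hσ .none) (ih' hσ hu)
  | copowlet _ _ ih ih' => exact .copowlet (ih hσ hu) (ih' (hσ.lift _) .svar)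
  | cimage e _ ih => exact .cimage e (ih hσ hu)
  | cinl _ ih => exact .cinl (ih hσ hu)
  | cinr _ ih => exact .cinr (ih hσ hu)
  | ccase _ _ _ ih ih' ih'' => exact .ccase (ih hσ hu) (ih' hσ .svar) (ih'' hσ .svar)
  | llam e _ ih => cases hu; exact .llam e (ih hσ .svar)
  | lapp _ _ ih ih' => exact .lapp (ih hσ .none) (ih' hσ hu)

theorem ssubst {D : CType} (h : Ty b Γ (some D) t A) (hu : Ty b Γ Δ u (.comp D)) :
    Ty b Γ Δ (Tm.ssubst u t) A := by
  rw [Tm.ssubst_eq_full]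
  exact h.full .var hu

theorem subst0 {B : VType} (h : Ty b (B :: Γ) Δ t A) (hu : Ty b Γ none u B) :
    Ty b Γ Δ (Tm.subst0 u t) A := by
  rw [Tm.subst0_eq_full]
  exact h.full (.scons hu) .svar

end Ty

end EEC

namespace EEC

/-! ## Basic properties of the equational theory -/

namespace Tm

theorem SFree.scons {v : Tm} (hv : SFree v) (n : ℕ) : SFree (scons v n) := by
  cases n with
  | zero => exact hv
  | succ n => exact .var n

theorem SFree.full_eq {t : Tm} (h : SFree t) (u : Tm) : full .var u t = t := h.ssubst_eq u

theorem shift_full_shift (σ : ℕ → Tm) (u t : Tm) :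
    shift (full σ u t) = full (liftS σ) (shift u) (shift t) := (full_liftS_shift σ u t).symm

theorem shift_ssubst (u t : Tm) : shift (ssubst u t) = ssubst (shift u) (shift t) := by
  simpa [ssubst_eq_full] using shift_full_shift .var u t

theorem full_subst0 {σ : ℕ → Tm} (hs : ∀ n, SFree (σ n)) (u : Tm) {v : Tm} (hv : SFree v)
    (t : Tm) : full σ u (subst0 v t) = subst0 (full σ u v) (full (liftS σ) (shift u) t) := by
  rw [subst0_eq_full, subst0_eq_full, full_full (SFree.scons hv), full_full (SFree.liftS hs)]
  congr 1
  · funext n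
    cases n with
    | zero => rfl
    | succ n => simp [full, SFree.full_eq (hs n)]
  · simp [full]

theorem full_ssubst {σ : ℕ → Tm} (hs : ∀ n, SFree (σ n)) (u v t : Tm) :
    full σ u (ssubst v t) = ssubst (full σ u v) (full σ .svar t) := by
  rw [ssubst_eq_full, ssubst_eq_full, full_full SFree.var, full_full hs]
  congr 1
  funext n
  exact (SFree.full_eq (hs n) _).symm

end Tm

theorem Deriv.sfree {Γ t A} (d : Deriv Γ none t A) : Tm.SFree t := (d.ty (b := true)).sfree

/-- The derivation witnessing a typing. -/
noncomputable def Ty.toDeriv {Γ Δ t A} (h : Ty true Γ Δ t A) : Deriv Γ Δ t A := h.deriv.some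

namespace EEq

/-- Both sides of an equation are well-typed. -/
theorem ty {Γ Δ t t' A} (h : EEq Γ Δ t t' A) : Ty true Γ Δ t A ∧ Ty true Γ Δ t' A := by
  induction h with
  | refl d => exact ⟨d.ty, d.ty⟩
  | symm _ ih => exact ih.symm
  | trans _ _ ih ih' => exact ⟨ih.1, ih'.2⟩
  | vlam_cong _ ih => exact ⟨.vlam (fun _ => rfl) ih.1, .vlam (fun _ => rfl) ih.2⟩
  | clam_cong _ ih => exact ⟨.clam (fun _ => rfl) ih.1, .clam (fun _ => rfl) ih.2⟩
  | llam_cong _ ih => exact ⟨.llam (fun _ => rfl) ih.1, .llam (fun _ => rfl) ih.2⟩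
  | cimage_cong _ ih => exact ⟨.cimage (fun _ => rfl) ih.1, .cimage (fun _ => rfl) ih.2⟩
  | vpair_cong _ _ ih ih' => exact ⟨.vpair ih.1 ih'.1, .vpair ih.2 ih'.2⟩
  | vapp_cong _ _ ih ih' => exact ⟨.vapp ih.1 ih'.1, .vapp ih.2 ih'.2⟩
  | cpair_cong _ _ ih ih' => exact ⟨.cpair ih.1 ih'.1, .cpair ih.2 ih'.2⟩
  | capp_cong _ _ ih ih' => exact ⟨.capp ih.1 ih'.1, .capp ih.2 ih'.2⟩
  | ilet_cong _ _ ih ih' => exact ⟨.ilet ih.1 ih'.1, .ilet ih.2 ih'.2⟩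
  | banglet_cong _ _ ih ih' => exact ⟨.banglet ih.1 ih'.1, .banglet ih.2 ih'.2⟩
  | copow_cong _ _ ih ih' => exact ⟨.copow ih.1 ih'.1, .copow ih.2 ih'.2⟩
  | copowlet_cong _ _ ih ih' => exact ⟨.copowlet ih.1 ih'.1, .copowlet ih.2 ih'.2⟩
  | lapp_cong _ _ ih ih' => exact ⟨.lapp ih.1 ih'.1, .lapp ih.2 ih'.2⟩
  | ccase_cong _ _ _ ih ih' ih'' => exact ⟨.ccase ih.1 ih'.1 ih''.1, .ccase ih.2 ih'.2 ih''.2⟩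
  | vfst_cong _ ih => exact ⟨.vfst ih.1, .vfst ih.2⟩
  | vsnd_cong _ ih => exact ⟨.vsnd ih.1, .vsnd ih.2⟩
  | cfst_cong _ ih => exact ⟨.cfst ih.1, .cfst ih.2⟩
  | csnd_cong _ ih => exact ⟨.csnd ih.1, .csnd ih.2⟩
  | cinl_cong _ ih => exact ⟨.cinl ih.1, .cinl ih.2⟩
  | cinr_cong _ ih => exact ⟨.cinr ih.1, .cinr ih.2⟩
  | bang_cong _ ih => exact ⟨.bang ih.1, .bang ih.2⟩
  | unit_eta d => exact ⟨d.ty, .unit⟩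
  | cunit_eta d => exact ⟨d.ty, .cunit⟩
  | vfst_beta d d' => exact ⟨.vfst (.vpair d.ty d'.ty), d.ty⟩
  | vsnd_beta d d' => exact ⟨.vsnd (.vpair d.ty d'.ty), d'.ty⟩
  | vpair_eta d => exact ⟨.vpair (.vfst d.ty) (.vsnd d.ty), d.ty⟩
  | cfst_beta d d' => exact ⟨.cfst (.cpair d.ty d'.ty), d.ty⟩
  | csnd_beta d d' => exact ⟨.csnd (.cpair d.ty d'.ty), d'.ty⟩
  | cpair_eta d => exact ⟨.cpair (.cfst d.ty) (.csnd d.ty), d.ty⟩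
  | vlam_beta d d' => exact ⟨.vapp (.vlam (fun _ => rfl) d.ty) d'.ty, d.ty.subst0 d'.ty⟩
  | vlam_eta d => exact ⟨.vlam (fun _ => rfl) (.vapp (d.ty.shift _) (.var rfl)), d.ty⟩
  | clam_beta d d' => exact ⟨.capp (.clam (fun _ => rfl) d.ty) d'.ty, d.ty.subst0 d'.ty⟩
  | clam_eta d => exact ⟨.clam (fun _ => rfl) (.capp (d.ty.shift _) (.var rfl)), d.ty⟩
  | ilet_beta d => exact ⟨.ilet .top d.ty, d.ty⟩
  | ilet_eta d d' => exact ⟨.ilet d.ty (d'.ty.ssubst .top), d'.ty.ssubst d.ty⟩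
  | bang_beta d d' => exact ⟨.banglet (.bang d.ty) d'.ty, d'.ty.subst0 d.ty⟩
  | bang_eta d d' =>
      exact ⟨.banglet d.ty ((d'.ty.shift _).ssubst (.bang (.var rfl))), d'.ty.ssubst d.ty⟩
  | copow_beta d d' d'' =>
      exact ⟨.copowlet (.copow d.ty d'.ty) d''.ty, (d''.ty.subst0 d.ty).ssubst d'.ty⟩
  | copow_eta d d' =>
      exact ⟨.copowlet d.ty ((d'.ty.shift _).ssubst (.copow (.var rfl) .svar)),
        d'.ty.ssubst d.ty⟩
  | czero_eta d d' => exact ⟨.cimage (fun _ => rfl) d.ty, d'.ty.ssubst d.ty⟩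
  | csum_beta_inl d d' d'' => exact ⟨.ccase (.cinl d''.ty) d.ty d'.ty, d.ty.ssubst d''.ty⟩
  | csum_beta_inr d d' d'' => exact ⟨.ccase (.cinr d''.ty) d.ty d'.ty, d'.ty.ssubst d''.ty⟩
  | csum_eta d d' =>
      exact ⟨.ccase d.ty (d'.ty.ssubst (.cinl .svar)) (d'.ty.ssubst (.cinr .svar)),
        d'.ty.ssubst d.ty⟩
  | llam_beta d d' => exact ⟨.lapp (.llam (fun _ => rfl) d.ty) d'.ty, d.ty.ssubst d'.ty⟩
  | llam_eta d => exact ⟨.llam (fun _ => rfl) (.lapp d.ty .svar), d.ty⟩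

/-- The equational theory is closed under well-typed simultaneous substitution. -/
theorem full {Γ Δ t t' A} (h : EEq Γ Δ t t' A) {Γ' Δ' σ u} (hs : ∀ n, Tm.SFree (σ n))
    (hσ : TySub true Γ Γ' σ) (hu : TyStoup true Γ' Δ Δ' u) :
    EEq Γ' Δ' (Tm.full σ u t) (Tm.full σ u t') A := by
  induction h generalizing Γ' Δ' σ u with
  | refl d => exact .refl (d.ty.full hσ hu).toDeriv
  | symm _ ih => exact .symm (ih hs hσ hu)
  | trans _ _ ih ih' => exact .trans (ih hs hσ hu) (ih' hs hσ hu)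
  | vpair_cong _ _ ih ih' => cases hu; exact .vpair_cong (ih hs hσ .none) (ih' hs hσ .none)
  | vfst_cong _ ih => cases hu; exact .vfst_cong (ih hs hσ .none)
  | vsnd_cong _ ih => cases hu; exact .vsnd_cong (ih hs hσ .none)
  | vlam_cong _ ih => cases hu; exact .vlam_cong (ih (Tm.SFree.liftS hs) (hσ.lift _) .none)
  | vapp_cong _ _ ih ih' => cases hu; exact .vapp_cong (ih hs hσ .none) (ih' hs hσ .none)
  | cpair_cong _ _ ih ih' => exact .cpair_cong (ih hs hσ hu) (ih' hs hσ hu)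
  | cfst_cong _ ih => exact .cfst_cong (ih hs hσ hu)
  | csnd_cong _ ih => exact .csnd_cong (ih hs hσ hu)
  | clam_cong _ ih => exact .clam_cong (ih (Tm.SFree.liftS hs) (hσ.lift _) (hu.shift _))
  | capp_cong _ _ ih ih' => exact .capp_cong (ih hs hσ hu) (ih' hs hσ .none)
  | ilet_cong _ _ ih ih' => exact .ilet_cong (ih hs hσ hu) (ih' hs hσ .none)
  | bang_cong _ ih => cases hu; exact .bang_cong (ih hs hσ .none)
  | banglet_cong _ _ ih ih' =>
      exact .banglet_cong (ih hs hσ hu) (ih' (Tm.SFree.liftS hs) (hσ.lift _) .none)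
  | copow_cong _ _ ih ih' => exact .copow_cong (ih hs hσ .none) (ih' hs hσ hu)
  | copowlet_cong _ _ ih ih' =>
      exact .copowlet_cong (ih hs hσ hu) (ih' (Tm.SFree.liftS hs) (hσ.lift _) .svar)
  | cimage_cong _ ih => exact .cimage_cong (ih hs hσ hu)
  | cinl_cong _ ih => exact .cinl_cong (ih hs hσ hu)
  | cinr_cong _ ih => exact .cinr_cong (ih hs hσ hu)
  | ccase_cong _ _ _ ih ih' ih'' =>
      exact .ccase_cong (ih hs hσ hu) (ih' hs hσ .svar) (ih'' hs hσ .svar)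
  | llam_cong _ ih => cases hu; exact .llam_cong (ih hs hσ .svar)
  | lapp_cong _ _ ih ih' => exact .lapp_cong (ih hs hσ .none) (ih' hs hσ hu)
  | unit_eta d => cases hu; exact .unit_eta (d.ty.full hσ .none).toDeriv
  | cunit_eta d => exact .cunit_eta (d.ty.full hσ hu).toDeriv
  | vfst_beta d d' =>
      cases hu; exact .vfst_beta (d.ty.full hσ .none).toDeriv (d'.ty.full hσ .none).toDeriv
  | vsnd_beta d d' =>
      cases hu; exact .vsnd_beta (d.ty.full hσ .none).toDeriv (d'.ty.full hσ .none).toDeriv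
  | vpair_eta d => cases hu; exact .vpair_eta (d.ty.full hσ .none).toDeriv
  | cfst_beta d d' => exact .cfst_beta (d.ty.full hσ hu).toDeriv (d'.ty.full hσ hu).toDeriv
  | csnd_beta d d' => exact .csnd_beta (d.ty.full hσ hu).toDeriv (d'.ty.full hσ hu).toDeriv
  | cpair_eta d => exact .cpair_eta (d.ty.full hσ hu).toDeriv
  | vlam_beta d d' =>
      cases hu
      rw [Tm.full_subst0 hs u d'.sfree]
      exact .vlam_beta (d.ty.full (hσ.lift _) .none).toDeriv (d'.ty.full hσ .none).toDeriv
  | vlam_eta d =>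
      cases hu
      simp only [Tm.full, Tm.full_liftS_shift]
      exact .vlam_eta (d.ty.full hσ .none).toDeriv
  | clam_beta d d' =>
      rw [Tm.full_subst0 hs u d'.sfree]
      exact .clam_beta (d.ty.full (hσ.lift _) (hu.shift _)).toDeriv (d'.ty.full hσ .none).toDeriv
  | clam_eta d =>
      simp only [Tm.full, Tm.full_liftS_shift]
      exact .clam_eta (d.ty.full hσ hu).toDeriv
  | ilet_beta d => cases hu; exact .ilet_beta (d.ty.full hσ .none).toDeriv
  | ilet_eta d d' =>
      simp only [Tm.full, Tm.full_ssubst hs]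
      exact .ilet_eta (d.ty.full hσ hu).toDeriv (d'.ty.full hσ .svar).toDeriv
  | bang_beta d d' =>
      cases hu
      rw [Tm.full_subst0 hs u d.sfree]
      exact .bang_beta (d.ty.full hσ .none).toDeriv (d'.ty.full (hσ.lift _) .none).toDeriv
  | bang_eta d d' =>
      simp only [Tm.full, Tm.full_ssubst hs, Tm.full_ssubst (Tm.SFree.liftS hs),
        Tm.full_liftS_shift']
      exact .bang_eta (d.ty.full hσ hu).toDeriv (d'.ty.full hσ .svar).toDeriv
  | copow_beta d d' d'' =>
      rw [Tm.full_ssubst hs, Tm.full_subst0 hs .svar d.sfree, d.sfree σ .svar u]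
      exact .copow_beta (d.ty.full hσ .none).toDeriv (d'.ty.full hσ hu).toDeriv
        (d''.ty.full (hσ.lift _) .svar).toDeriv
  | copow_eta d d' =>
      simp only [Tm.full, Tm.full_ssubst hs, Tm.full_ssubst (Tm.SFree.liftS hs),
        Tm.full_liftS_shift']
      exact .copow_eta (d.ty.full hσ hu).toDeriv (d'.ty.full hσ .svar).toDeriv
  | czero_eta d d' =>
      rw [Tm.full_ssubst hs]
      exact .czero_eta (d.ty.full hσ hu).toDeriv (d'.ty.full hσ .svar).toDeriv
  | csum_beta_inl d d' d'' =>
      rw [Tm.full_ssubst hs]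
      exact .csum_beta_inl (d.ty.full hσ .svar).toDeriv (d'.ty.full hσ .svar).toDeriv
        (d''.ty.full hσ hu).toDeriv
  | csum_beta_inr d d' d'' =>
      rw [Tm.full_ssubst hs]
      exact .csum_beta_inr (d.ty.full hσ .svar).toDeriv (d'.ty.full hσ .svar).toDeriv
        (d''.ty.full hσ hu).toDeriv
  | csum_eta d d' =>
      simp only [Tm.full, Tm.full_ssubst hs]
      exact .csum_eta (d.ty.full hσ hu).toDeriv (d'.ty.full hσ .svar).toDeriv
  | llam_beta d d' =>
      rw [Tm.full_ssubst hs]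
      exact .llam_beta (d.ty.full hσ .svar).toDeriv (d'.ty.full hσ hu).toDeriv
  | llam_eta d =>
      cases hu
      rw [d.sfree σ u .svar]
      exact .llam_eta (d.ty.full hσ .none).toDeriv

theorem ssubst_right {Γ Δ B C E s s'} (d : Ty true Γ (some B) E (.comp C))
    (h : EEq Γ Δ s s' (.comp B)) :
    EEq Γ Δ (Tm.ssubst s E) (Tm.ssubst s' E) (.comp C) :=
  ((EEq.llam_beta d.toDeriv h.ty.1.toDeriv).symm.trans
    (.lapp_cong (.refl (.llam _ _ _ _ d.toDeriv)) h)).trans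
    (.llam_beta d.toDeriv h.ty.2.toDeriv)

/-! ### Commuting conversions -/

variable {Γ : List VType} {Δ : Option CType} {B C : CType} {E : Tm}

theorem ilet_comm (d : Ty true Γ (some B) E (.comp C)) {s t}
    (ds : Ty true Γ Δ s (.comp .iunit)) (dt : Ty true Γ none t (.comp B)) :
    EEq Γ Δ (Tm.ssubst (.ilet s t) E) (.ilet s (Tm.ssubst t E)) (.comp C) := by
  have h := EEq.ilet_eta ds.toDeriv (d.ssubst (.ilet .svar dt)).toDeriv
  simp only [Tm.ssubst_eq_full, Tm.full_full Tm.SFree.var, Tm.full, dt.sfree.full_eq] at h ⊢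
  refine h.symm.trans (.ilet_cong (.refl ds.toDeriv) ?_)
  simpa only [Tm.ssubst_eq_full] using ssubst_right d (.ilet_beta dt.toDeriv)

theorem banglet_comm (d : Ty true Γ (some B) E (.comp C)) {s t A}
    (ds : Ty true Γ Δ s (.comp (.bang A))) (dt : Ty true (A :: Γ) none t (.comp B)) :
    EEq Γ Δ (Tm.ssubst (.banglet s t) E) (.banglet s (Tm.ssubst t (Tm.shift E))) (.comp C) := by
  have h := EEq.bang_eta ds.toDeriv (d.ssubst (.banglet .svar dt)).toDeriv
  have dt' := dt.rename (f := Tm.liftN Nat.succ) (Γ' := A :: A :: Γ) (by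
    intro n X hn
    cases n <;> simpa using hn)
  have e : Tm.subst0 (.var 0) (Tm.rename (Tm.liftN Nat.succ) t) = t := by
    rw [Tm.subst0_eq_full, Tm.full_rename]
    conv_rhs => rw [← Tm.full_var_svar t]
    congr 1
    funext n
    cases n <;> rfl
  have h2 := EEq.bang_beta (.var _ 0 _ rfl) dt'.toDeriv
  rw [e] at h2
  simp only [Tm.shift_ssubst] at h
  simp only [Tm.ssubst_eq_full, Tm.full_full Tm.SFree.var, Tm.full, dt.sfree.full_eq,
    Tm.shift, Tm.rename, dt'.sfree.full_eq, Tm.liftS_var] at h ⊢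
  refine h.symm.trans (.banglet_cong (.refl ds.toDeriv) ?_)
  have h3 := ssubst_right (d.shift A) h2
  rw [Tm.ssubst_eq_full, Tm.ssubst_eq_full] at h3
  exact h3

theorem copowlet_comm (d : Ty true Γ (some B) E (.comp C)) {s t A X}
    (ds : Ty true Γ Δ s (.comp (.copow A X))) (dt : Ty true (A :: Γ) (some X) t (.comp B)) :
    EEq Γ Δ (Tm.ssubst (.copowlet s t) E) (.copowlet s (Tm.ssubst t (Tm.shift E))) (.comp C) := by
  have h := EEq.copow_eta ds.toDeriv (d.ssubst (.copowlet .svar dt)).toDeriv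
  have dt' := dt.rename (f := Tm.liftN Nat.succ) (Γ' := A :: A :: Γ) (by
    intro n X hn
    cases n <;> simpa using hn)
  have e : Tm.subst0 (.var 0) (Tm.rename (Tm.liftN Nat.succ) t) = t := by
    rw [Tm.subst0_eq_full, Tm.full_rename]
    conv_rhs => rw [← Tm.full_var_svar t]
    congr 1
    funext n
    cases n <;> rfl
  have h2 := EEq.copow_beta (.var _ 0 _ rfl) (.svar _ _) dt'.toDeriv
  rw [e] at h2
  simp only [Tm.shift_ssubst] at h
  simp only [Tm.ssubst_eq_full, Tm.full_full Tm.SFree.var, Tm.full, Tm.full_var_svar,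
    Tm.shift, Tm.rename, Tm.liftS_var] at h h2 ⊢
  refine h.symm.trans (.copowlet_cong (.refl ds.toDeriv) ?_)
  have h3 := ssubst_right (d.shift A) h2
  rw [Tm.ssubst_eq_full, Tm.ssubst_eq_full] at h3
  exact h3

theorem cimage_comm (d : Ty true Γ (some B) E (.comp C)) {s}
    (ds : Ty true Γ Δ s (.comp .czero)) :
    EEq Γ Δ (Tm.ssubst (.cimage B s) E) (.cimage C s) (.comp C) := by
  have h := EEq.czero_eta ds.toDeriv (d.ssubst (.cimage (fun _ => rfl) .svar)).toDeriv
  simp only [Tm.ssubst_eq_full, Tm.full_full Tm.SFree.var, Tm.full] at h ⊢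
  exact h.symm

theorem ccase_comm (d : Ty true Γ (some B) E (.comp C)) {s t t' X Y}
    (ds : Ty true Γ Δ s (.comp (.csum X Y))) (dt : Ty true Γ (some X) t (.comp B))
    (dt' : Ty true Γ (some Y) t' (.comp B)) :
    EEq Γ Δ (Tm.ssubst (.ccase s t t') E) (.ccase s (Tm.ssubst t E) (Tm.ssubst t' E))
      (.comp C) := by
  have h := EEq.csum_eta ds.toDeriv (d.ssubst (.ccase .svar dt dt')).toDeriv
  have h1 := ssubst_right d (.csum_beta_inl dt.toDeriv dt'.toDeriv (.svar _ _))
  have h2 := ssubst_right d (.csum_beta_inr dt.toDeriv dt'.toDeriv (.svar _ _))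
  simp only [Tm.ssubst_eq_full, Tm.full_full Tm.SFree.var, Tm.full, Tm.full_var_svar]
    at h h1 h2 ⊢
  exact h.symm.trans (.ccase_cong (.refl ds.toDeriv) h1 h2)

end EEq

end EEC

namespace EEC

/-! ## Reduction up to annotations -/

/-- Every annotated version of `e` is provably equal to some annotated version of `e'`. -/
structure Red (e e' : Tm) : Prop where
  run : ∀ {Γ : List VType} {Δ : Option CType} {A : VType} {t : Tm}, Deriv Γ Δ t A →
    Tm.erase t = Tm.erase e → ∃ t', Tm.erase t' = Tm.erase e' ∧ EEq Γ Δ t t' A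

namespace Red

theorem refl (e : Tm) : Red e e := ⟨fun d h => ⟨_, h, .refl d⟩⟩

theorem of_eq {e e' : Tm} (h : e = e') : Red e e' := h ▸ refl e

theorem trans {e e' e'' : Tm} (h : Red e e') (h' : Red e' e'') : Red e e'' := by
  constructor
  intro Γ Δ A t d he
  obtain ⟨t', e1, q1⟩ := h.run d he
  obtain ⟨t'', e2, q2⟩ := h'.run q1.ty.2.toDeriv e1
  exact ⟨t'', e2, q1.trans q2⟩

theorem ty {e e' : Tm} (h : Red e e') {Γ Δ A} (ht : Ty false Γ Δ e A) : Ty false Γ Δ e' A := by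
  obtain ⟨t, he, ⟨d⟩⟩ := ht.lift
  obtain ⟨t', e1, q1⟩ := h.run d he
  exact q1.ty.2.of_erase_eq e1.symm

theorem vpair {s s' t t' : Tm} (h0 : Red s s') (h1 : Red t t') :
    Red (.vpair s t) (.vpair s' t') := by
  constructor
  intro Γ Δ A x d e
  cases d <;> simp only [Tm.erase, reduceCtorEq, Tm.vpair.injEq] at e
  rename_i d0 d1
  obtain ⟨_, e0, q0⟩ := h0.run d0 e.1
  obtain ⟨_, e1, q1⟩ := h1.run d1 e.2
  exact ⟨_, by simp only [Tm.erase, e0, e1], .vpair_cong q0 q1⟩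

theorem vfst {s s' : Tm} (h0 : Red s s') :
    Red (.vfst s) (.vfst s') := by
  constructor
  intro Γ Δ A x d e
  cases d <;> simp only [Tm.erase, reduceCtorEq, Tm.vfst.injEq] at e
  rename_i d0
  obtain ⟨_, e0, q0⟩ := h0.run d0 e
  exact ⟨_, by simp only [Tm.erase, e0], .vfst_cong q0⟩

theorem vsnd {s s' : Tm} (h0 : Red s s') :
    Red (.vsnd s) (.vsnd s') := by
  constructor
  intro Γ Δ A x d e
  cases d <;> simp only [Tm.erase, reduceCtorEq, Tm.vsnd.injEq] at e
  rename_i d0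
  obtain ⟨_, e0, q0⟩ := h0.run d0 e
  exact ⟨_, by simp only [Tm.erase, e0], .vsnd_cong q0⟩

theorem vapp {s s' t t' : Tm} (h0 : Red s s') (h1 : Red t t') :
    Red (.vapp s t) (.vapp s' t') := by
  constructor
  intro Γ Δ A x d e
  cases d <;> simp only [Tm.erase, reduceCtorEq, Tm.vapp.injEq] at e
  rename_i d1 d0
  obtain ⟨_, e0, q0⟩ := h0.run d0 e.1
  obtain ⟨_, e1, q1⟩ := h1.run d1 e.2
  exact ⟨_, by simp only [Tm.erase, e0, e1], .vapp_cong q0 q1⟩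

theorem cpair {s s' t t' : Tm} (h0 : Red s s') (h1 : Red t t') :
    Red (.cpair s t) (.cpair s' t') := by
  constructor
  intro Γ Δ A x d e
  cases d <;> simp only [Tm.erase, reduceCtorEq, Tm.cpair.injEq] at e
  rename_i d0 d1
  obtain ⟨_, e0, q0⟩ := h0.run d0 e.1
  obtain ⟨_, e1, q1⟩ := h1.run d1 e.2
  exact ⟨_, by simp only [Tm.erase, e0, e1], .cpair_cong q0 q1⟩

theorem cfst {s s' : Tm} (h0 : Red s s') :
    Red (.cfst s) (.cfst s') := by
  constructor
  intro Γ Δ A x d e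
  cases d <;> simp only [Tm.erase, reduceCtorEq, Tm.cfst.injEq] at e
  rename_i d0
  obtain ⟨_, e0, q0⟩ := h0.run d0 e
  exact ⟨_, by simp only [Tm.erase, e0], .cfst_cong q0⟩

theorem csnd {s s' : Tm} (h0 : Red s s') :
    Red (.csnd s) (.csnd s') := by
  constructor
  intro Γ Δ A x d e
  cases d <;> simp only [Tm.erase, reduceCtorEq, Tm.csnd.injEq] at e
  rename_i d0
  obtain ⟨_, e0, q0⟩ := h0.run d0 e
  exact ⟨_, by simp only [Tm.erase, e0], .csnd_cong q0⟩

theorem capp {s s' t t' : Tm} (h0 : Red s s') (h1 : Red t t') :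
    Red (.capp s t) (.capp s' t') := by
  constructor
  intro Γ Δ A x d e
  cases d <;> simp only [Tm.erase, reduceCtorEq, Tm.capp.injEq] at e
  rename_i d1 d0
  obtain ⟨_, e0, q0⟩ := h0.run d0 e.1
  obtain ⟨_, e1, q1⟩ := h1.run d1 e.2
  exact ⟨_, by simp only [Tm.erase, e0, e1], .capp_cong q0 q1⟩

theorem ilet {s s' t t' : Tm} (h0 : Red s s') (h1 : Red t t') :
    Red (.ilet s t) (.ilet s' t') := by
  constructor
  intro Γ Δ A x d e
  cases d <;> simp only [Tm.erase, reduceCtorEq, Tm.ilet.injEq] at e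
  rename_i d1 d0
  obtain ⟨_, e0, q0⟩ := h0.run d0 e.1
  obtain ⟨_, e1, q1⟩ := h1.run d1 e.2
  exact ⟨_, by simp only [Tm.erase, e0, e1], .ilet_cong q0 q1⟩

theorem bang {s s' : Tm} (h0 : Red s s') :
    Red (.bang s) (.bang s') := by
  constructor
  intro Γ Δ A x d e
  cases d <;> simp only [Tm.erase, reduceCtorEq, Tm.bang.injEq] at e
  rename_i d0
  obtain ⟨_, e0, q0⟩ := h0.run d0 e
  exact ⟨_, by simp only [Tm.erase, e0], .bang_cong q0⟩

theorem banglet {s s' t t' : Tm} (h0 : Red s s') (h1 : Red t t') :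
    Red (.banglet s t) (.banglet s' t') := by
  constructor
  intro Γ Δ A x d e
  cases d <;> simp only [Tm.erase, reduceCtorEq, Tm.banglet.injEq] at e
  rename_i d1 d0
  obtain ⟨_, e0, q0⟩ := h0.run d0 e.1
  obtain ⟨_, e1, q1⟩ := h1.run d1 e.2
  exact ⟨_, by simp only [Tm.erase, e0, e1], .banglet_cong q0 q1⟩

theorem copow {s s' t t' : Tm} (h0 : Red s s') (h1 : Red t t') :
    Red (.copow s t) (.copow s' t') := by
  constructor
  intro Γ Δ A x d e
  cases d <;> simp only [Tm.erase, reduceCtorEq, Tm.copow.injEq] at e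
  rename_i d0 d1
  obtain ⟨_, e0, q0⟩ := h0.run d0 e.1
  obtain ⟨_, e1, q1⟩ := h1.run d1 e.2
  exact ⟨_, by simp only [Tm.erase, e0, e1], .copow_cong q0 q1⟩

theorem copowlet {s s' t t' : Tm} (h0 : Red s s') (h1 : Red t t') :
    Red (.copowlet s t) (.copowlet s' t') := by
  constructor
  intro Γ Δ A x d e
  cases d <;> simp only [Tm.erase, reduceCtorEq, Tm.copowlet.injEq] at e
  rename_i d1 d0
  obtain ⟨_, e0, q0⟩ := h0.run d0 e.1
  obtain ⟨_, e1, q1⟩ := h1.run d1 e.2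
  exact ⟨_, by simp only [Tm.erase, e0, e1], .copowlet_cong q0 q1⟩

theorem cinl {s s' : Tm} (h0 : Red s s') :
    Red (.cinl s) (.cinl s') := by
  constructor
  intro Γ Δ A x d e
  cases d <;> simp only [Tm.erase, reduceCtorEq, Tm.cinl.injEq] at e
  rename_i d0
  obtain ⟨_, e0, q0⟩ := h0.run d0 e
  exact ⟨_, by simp only [Tm.erase, e0], .cinl_cong q0⟩

theorem cinr {s s' : Tm} (h0 : Red s s') :
    Red (.cinr s) (.cinr s') := by
  constructor
  intro Γ Δ A x d e
  cases d <;> simp only [Tm.erase, reduceCtorEq, Tm.cinr.injEq] at e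
  rename_i d0
  obtain ⟨_, e0, q0⟩ := h0.run d0 e
  exact ⟨_, by simp only [Tm.erase, e0], .cinr_cong q0⟩

theorem ccase {s s' t t' u u' : Tm} (h0 : Red s s') (h1 : Red t t') (h2 : Red u u') :
    Red (.ccase s t u) (.ccase s' t' u') := by
  constructor
  intro Γ Δ A x d e
  cases d <;> simp only [Tm.erase, reduceCtorEq, Tm.ccase.injEq] at e
  rename_i d1 d2 d0
  obtain ⟨_, e0, q0⟩ := h0.run d0 e.1
  obtain ⟨_, e1, q1⟩ := h1.run d1 e.2.1
  obtain ⟨_, e2, q2⟩ := h2.run d2 e.2.2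
  exact ⟨_, by simp only [Tm.erase, e0, e1, e2], .ccase_cong q0 q1 q2⟩

theorem lapp {s s' t t' : Tm} (h0 : Red s s') (h1 : Red t t') :
    Red (.lapp s t) (.lapp s' t') := by
  constructor
  intro Γ Δ A x d e
  cases d <;> simp only [Tm.erase, reduceCtorEq, Tm.lapp.injEq] at e
  rename_i d0 d1
  obtain ⟨_, e0, q0⟩ := h0.run d0 e.1
  obtain ⟨_, e1, q1⟩ := h1.run d1 e.2
  exact ⟨_, by simp only [Tm.erase, e0, e1], .lapp_cong q0 q1⟩

theorem vlam {s s' : Tm} {X Y : VType} (h : Red s s') :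
    Red (.vlam X s) (.vlam Y s') := by
  constructor
  intro Γ Δ A x d e
  cases d <;> simp only [Tm.erase, reduceCtorEq, Tm.vlam.injEq, true_and] at e
  rename_i d
  obtain ⟨_, e', q⟩ := h.run d e
  exact ⟨_, by simp only [Tm.erase, e'], .vlam_cong q⟩

theorem clam {s s' : Tm} {X Y : VType} (h : Red s s') :
    Red (.clam X s) (.clam Y s') := by
  constructor
  intro Γ Δ A x d e
  cases d <;> simp only [Tm.erase, reduceCtorEq, Tm.clam.injEq, true_and] at e
  rename_i d
  obtain ⟨_, e', q⟩ := h.run d e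
  exact ⟨_, by simp only [Tm.erase, e'], .clam_cong q⟩

theorem llam {s s' : Tm} {X Y : CType} (h : Red s s') :
    Red (.llam X s) (.llam Y s') := by
  constructor
  intro Γ Δ A x d e
  cases d <;> simp only [Tm.erase, reduceCtorEq, Tm.llam.injEq, true_and] at e
  rename_i d
  obtain ⟨_, e', q⟩ := h.run d e
  exact ⟨_, by simp only [Tm.erase, e'], .llam_cong q⟩

theorem cimage {s s' : Tm} {X Y : CType} (h : Red s s') :
    Red (.cimage X s) (.cimage Y s') := by
  constructor
  intro Γ Δ A x d e
  cases d <;> simp only [Tm.erase, reduceCtorEq, Tm.cimage.injEq, true_and] at e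
  rename_i d
  obtain ⟨_, e', q⟩ := h.run d e
  exact ⟨_, by simp only [Tm.erase, e'], .cimage_cong q⟩

theorem vfst_beta (s t : Tm) : Red (.vfst (.vpair s t)) s := by
  constructor
  intro Γ Δ A x d e
  cases d <;> simp only [Tm.erase, reduceCtorEq, Tm.vfst.injEq] at e
  rename_i d
  cases d <;> simp only [Tm.erase, reduceCtorEq, Tm.vpair.injEq] at e
  rename_i d1 d2
  exact ⟨_, e.1, .vfst_beta d1 d2⟩

theorem vsnd_beta (s t : Tm) : Red (.vsnd (.vpair s t)) t := by
  constructor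
  intro Γ Δ A x d e
  cases d <;> simp only [Tm.erase, reduceCtorEq, Tm.vsnd.injEq] at e
  rename_i d
  cases d <;> simp only [Tm.erase, reduceCtorEq, Tm.vpair.injEq] at e
  rename_i d1 d2
  exact ⟨_, e.2, .vsnd_beta d1 d2⟩

theorem cfst_beta (s t : Tm) : Red (.cfst (.cpair s t)) s := by
  constructor
  intro Γ Δ A x d e
  cases d <;> simp only [Tm.erase, reduceCtorEq, Tm.cfst.injEq] at e
  rename_i d
  cases d <;> simp only [Tm.erase, reduceCtorEq, Tm.cpair.injEq] at e
  rename_i d1 d2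
  exact ⟨_, e.1, .cfst_beta d1 d2⟩

theorem csnd_beta (s t : Tm) : Red (.csnd (.cpair s t)) t := by
  constructor
  intro Γ Δ A x d e
  cases d <;> simp only [Tm.erase, reduceCtorEq, Tm.csnd.injEq] at e
  rename_i d
  cases d <;> simp only [Tm.erase, reduceCtorEq, Tm.cpair.injEq] at e
  rename_i d1 d2
  exact ⟨_, e.2, .csnd_beta d1 d2⟩

theorem vlam_beta (X : VType) (s t : Tm) : Red (.vapp (.vlam X s) t) (Tm.subst0 t s) := by
  constructor
  intro Γ Δ A x d e
  cases d <;> simp only [Tm.erase, reduceCtorEq, Tm.vapp.injEq] at e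
  rename_i d2 d1
  cases d1 <;> simp only [Tm.erase, reduceCtorEq, Tm.vlam.injEq, false_and, true_and] at e
  rename_i d1
  exact ⟨_, by simp only [Tm.erase_subst0, e.1, e.2], .vlam_beta d1 d2⟩

theorem clam_beta (X : VType) (s t : Tm) : Red (.capp (.clam X s) t) (Tm.subst0 t s) := by
  constructor
  intro Γ Δ A x d e
  cases d <;> simp only [Tm.erase, reduceCtorEq, Tm.capp.injEq] at e
  rename_i d2 d1
  cases d1 <;> simp only [Tm.erase, reduceCtorEq, Tm.clam.injEq, false_and, true_and] at e
  rename_i d1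
  exact ⟨_, by simp only [Tm.erase_subst0, e.1, e.2], .clam_beta d1 d2⟩

theorem llam_beta (X : CType) (s t : Tm) : Red (.lapp (.llam X s) t) (Tm.ssubst t s) := by
  constructor
  intro Γ Δ A x d e
  cases d <;> simp only [Tm.erase, reduceCtorEq, Tm.lapp.injEq] at e
  rename_i d1 d2
  cases d1 <;> simp only [Tm.erase, reduceCtorEq, Tm.llam.injEq, false_and, true_and] at e
  rename_i d1
  exact ⟨_, by simp only [Tm.erase_ssubst, e.1, e.2], .llam_beta d1 d2⟩

theorem ilet_beta (t : Tm) : Red (.ilet .top t) t := by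
  constructor
  intro Γ Δ A x d e
  cases d <;> simp only [Tm.erase, reduceCtorEq, Tm.ilet.injEq] at e
  rename_i d2 d1
  cases d1 <;> simp only [Tm.erase, reduceCtorEq, false_and, true_and] at e
  exact ⟨_, e, .ilet_beta d2⟩

theorem bang_beta (s t : Tm) : Red (.banglet (.bang s) t) (Tm.subst0 s t) := by
  constructor
  intro Γ Δ A x d e
  cases d <;> simp only [Tm.erase, reduceCtorEq, Tm.banglet.injEq] at e
  rename_i d2 d1
  cases d1 <;> simp only [Tm.erase, reduceCtorEq, Tm.bang.injEq, false_and] at e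
  rename_i d1
  exact ⟨_, by simp only [Tm.erase_subst0, e.1, e.2], .bang_beta d1 d2⟩

theorem copow_beta (s t u : Tm) :
    Red (.copowlet (.copow s t) u) (Tm.ssubst t (Tm.subst0 s u)) := by
  constructor
  intro Γ Δ A x d e
  cases d <;> simp only [Tm.erase, reduceCtorEq, Tm.copowlet.injEq] at e
  rename_i d2 d1
  cases d1 <;> simp only [Tm.erase, reduceCtorEq, Tm.copow.injEq, false_and] at e
  rename_i d1 d3
  exact ⟨_, by simp only [Tm.erase_subst0, Tm.erase_ssubst, e.1, e.2], .copow_beta d1 d3 d2⟩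

theorem csum_beta_inl (s t u : Tm) : Red (.ccase (.cinl s) t u) (Tm.ssubst s t) := by
  constructor
  intro Γ Δ A x d e
  cases d <;> simp only [Tm.erase, reduceCtorEq, Tm.ccase.injEq] at e
  rename_i d2 d3 d1
  cases d1 <;> simp only [Tm.erase, reduceCtorEq, Tm.cinl.injEq, false_and] at e
  rename_i d1
  exact ⟨_, by simp only [Tm.erase_ssubst, e.1, e.2], .csum_beta_inl d2 d3 d1⟩

theorem csum_beta_inr (s t u : Tm) : Red (.ccase (.cinr s) t u) (Tm.ssubst s u) := by
  constructor
  intro Γ Δ A x d e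
  cases d <;> simp only [Tm.erase, reduceCtorEq, Tm.ccase.injEq] at e
  rename_i d2 d3 d1
  cases d1 <;> simp only [Tm.erase, reduceCtorEq, Tm.cinr.injEq, false_and] at e
  rename_i d1
  exact ⟨_, by simp only [Tm.erase_ssubst, e.1, e.2], .csum_beta_inr d2 d3 d1⟩

end Red

/-! ### Elimination frames -/

/-- Eliminations of computation types, with a hole for the principal argument. -/
inductive Fr : Type
  | cfst : Fr
  | csnd : Fr
  | capp : Tm → Fr
  | ilet : Tm → Fr
  | banglet : Tm → Fr
  | copowlet : Tm → Fr
  | ccase : Tm → Tm → Fr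
  | cimage : CType → Fr

namespace Fr

/-- Fill the hole of a frame. -/
def app : Fr → Tm → Tm
  | cfst, t => .cfst t
  | csnd, t => .csnd t
  | capp u, t => .capp t u
  | ilet u, t => .ilet t u
  | banglet u, t => .banglet t u
  | copowlet u, t => .copowlet t u
  | ccase u u', t => .ccase t u u'
  | cimage X, t => .cimage X t

/-- Weakening of frames. -/
def shift : Fr → Fr
  | cfst => cfst
  | csnd => csnd
  | capp u => capp (Tm.shift u)
  | ilet u => ilet (Tm.shift u)
  | banglet u => banglet (Tm.rename (Tm.liftN Nat.succ) u)
  | copowlet u => copowlet (Tm.rename (Tm.liftN Nat.succ) u)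
  | ccase u u' => ccase (Tm.shift u) (Tm.shift u')
  | cimage X => cimage X

/-- Erasure of annotations in frames. -/
def erase : Fr → Fr
  | cfst => cfst
  | csnd => csnd
  | capp u => capp (Tm.erase u)
  | ilet u => ilet (Tm.erase u)
  | banglet u => banglet (Tm.erase u)
  | copowlet u => copowlet (Tm.erase u)
  | ccase u u' => ccase (Tm.erase u) (Tm.erase u')
  | cimage _ => cimage .cunit

theorem erase_app (F : Fr) (t : Tm) : Tm.erase (F.app t) = F.erase.app (Tm.erase t) := by
  cases F <;> rfl

theorem erase_shift (F : Fr) : F.shift.erase = F.erase.shift := by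
  cases F <;> simp [shift, erase, Tm.erase_shift, Tm.erase_rename]

theorem erase_inv {F : Fr} {x t : Tm} (e : Tm.erase x = Tm.erase (F.app t)) :
    ∃ F' t', x = app F' t' ∧ Tm.erase t' = Tm.erase t ∧ F'.erase = F.erase := by
  cases F <;> cases x <;> simp only [app, Tm.erase, reduceCtorEq, Tm.cfst.injEq, Tm.csnd.injEq,
    Tm.capp.injEq, Tm.ilet.injEq, Tm.banglet.injEq, Tm.copowlet.injEq, Tm.ccase.injEq,
    Tm.cimage.injEq, true_and] at e
  · exact ⟨cfst, _, rfl, e, rfl⟩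
  · exact ⟨csnd, _, rfl, e, rfl⟩
  · exact ⟨capp _, _, rfl, e.1, by simp [erase, e.2]⟩
  · exact ⟨ilet _, _, rfl, e.1, by simp [erase, e.2]⟩
  · exact ⟨banglet _, _, rfl, e.1, by simp [erase, e.2]⟩
  · exact ⟨copowlet _, _, rfl, e.1, by simp [erase, e.2]⟩
  · exact ⟨ccase _ _, _, rfl, e.1, by simp [erase, e.2]⟩
  · exact ⟨cimage _, _, rfl, e, rfl⟩

end Fr

/-- Typing of frames: from the type of the hole to the type of the result. -/
inductive FrTy (b : Bool) (Γ : List VType) : Fr → CType → CType → Prop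
  | cfst {A B} : FrTy b Γ .cfst (.cand A B) A
  | csnd {A B} : FrTy b Γ .csnd (.cand A B) B
  | capp {u A B} : Ty b Γ none u A → FrTy b Γ (.capp u) (.carr A B) B
  | ilet {u A} : Ty b Γ none u (.comp A) → FrTy b Γ (.ilet u) .iunit A
  | banglet {u A B} : Ty b (A :: Γ) none u (.comp B) → FrTy b Γ (.banglet u) (.bang A) B
  | copowlet {u A B C} : Ty b (A :: Γ) (some B) u (.comp C) →
      FrTy b Γ (.copowlet u) (.copow A B) C
  | ccase {u u' A B C} : Ty b Γ (some A) u (.comp C) → Ty b Γ (some B) u' (.comp C) →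
      FrTy b Γ (.ccase u u') (.csum A B) C
  | cimage {X A} : (b = true → X = A) → FrTy b Γ (.cimage X) .czero A

namespace FrTy

variable {b : Bool} {Γ : List VType} {Δ : Option CType} {F : Fr} {B C : CType} {t : Tm}

theorem app (h : FrTy b Γ F B C) (ht : Ty b Γ Δ t (.comp B)) : Ty b Γ Δ (F.app t) (.comp C) := by
  cases h with
  | cfst => exact .cfst ht
  | csnd => exact .csnd ht
  | capp h => exact .capp ht h
  | ilet h => exact .ilet ht h
  | banglet h => exact .banglet ht h
  | copowlet h => exact .copowlet ht h
  | ccase h h' => exact .ccase ht h h'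
  | cimage h => exact .cimage h ht

theorem inv {A : VType} (h : Ty b Γ Δ (F.app t) A) :
    ∃ B C, A = .comp C ∧ Ty b Γ Δ t (.comp B) ∧ FrTy b Γ F B C := by
  cases F <;> cases h
  · exact ⟨_, _, rfl, ‹_›, .cfst⟩
  · exact ⟨_, _, rfl, ‹_›, .csnd⟩
  · exact ⟨_, _, rfl, ‹_›, .capp ‹_›⟩
  · exact ⟨_, _, rfl, ‹_›, .ilet ‹_›⟩
  · exact ⟨_, _, rfl, ‹_›, .banglet ‹_›⟩
  · exact ⟨_, _, rfl, ‹_›, .copowlet ‹_›⟩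
  · exact ⟨_, _, rfl, ‹_›, .ccase ‹_› ‹_›⟩
  · exact ⟨_, _, rfl, ‹_›, .cimage ‹_›⟩

theorem shift (h : FrTy b Γ F B C) (X : VType) : FrTy b (X :: Γ) F.shift B C := by
  have l : ∀ {A : VType} {Δ u B}, Ty b (A :: Γ) Δ u B →
      Ty b (A :: X :: Γ) Δ (Tm.rename (Tm.liftN Nat.succ) u) B := by
    intro A Δ u B h
    refine h.rename fun n C hn => ?_
    cases n <;> simpa using hn
  cases h with
  | cfst => exact .cfst
  | csnd => exact .csnd
  | capp h => exact .capp (h.shift _)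
  | ilet h => exact .ilet (h.shift _)
  | banglet h => exact .banglet (l h)
  | copowlet h => exact .copowlet (l h)
  | ccase h h' => exact .ccase (h.shift _) (h'.shift _)
  | cimage h => exact .cimage h

theorem ssubst (h : FrTy b Γ F B C) (s : Tm) : Tm.ssubst s (F.app .svar) = F.app s := by
  cases h with
  | capp h => simp [Fr.app, Tm.ssubst_eq_full, Tm.full, h.sfree.full_eq]
  | ilet h => simp [Fr.app, Tm.ssubst_eq_full, Tm.full, h.sfree.full_eq]
  | banglet h => simp [Fr.app, Tm.ssubst_eq_full, Tm.full, h.sfree.full_eq]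
  | _ => simp [Fr.app, Tm.ssubst]

end FrTy

theorem Fr.shift_app (F : Fr) (t : Tm) : Tm.shift (F.app t) = F.shift.app (Tm.shift t) := by
  cases F <;> rfl

namespace Red

variable (F : Fr) (s t u : Tm)

theorem fr_inv {F : Fr} {t x : Tm} {Γ : List VType} {Δ : Option CType} {A : VType}
    (d : Deriv Γ Δ x A) (e : Tm.erase x = Tm.erase (F.app t)) :
    ∃ F' t' B C, x = Fr.app F' t' ∧ Tm.erase t' = Tm.erase t ∧ F'.erase = F.erase ∧
      A = .comp C ∧ Nonempty (Deriv Γ Δ t' (.comp B)) ∧ FrTy true Γ F' B C := by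
  obtain ⟨F', t', rfl, e1, e2⟩ := Fr.erase_inv e
  obtain ⟨B, C, rfl, h1, h2⟩ := FrTy.inv (d.ty (b := true))
  exact ⟨F', t', B, C, rfl, e1, e2, rfl, h1.deriv, h2⟩

theorem ilet_comm : Red (F.app (.ilet s t)) (.ilet s (F.app t)) := by
  constructor
  intro Γ Δ A x d e
  obtain ⟨F', t', B, C, rfl, e1, e2, rfl, ⟨d'⟩, hF⟩ := fr_inv d e
  cases d' <;> simp only [Tm.erase, reduceCtorEq, Tm.ilet.injEq] at e1
  rename_i d1 d2
  have h := EEq.ilet_comm (hF.app .svar) d1.ty d2.ty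
  simp only [hF.ssubst] at h
  exact ⟨_, by simp only [Tm.erase, Fr.erase_app, e1, e2], h⟩

theorem banglet_comm : Red (F.app (.banglet s t)) (.banglet s (F.shift.app t)) := by
  constructor
  intro Γ Δ A x d e
  obtain ⟨F', t', B, C, rfl, e1, e2, rfl, ⟨d'⟩, hF⟩ := fr_inv d e
  cases d' <;> simp only [Tm.erase, reduceCtorEq, Tm.banglet.injEq] at e1
  rename_i X d1 d2
  have h := EEq.banglet_comm (hF.app .svar) d1.ty d2.ty
  simp only [hF.ssubst, Fr.shift_app, Tm.shift_svar, (hF.shift X).ssubst] at h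
  exact ⟨_, by simp only [Tm.erase, Fr.erase_app, Fr.erase_shift, e1, e2], h⟩

theorem copowlet_comm : Red (F.app (.copowlet s t)) (.copowlet s (F.shift.app t)) := by
  constructor
  intro Γ Δ A x d e
  obtain ⟨F', t', B, C, rfl, e1, e2, rfl, ⟨d'⟩, hF⟩ := fr_inv d e
  cases d' <;> simp only [Tm.erase, reduceCtorEq, Tm.copowlet.injEq] at e1
  rename_i X Y d1 d2
  have h := EEq.copowlet_comm (hF.app .svar) d1.ty d2.ty
  simp only [hF.ssubst, Fr.shift_app, Tm.shift_svar, (hF.shift X).ssubst] at h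
  exact ⟨_, by simp only [Tm.erase, Fr.erase_app, Fr.erase_shift, e1, e2], h⟩

theorem cimage_comm (X Y : CType) : Red (F.app (.cimage X s)) (.cimage Y s) := by
  constructor
  intro Γ Δ A x d e
  obtain ⟨F', t', B, C, rfl, e1, e2, rfl, ⟨d'⟩, hF⟩ := fr_inv d e
  cases d' <;> simp only [Tm.erase, reduceCtorEq, Tm.cimage.injEq, true_and] at e1
  rename_i d1
  have h := EEq.cimage_comm (hF.app .svar) d1.ty
  simp only [hF.ssubst] at h
  exact ⟨_, by simp only [Tm.erase, e1], h⟩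

theorem ccase_comm : Red (F.app (.ccase s t u)) (.ccase s (F.app t) (F.app u)) := by
  constructor
  intro Γ Δ A x d e
  obtain ⟨F', t', B, C, rfl, e1, e2, rfl, ⟨d'⟩, hF⟩ := fr_inv d e
  cases d' <;> simp only [Tm.erase, reduceCtorEq, Tm.ccase.injEq] at e1
  rename_i d1 d2 d3
  have h := EEq.ccase_comm (hF.app .svar) d1.ty d2.ty d3.ty
  simp only [hF.ssubst] at h
  exact ⟨_, by simp only [Tm.erase, Fr.erase_app, e1, e2], h⟩

end Red

end EEC

namespace EEC

/-! ## Normal forms -/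

/-- Neutral (`true`) and normal (`false`) terms. -/
inductive Nf : Bool → Tm → Prop
  | var (n : ℕ) : Nf true (.var n)
  | svar : Nf true .svar
  | vfst {t} : Nf true t → Nf true (.vfst t)
  | vsnd {t} : Nf true t → Nf true (.vsnd t)
  | vapp {s t} : Nf true s → Nf false t → Nf true (.vapp s t)
  | cfst {t} : Nf true t → Nf true (.cfst t)
  | csnd {t} : Nf true t → Nf true (.csnd t)
  | capp {s t} : Nf true s → Nf false t → Nf true (.capp s t)
  | lapp {s t} : Nf true s → Nf false t → Nf true (.lapp s t)
  | unit : Nf false .unit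
  | vpair {s t} : Nf false s → Nf false t → Nf false (.vpair s t)
  | vlam {X t} : Nf false t → Nf false (.vlam X t)
  | cunit : Nf false .cunit
  | cpair {s t} : Nf false s → Nf false t → Nf false (.cpair s t)
  | clam {X t} : Nf false t → Nf false (.clam X t)
  | top : Nf false .top
  | bang {t} : Nf false t → Nf false (.bang t)
  | copow {s t} : Nf false s → Nf false t → Nf false (.copow s t)
  | cinl {t} : Nf false t → Nf false (.cinl t)
  | cinr {t} : Nf false t → Nf false (.cinr t)
  | llam {X t} : Nf false t → Nf false (.llam X t)
  | ilet {s t} : Nf true s → Nf false t → Nf false (.ilet s t)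
  | banglet {s t} : Nf true s → Nf false t → Nf false (.banglet s t)
  | copowlet {s t} : Nf true s → Nf false t → Nf false (.copowlet s t)
  | ccase {s t u} : Nf true s → Nf false t → Nf false u → Nf false (.ccase s t u)
  | cimage {X t} : Nf true t → Nf false (.cimage X t)
  | ne {t} : Nf true t → Nf false t

theorem Nf.rename {b : Bool} {t : Tm} (h : Nf b t) (f : ℕ → ℕ) : Nf b (Tm.rename f t) := by
  induction h generalizing f with
  | ne _ ih => exact .ne (ih f)
  | _ => constructor <;> solve_by_elim

/-- Annotated versions of a normal form are provably equal, and the type of a neutral term is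
determined by its context. -/
theorem Nf.unique {b : Bool} {t : Tm} (h : Nf b t) : ∀ {Γ Δ A A' x y}, Deriv Γ Δ x A →
    Deriv Γ Δ y A' → Tm.erase x = Tm.erase t → Tm.erase y = Tm.erase t →
    (b = true → A = A') ∧ (A = A' → EEq Γ Δ x y A) := by
  induction h <;> intro Γ Δ A A' x y d d' e e'
  case ne ih => exact ⟨nofun, (ih d d' e e').2⟩
  case var =>
    cases d <;> simp only [Tm.erase, reduceCtorEq, Tm.var.injEq] at e
    rename_i h
    subst e
    cases d' <;> simp only [Tm.erase, reduceCtorEq, Tm.var.injEq] at e'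
    rename_i h'
    subst e'
    cases h.symm.trans h'
    exact ⟨fun _ => rfl, fun _ => .refl (.var _ _ _ h)⟩
  case svar =>
    cases d <;> simp only [Tm.erase, reduceCtorEq] at e
    cases d' <;> simp only [Tm.erase, reduceCtorEq] at e'
    exact ⟨fun _ => rfl, fun _ => .refl (.svar _ _)⟩
  case unit =>
    cases d <;> simp only [Tm.erase, reduceCtorEq] at e
    cases d' <;> simp only [Tm.erase, reduceCtorEq] at e'
    exact ⟨nofun, fun _ => .refl (.unit _)⟩
  case cunit =>
    cases d <;> simp only [Tm.erase, reduceCtorEq] at e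
    cases d' <;> simp only [Tm.erase, reduceCtorEq] at e'
    exact ⟨nofun, fun _ => .refl (.cunit _ _)⟩
  case top =>
    cases d <;> simp only [Tm.erase, reduceCtorEq] at e
    cases d' <;> simp only [Tm.erase, reduceCtorEq] at e'
    exact ⟨nofun, fun _ => .refl (.top _)⟩
  case vfst ih0 =>
    cases d <;> simp only [Tm.erase, reduceCtorEq, Tm.vfst.injEq] at e
    rename_i a0
    cases d' <;> simp only [Tm.erase, reduceCtorEq, Tm.vfst.injEq] at e'
    rename_i b0
    obtain ⟨q, r⟩ := ih0 a0 b0 e e'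
    cases q rfl
    exact ⟨fun _ => rfl, fun _ => .vfst_cong (r rfl)⟩
  case vsnd ih0 =>
    cases d <;> simp only [Tm.erase, reduceCtorEq, Tm.vsnd.injEq] at e
    rename_i a0
    cases d' <;> simp only [Tm.erase, reduceCtorEq, Tm.vsnd.injEq] at e'
    rename_i b0
    obtain ⟨q, r⟩ := ih0 a0 b0 e e'
    cases q rfl
    exact ⟨fun _ => rfl, fun _ => .vsnd_cong (r rfl)⟩
  case vapp ih0 ih1 =>
    cases d <;> simp only [Tm.erase, reduceCtorEq, Tm.vapp.injEq] at e
    rename_i a1 a0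
    cases d' <;> simp only [Tm.erase, reduceCtorEq, Tm.vapp.injEq] at e'
    rename_i b1 b0
    obtain ⟨q, r⟩ := ih0 a0 b0 e.1 e'.1
    cases q rfl
    exact ⟨fun _ => rfl, fun _ => .vapp_cong (r rfl) ((ih1 a1 b1 e.2 e'.2).2 rfl)⟩
  case cfst ih0 =>
    cases d <;> simp only [Tm.erase, reduceCtorEq, Tm.cfst.injEq] at e
    rename_i a0
    cases d' <;> simp only [Tm.erase, reduceCtorEq, Tm.cfst.injEq] at e'
    rename_i b0
    obtain ⟨q, r⟩ := ih0 a0 b0 e e'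
    cases q rfl
    exact ⟨fun _ => rfl, fun _ => .cfst_cong (r rfl)⟩
  case csnd ih0 =>
    cases d <;> simp only [Tm.erase, reduceCtorEq, Tm.csnd.injEq] at e
    rename_i a0
    cases d' <;> simp only [Tm.erase, reduceCtorEq, Tm.csnd.injEq] at e'
    rename_i b0
    obtain ⟨q, r⟩ := ih0 a0 b0 e e'
    cases q rfl
    exact ⟨fun _ => rfl, fun _ => .csnd_cong (r rfl)⟩
  case capp ih0 ih1 =>
    cases d <;> simp only [Tm.erase, reduceCtorEq, Tm.capp.injEq] at e
    rename_i a1 a0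
    cases d' <;> simp only [Tm.erase, reduceCtorEq, Tm.capp.injEq] at e'
    rename_i b1 b0
    obtain ⟨q, r⟩ := ih0 a0 b0 e.1 e'.1
    cases q rfl
    exact ⟨fun _ => rfl, fun _ => .capp_cong (r rfl) ((ih1 a1 b1 e.2 e'.2).2 rfl)⟩
  case lapp ih0 ih1 =>
    cases d <;> simp only [Tm.erase, reduceCtorEq, Tm.lapp.injEq] at e
    rename_i a0 a1
    cases d' <;> simp only [Tm.erase, reduceCtorEq, Tm.lapp.injEq] at e'
    rename_i b0 b1
    obtain ⟨q, r⟩ := ih0 a0 b0 e.1 e'.1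
    cases q rfl
    exact ⟨fun _ => rfl, fun _ => .lapp_cong (r rfl) ((ih1 a1 b1 e.2 e'.2).2 rfl)⟩
  case vpair ih0 ih1 =>
    cases d <;> simp only [Tm.erase, reduceCtorEq, Tm.vpair.injEq] at e
    rename_i a0 a1
    cases d' <;> simp only [Tm.erase, reduceCtorEq, Tm.vpair.injEq] at e'
    rename_i b0 b1
    refine ⟨nofun, fun h => ?_⟩
    cases h
    exact .vpair_cong ((ih0 a0 b0 e.1 e'.1).2 rfl) ((ih1 a1 b1 e.2 e'.2).2 rfl)
  case vlam ih0 =>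
    cases d <;> simp only [Tm.erase, reduceCtorEq, Tm.vlam.injEq, true_and] at e
    rename_i a0
    cases d' <;> simp only [Tm.erase, reduceCtorEq, Tm.vlam.injEq, true_and] at e'
    rename_i b0
    refine ⟨nofun, fun h => ?_⟩
    cases h
    exact .vlam_cong ((ih0 a0 b0 e e').2 rfl)
  case cpair ih0 ih1 =>
    cases d <;> simp only [Tm.erase, reduceCtorEq, Tm.cpair.injEq] at e
    rename_i a0 a1
    cases d' <;> simp only [Tm.erase, reduceCtorEq, Tm.cpair.injEq] at e'
    rename_i b0 b1
    refine ⟨nofun, fun h => ?_⟩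
    cases h
    exact .cpair_cong ((ih0 a0 b0 e.1 e'.1).2 rfl) ((ih1 a1 b1 e.2 e'.2).2 rfl)
  case clam ih0 =>
    cases d <;> simp only [Tm.erase, reduceCtorEq, Tm.clam.injEq, true_and] at e
    rename_i a0
    cases d' <;> simp only [Tm.erase, reduceCtorEq, Tm.clam.injEq, true_and] at e'
    rename_i b0
    refine ⟨nofun, fun h => ?_⟩
    cases h
    exact .clam_cong ((ih0 a0 b0 e e').2 rfl)
  case bang ih0 =>
    cases d <;> simp only [Tm.erase, reduceCtorEq, Tm.bang.injEq] at e
    rename_i a0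
    cases d' <;> simp only [Tm.erase, reduceCtorEq, Tm.bang.injEq] at e'
    rename_i b0
    refine ⟨nofun, fun h => ?_⟩
    cases h
    exact .bang_cong ((ih0 a0 b0 e e').2 rfl)
  case copow ih0 ih1 =>
    cases d <;> simp only [Tm.erase, reduceCtorEq, Tm.copow.injEq] at e
    rename_i a0 a1
    cases d' <;> simp only [Tm.erase, reduceCtorEq, Tm.copow.injEq] at e'
    rename_i b0 b1
    refine ⟨nofun, fun h => ?_⟩
    cases h
    exact .copow_cong ((ih0 a0 b0 e.1 e'.1).2 rfl) ((ih1 a1 b1 e.2 e'.2).2 rfl)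
  case cinl ih0 =>
    cases d <;> simp only [Tm.erase, reduceCtorEq, Tm.cinl.injEq] at e
    rename_i a0
    cases d' <;> simp only [Tm.erase, reduceCtorEq, Tm.cinl.injEq] at e'
    rename_i b0
    refine ⟨nofun, fun h => ?_⟩
    cases h
    exact .cinl_cong ((ih0 a0 b0 e e').2 rfl)
  case cinr ih0 =>
    cases d <;> simp only [Tm.erase, reduceCtorEq, Tm.cinr.injEq] at e
    rename_i a0
    cases d' <;> simp only [Tm.erase, reduceCtorEq, Tm.cinr.injEq] at e'
    rename_i b0
    refine ⟨nofun, fun h => ?_⟩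
    cases h
    exact .cinr_cong ((ih0 a0 b0 e e').2 rfl)
  case llam ih0 =>
    cases d <;> simp only [Tm.erase, reduceCtorEq, Tm.llam.injEq, true_and] at e
    rename_i a0
    cases d' <;> simp only [Tm.erase, reduceCtorEq, Tm.llam.injEq, true_and] at e'
    rename_i b0
    refine ⟨nofun, fun h => ?_⟩
    cases h
    exact .llam_cong ((ih0 a0 b0 e e').2 rfl)
  case ilet ih0 ih1 =>
    cases d <;> simp only [Tm.erase, reduceCtorEq, Tm.ilet.injEq] at e
    rename_i a1 a0
    cases d' <;> simp only [Tm.erase, reduceCtorEq, Tm.ilet.injEq] at e'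
    rename_i b1 b0
    obtain ⟨q, r⟩ := ih0 a0 b0 e.1 e'.1
    cases q rfl
    refine ⟨nofun, fun h => ?_⟩
    cases h
    exact .ilet_cong (r rfl) ((ih1 a1 b1 e.2 e'.2).2 rfl)
  case banglet ih0 ih1 =>
    cases d <;> simp only [Tm.erase, reduceCtorEq, Tm.banglet.injEq] at e
    rename_i a1 a0
    cases d' <;> simp only [Tm.erase, reduceCtorEq, Tm.banglet.injEq] at e'
    rename_i b1 b0
    obtain ⟨q, r⟩ := ih0 a0 b0 e.1 e'.1
    cases q rfl
    refine ⟨nofun, fun h => ?_⟩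
    cases h
    exact .banglet_cong (r rfl) ((ih1 a1 b1 e.2 e'.2).2 rfl)
  case copowlet ih0 ih1 =>
    cases d <;> simp only [Tm.erase, reduceCtorEq, Tm.copowlet.injEq] at e
    rename_i a1 a0
    cases d' <;> simp only [Tm.erase, reduceCtorEq, Tm.copowlet.injEq] at e'
    rename_i b1 b0
    obtain ⟨q, r⟩ := ih0 a0 b0 e.1 e'.1
    cases q rfl
    refine ⟨nofun, fun h => ?_⟩
    cases h
    exact .copowlet_cong (r rfl) ((ih1 a1 b1 e.2 e'.2).2 rfl)
  case ccase ih0 ih1 ih2 =>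
    cases d <;> simp only [Tm.erase, reduceCtorEq, Tm.ccase.injEq] at e
    rename_i a1 a2 a0
    cases d' <;> simp only [Tm.erase, reduceCtorEq, Tm.ccase.injEq] at e'
    rename_i b1 b2 b0
    obtain ⟨q, r⟩ := ih0 a0 b0 e.1 e'.1
    cases q rfl
    refine ⟨nofun, fun h => ?_⟩
    cases h
    exact .ccase_cong (r rfl) ((ih1 a1 b1 e.2.1 e'.2.1).2 rfl) ((ih2 a2 b2 e.2.2 e'.2.2).2 rfl)
  case cimage ih0 =>
    cases d <;> simp only [Tm.erase, reduceCtorEq, Tm.cimage.injEq, true_and] at e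
    rename_i a0
    cases d' <;> simp only [Tm.erase, reduceCtorEq, Tm.cimage.injEq, true_and] at e'
    rename_i b0
    obtain ⟨q, r⟩ := ih0 a0 b0 e e'
    cases q rfl
    refine ⟨nofun, fun h => ?_⟩
    cases h
    exact .cimage_cong (r rfl)

end EEC

namespace EEC

/-! ## Normalization by hereditary substitution -/

mutual
  /-- The number of type constructors, not counting `comp`. -/
  def VType.size : VType → ℕ
    | .base _ => 1
    | .unit => 1
    | .prod A B => A.size + B.size + 1
    | .arr A B => A.size + B.size + 1
    | .comp A => A.size
    | .lin A B => A.size + B.size + 1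
  /-- The number of type constructors. -/
  def CType.size : CType → ℕ
    | .base _ => 1
    | .cunit => 1
    | .cand A B => A.size + B.size + 1
    | .carr A B => A.size + B.size + 1
    | .iunit => 1
    | .bang A => A.size + 1
    | .copow A B => A.size + B.size + 1
    | .czero => 1
    | .csum A B => A.size + B.size + 1
end

/-- Normal terms that may be eliminated at types of size at most `k`. -/
def Ok (k : ℕ) (e : Tm) (A : VType) : Prop := Nf true e ∨ (Nf false e ∧ A.size ≤ k)

theorem Ok.nf {k : ℕ} {e : Tm} {A : VType} (h : Ok k e A) : Nf false e := h.elim .ne And.left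

theorem Ok.rename {k : ℕ} {e : Tm} {A : VType} (h : Ok k e A) (f : ℕ → ℕ) :
    Ok k (Tm.rename f e) A := h.imp (·.rename f) (.imp_left (·.rename f))

/-- Typed substitutions by terms that may be eliminated at types of size at most `k`. -/
structure SOk (k : ℕ) (Γ Γ' : List VType) (Δ Δ' : Option CType) (σ : ℕ → Tm) (u : Tm) : Prop where
  ty : TySub false Γ Γ' σ
  st : TyStoup false Γ' Δ Δ' u
  ok : ∀ n A, Γ[n]? = some A → Ok k (σ n) A
  sok : ∀ B, Δ = some B → Ok k u (.comp B)

namespace SOk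

variable {k : ℕ} {Γ Γ' : List VType} {Δ Δ' : Option CType} {σ : ℕ → Tm} {u : Tm}

theorem lift (S : SOk k Γ Γ' Δ Δ' σ u) (X : VType) :
    SOk k (X :: Γ) (X :: Γ') Δ Δ' (Tm.liftS σ) (Tm.shift u) where
  ty := S.ty.lift X
  st := S.st.shift X
  ok n A h := by
    cases n with
    | zero => exact .inl (.var 0)
    | succ n => exact (S.ok n A (by simpa using h)).rename _
  sok B h := (S.sok B h).rename _

theorem svar (S : SOk k Γ Γ' Δ Δ' σ u) (B : Option CType) : SOk k Γ Γ' B B σ .svar where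
  ty := S.ty
  st := .svar
  ok := S.ok
  sok _ _ := .inl .svar

theorem none (S : SOk k Γ Γ' Δ Δ' σ u) : SOk k Γ Γ' none none σ u where
  ty := S.ty
  st := rfl
  ok := S.ok
  sok _ h := nomatch h

theorem var (hu : TyStoup false Γ Δ Δ' u) (h : ∀ B, Δ = some B → Ok k u (.comp B)) :
    SOk k Γ Γ Δ Δ' .var u where
  ty := .var
  st := hu
  ok n _ _ := .inl (.var n)
  sok := h

theorem scons {v : Tm} {X : VType} (hv : Ty false Γ Option.none v X) (hk : Ok k v X)
    (hu : TyStoup false Γ Δ Δ' u) (h : ∀ B, Δ = some B → Ok k u (.comp B)) :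
    SOk k (X :: Γ) Γ Δ Δ' (Tm.scons v) u where
  ty := .scons hv
  st := hu
  ok n A hn := by
    cases n with
    | zero => simp only [List.getElem?_cons_zero, Option.some.injEq] at hn; exact hn ▸ hk
    | succ n => exact .inl (.var n)
  sok := h

end SOk

/-- Hereditary substitution of terms that may be eliminated at types of size at most `k`. -/
def HSub (k : ℕ) : Prop :=
  ∀ {b : Bool} {m : Tm}, Nf b m → ∀ {Γ Γ' Δ Δ' A σ u}, Ty false Γ Δ m A → SOk k Γ Γ' Δ Δ' σ u →
    ∃ e, Red (Tm.full σ u m) e ∧ Nf false e ∧ (b = true → Ok k e A)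

/-- Frames with normal components. -/
def Fr.Nf : Fr → Prop
  | .capp u => EEC.Nf false u
  | .ilet u => EEC.Nf false u
  | .banglet u => EEC.Nf false u
  | .copowlet u => EEC.Nf false u
  | .ccase u u' => EEC.Nf false u ∧ EEC.Nf false u'
  | _ => True

theorem Fr.Nf.shift {F : Fr} (h : F.Nf) : F.shift.Nf := by
  cases F with
  | ccase => exact ⟨h.1.rename _, h.2.rename _⟩
  | capp | ilet | banglet | copowlet => exact EEC.Nf.rename h _
  | _ => exact h

theorem Fr.Nf.app {F : Fr} (h : F.Nf) {n : Tm} (hn : EEC.Nf true n) : EEC.Nf false (F.app n) := by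
  cases F with
  | cfst => exact .ne (.cfst hn)
  | csnd => exact .ne (.csnd hn)
  | capp => exact .ne (.capp hn h)
  | ilet => exact .ilet hn h
  | banglet => exact .banglet hn h
  | copowlet => exact .copowlet hn h
  | ccase => exact .ccase hn h.1 h.2
  | cimage => exact .cimage hn


theorem Nf.fr {k : ℕ} (H : ∀ j < k, HSub j) {b : Bool} {n : Tm} (h : Nf b n) :
    ∀ {Γ Δ B C F}, Ty false Γ Δ n (.comp B) → B.size ≤ k → FrTy false Γ F B C → F.Nf →
      ∃ e, Red (F.app n) e ∧ Nf false e := by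
  induction h with
  | ne h ih => intro Γ Δ B C F _ _ _ hF; exact ⟨_, .refl _, hF.app h⟩
  | unit | vpair | vlam | llam => intro Γ Δ B C F ht; cases ht
  | cunit => intro Γ Δ B C F ht _ hF; cases ht; cases hF
  | cpair h1 h2 =>
    intro Γ Δ B C F ht _ hF _
    cases ht
    cases hF
    · exact ⟨_, .cfst_beta _ _, h1⟩
    · exact ⟨_, .csnd_beta _ _, h2⟩
  | clam h =>
    intro Γ Δ B C F ht hk hF hn
    cases ht with | clam _ ht =>
    cases hF with | capp hu =>
    simp only [CType.size] at hk
    obtain ⟨e, r, n, _⟩ := H _ (by omega) h ht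
      (.scons hu (.inr ⟨hn, le_rfl⟩) .svar fun _ _ => .inl .svar)
    exact ⟨e, (Red.clam_beta _ _ _).trans (Tm.subst0_eq_full _ _ ▸ r), n⟩
  | top =>
    intro Γ Δ B C F ht _ hF hn
    cases ht
    cases hF
    exact ⟨_, .ilet_beta _, hn⟩
  | bang h =>
    intro Γ Δ B C F ht hk hF hn
    cases ht with | bang ht =>
    cases hF with | banglet hu =>
    simp only [CType.size] at hk
    obtain ⟨e, r, n, _⟩ := H _ (by omega) hn hu
      (.scons ht (.inr ⟨h, le_rfl⟩) (u := .svar) rfl nofun)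
    exact ⟨e, (Red.bang_beta _ _).trans (Tm.subst0_eq_full _ _ ▸ r), n⟩
  | @copow s t h1 h2 =>
    intro Γ Δ B C F ht hk hF hn
    cases ht with | @copow _ _ _ _ X Y ht1 ht2 =>
    cases hF with | copowlet hu =>
    simp only [CType.size] at hk
    obtain ⟨e, r, n, _⟩ := H (max X.size Y.size) (by omega) hn hu
      (.scons ht1 (.inr ⟨h1, le_max_left _ _⟩) (u := t) ht2
        fun _ h => by cases h; exact .inr ⟨h2, le_max_right _ _⟩)
    refine ⟨e, (Red.copow_beta _ _ _).trans (.trans (.of_eq ?_) r), n⟩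
    rw [Tm.subst0_eq_full, Tm.ssubst_eq_full, Tm.full_full ht1.sfree.scons]
    simp only [Tm.full]
    congr 1
    funext n
    exact (ht1.sfree.scons n).full_eq _
  | cinl h =>
    intro Γ Δ B C F ht hk hF hn
    cases ht with | @cinl _ _ _ X Y ht =>
    cases hF with | ccase hu hu' =>
    simp only [CType.size] at hk
    obtain ⟨e, r, n, _⟩ := H X.size (by omega) hn.1 hu
      (.var ht fun _ e => by cases e; exact .inr ⟨h, le_rfl⟩)
    exact ⟨e, (Red.csum_beta_inl _ _ _).trans (Tm.ssubst_eq_full _ _ ▸ r), n⟩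
  | cinr h =>
    intro Γ Δ B C F ht hk hF hn
    cases ht with | @cinr _ _ _ X Y ht =>
    cases hF with | ccase hu hu' =>
    simp only [CType.size] at hk
    obtain ⟨e, r, n, _⟩ := H Y.size (by omega) hn.2 hu'
      (.var ht fun _ e => by cases e; exact .inr ⟨h, le_rfl⟩)
    exact ⟨e, (Red.csum_beta_inr _ _ _).trans (Tm.ssubst_eq_full _ _ ▸ r), n⟩
  | ilet h1 _ _ ih =>
    intro Γ Δ B C F ht hk hF hn
    cases ht with | ilet ht1 ht2 =>
    obtain ⟨e, r, n⟩ := ih ht2 hk hF hn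
    exact ⟨_, (Red.ilet_comm _ _ _).trans (.ilet (.refl _) r), .ilet h1 n⟩
  | banglet h1 _ _ ih =>
    intro Γ Δ B C F ht hk hF hn
    cases ht with | banglet ht1 ht2 =>
    obtain ⟨e, r, n⟩ := ih ht2 hk (hF.shift _) hn.shift
    exact ⟨_, (Red.banglet_comm _ _ _).trans (.banglet (.refl _) r), .banglet h1 n⟩
  | copowlet h1 _ _ ih =>
    intro Γ Δ B C F ht hk hF hn
    cases ht with | copowlet ht1 ht2 =>
    obtain ⟨e, r, n⟩ := ih ht2 hk (hF.shift _) hn.shift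
    exact ⟨_, (Red.copowlet_comm _ _ _).trans (.copowlet (.refl _) r), .copowlet h1 n⟩
  | ccase h1 _ _ _ ih ih' =>
    intro Γ Δ B C F ht hk hF hn
    cases ht with | ccase ht1 ht2 ht3 =>
    obtain ⟨e, r, n⟩ := ih ht2 hk hF hn
    obtain ⟨e', r', n'⟩ := ih' ht3 hk hF hn
    exact ⟨_, (Red.ccase_comm _ _ _ _).trans (.ccase (.refl _) r r'), .ccase h1 n n'⟩
  | cimage h =>
    intro Γ Δ B C F ht hk hF hn
    exact ⟨_, Red.cimage_comm _ _ _ .cunit, .cimage h⟩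
  | svar | var | vfst | vsnd | vapp | cfst | csnd | capp | lapp =>
    intro Γ Δ B C F _ _ _ hF
    exact ⟨_, .refl _, hF.app (by constructor <;> assumption)⟩

namespace Ok

variable {k : ℕ} {Γ : List VType} {Δ : Option CType}

theorem fr (H : ∀ j < k, HSub j) {n : Tm} {F : Fr} {B C : CType} (h : Ok k n (.comp B))
    (ht : Ty false Γ Δ n (.comp B)) (hF : FrTy false Γ F B C) (hn : F.Nf) :
    ∃ e, Red (F.app n) e ∧ Nf false e := by
  obtain h | ⟨h, hk⟩ := h
  · exact ⟨_, .refl _, hn.app h⟩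
  · exact h.fr H ht hk hF hn

theorem cfst (H : ∀ j < k, HSub j) {n : Tm} {A B : CType} (h : Ok k n (.comp (.cand A B)))
    (ht : Ty false Γ Δ n (.comp (.cand A B))) : ∃ e, Red (.cfst n) e ∧ Ok k e (.comp A) := by
  obtain h | ⟨h, hk⟩ := h
  · exact ⟨_, .refl _, .inl (.cfst h)⟩
  · obtain ⟨e, r, n⟩ := h.fr H ht hk .cfst trivial
    simp only [VType.size, CType.size] at hk
    exact ⟨e, r, .inr ⟨n, by simp only [VType.size]; omega⟩⟩

theorem csnd (H : ∀ j < k, HSub j) {n : Tm} {A B : CType} (h : Ok k n (.comp (.cand A B)))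
    (ht : Ty false Γ Δ n (.comp (.cand A B))) : ∃ e, Red (.csnd n) e ∧ Ok k e (.comp B) := by
  obtain h | ⟨h, hk⟩ := h
  · exact ⟨_, .refl _, .inl (.csnd h)⟩
  · obtain ⟨e, r, n⟩ := h.fr H ht hk .csnd trivial
    simp only [VType.size, CType.size] at hk
    exact ⟨e, r, .inr ⟨n, by simp only [VType.size]; omega⟩⟩

theorem capp (H : ∀ j < k, HSub j) {n u : Tm} {A : VType} {B : CType}
    (h : Ok k n (.comp (.carr A B))) (ht : Ty false Γ Δ n (.comp (.carr A B)))
    (hu : Ty false Γ none u A) (hn : Nf false u) :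
    ∃ e, Red (.capp n u) e ∧ Ok k e (.comp B) := by
  obtain h | ⟨h, hk⟩ := h
  · exact ⟨_, .refl _, .inl (.capp h hn)⟩
  · obtain ⟨e, r, n⟩ := h.fr H ht hk (.capp hu) hn
    simp only [VType.size, CType.size] at hk
    exact ⟨e, r, .inr ⟨n, by simp only [VType.size]; omega⟩⟩

theorem vfst {n : Tm} {A B : VType} (h : Ok k n (.prod A B))
    (ht : Ty false Γ none n (.prod A B)) : ∃ e, Red (.vfst n) e ∧ Ok k e A := by
  obtain h | ⟨h, hk⟩ := h
  · exact ⟨_, .refl _, .inl (.vfst h)⟩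
  · simp only [VType.size] at hk
    cases h with
    | ne h => exact ⟨_, .refl _, .inl (.vfst h)⟩
    | vpair h1 h2 => exact ⟨_, .vfst_beta _ _, .inr ⟨h1, by omega⟩⟩
    | _ => cases ht

theorem vsnd {n : Tm} {A B : VType} (h : Ok k n (.prod A B))
    (ht : Ty false Γ none n (.prod A B)) : ∃ e, Red (.vsnd n) e ∧ Ok k e B := by
  obtain h | ⟨h, hk⟩ := h
  · exact ⟨_, .refl _, .inl (.vsnd h)⟩
  · simp only [VType.size] at hk
    cases h with
    | ne h => exact ⟨_, .refl _, .inl (.vsnd h)⟩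
    | vpair h1 h2 => exact ⟨_, .vsnd_beta _ _, .inr ⟨h2, by omega⟩⟩
    | _ => cases ht

theorem vapp (H : ∀ j < k, HSub j) {n u : Tm} {A B : VType} (h : Ok k n (.arr A B))
    (ht : Ty false Γ none n (.arr A B)) (hu : Ty false Γ none u A) (hn : Nf false u) :
    ∃ e, Red (.vapp n u) e ∧ Ok k e B := by
  obtain h | ⟨h, hk⟩ := h
  · exact ⟨_, .refl _, .inl (.vapp h hn)⟩
  · simp only [VType.size] at hk
    cases h with
    | ne h => exact ⟨_, .refl _, .inl (.vapp h hn)⟩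
    | vlam h =>
      cases ht with | vlam _ ht =>
      obtain ⟨e, r, n, _⟩ := H _ (by omega) h ht
        (.scons hu (.inr ⟨hn, le_rfl⟩) (u := .svar) rfl nofun)
      exact ⟨e, (Red.vlam_beta _ _ _).trans (Tm.subst0_eq_full _ _ ▸ r), .inr ⟨n, by omega⟩⟩
    | _ => cases ht

theorem lapp (H : ∀ j < k, HSub j) {n u : Tm} {A B : CType} (h : Ok k n (.lin A B))
    (ht : Ty false Γ none n (.lin A B)) (hu : Ty false Γ Δ u (.comp A)) (hn : Nf false u) :
    ∃ e, Red (.lapp n u) e ∧ Ok k e (.comp B) := by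
  obtain h | ⟨h, hk⟩ := h
  · exact ⟨_, .refl _, .inl (.lapp h hn)⟩
  · simp only [VType.size] at hk
    cases h with
    | ne h => exact ⟨_, .refl _, .inl (.lapp h hn)⟩
    | llam h =>
      cases ht with | llam _ ht =>
      obtain ⟨e, r, n, _⟩ := H A.size (by omega) h ht
        (.var hu fun _ e => by cases e; exact .inr ⟨hn, le_rfl⟩)
      exact ⟨e, (Red.llam_beta _ _ _).trans (Tm.ssubst_eq_full _ _ ▸ r),
        .inr ⟨n, by simp only [VType.size]; omega⟩⟩
    | _ => cases ht

end Ok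

end EEC

namespace EEC

/-- Hereditary substitution at size `k` follows from hereditary substitution at smaller sizes. -/
theorem HSub.of_lt {k : ℕ} (H : ∀ j < k, HSub j) : HSub k := by
  intro b m hm
  induction hm with
  | var n =>
    intro Γ Γ' Δ Δ' A σ u ht S
    cases ht with | var h =>
    exact ⟨_, .refl _, (S.ok _ _ h).nf, fun _ => S.ok _ _ h⟩
  | svar =>
    intro Γ Γ' Δ Δ' A σ u ht S
    cases ht
    exact ⟨_, .refl _, (S.sok _ rfl).nf, fun _ => S.sok _ rfl⟩
  | ne _ ih =>
    intro Γ Γ' Δ Δ' A σ u ht S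
    obtain ⟨e, r, n, _⟩ := ih ht S
    exact ⟨e, r, n, nofun⟩
  | vfst _ ih =>
    intro Γ Γ' Δ Δ' A σ u ht S
    cases ht with | vfst ht =>
    obtain ⟨e, r, _, o⟩ := ih ht S
    obtain ⟨e', r', o'⟩ := (o rfl).vfst (r.ty (ht.full S.ty S.none.st))
    exact ⟨e', (Red.vfst r).trans r', o'.nf, fun _ => o'⟩
  | vsnd _ ih =>
    intro Γ Γ' Δ Δ' A σ u ht S
    cases ht with | vsnd ht =>
    obtain ⟨e, r, _, o⟩ := ih ht S
    obtain ⟨e', r', o'⟩ := (o rfl).vsnd (r.ty (ht.full S.ty S.none.st))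
    exact ⟨e', (Red.vsnd r).trans r', o'.nf, fun _ => o'⟩
  | cfst _ ih =>
    intro Γ Γ' Δ Δ' A σ u ht S
    cases ht with | cfst ht =>
    obtain ⟨e, r, _, o⟩ := ih ht S
    obtain ⟨e', r', o'⟩ := (o rfl).cfst H (r.ty (ht.full S.ty S.st))
    exact ⟨e', (Red.cfst r).trans r', o'.nf, fun _ => o'⟩
  | csnd _ ih =>
    intro Γ Γ' Δ Δ' A σ u ht S
    cases ht with | csnd ht =>
    obtain ⟨e, r, _, o⟩ := ih ht S
    obtain ⟨e', r', o'⟩ := (o rfl).csnd H (r.ty (ht.full S.ty S.st))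
    exact ⟨e', (Red.csnd r).trans r', o'.nf, fun _ => o'⟩
  | vapp _ _ ih ih' =>
    intro Γ Γ' Δ Δ' A σ u ht S
    cases ht with | vapp ht hu =>
    obtain ⟨e, r, _, o⟩ := ih ht S
    obtain ⟨a, ra, na, _⟩ := ih' hu S
    obtain ⟨e', r', o'⟩ := (o rfl).vapp H (r.ty (ht.full S.ty S.none.st))
      (ra.ty (hu.full S.ty S.none.st)) na
    exact ⟨e', (Red.vapp r ra).trans r', o'.nf, fun _ => o'⟩
  | capp _ _ ih ih' =>
    intro Γ Γ' Δ Δ' A σ u ht S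
    cases ht with | capp ht hu =>
    obtain ⟨e, r, _, o⟩ := ih ht S
    obtain ⟨a, ra, na, _⟩ := ih' hu S.none
    obtain ⟨e', r', o'⟩ := (o rfl).capp H (r.ty (ht.full S.ty S.st))
      (ra.ty (hu.full S.ty S.none.st)) na
    exact ⟨e', (Red.capp r ra).trans r', o'.nf, fun _ => o'⟩
  | lapp _ _ ih ih' =>
    intro Γ Γ' Δ Δ' A σ u ht S
    cases ht with | lapp ht hu =>
    obtain ⟨e, r, _, o⟩ := ih ht S.none
    obtain ⟨a, ra, na, _⟩ := ih' hu S
    obtain ⟨e', r', o'⟩ := (o rfl).lapp H (r.ty (ht.full S.ty S.none.st))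
      (ra.ty (hu.full S.ty S.st)) na
    exact ⟨e', (Red.lapp r ra).trans r', o'.nf, fun _ => o'⟩
  | unit => intro Γ Γ' Δ Δ' A σ u ht S; exact ⟨_, .refl _, .unit, nofun⟩
  | cunit => intro Γ Γ' Δ Δ' A σ u ht S; exact ⟨_, .refl _, .cunit, nofun⟩
  | top => intro Γ Γ' Δ Δ' A σ u ht S; exact ⟨_, .refl _, .top, nofun⟩
  | vpair _ _ ih ih' =>
    intro Γ Γ' Δ Δ' A σ u ht S
    cases ht with | vpair ht hu =>
    obtain ⟨e, r, n, _⟩ := ih ht S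
    obtain ⟨e', r', n', _⟩ := ih' hu S
    exact ⟨_, .vpair r r', .vpair n n', nofun⟩
  | cpair _ _ ih ih' =>
    intro Γ Γ' Δ Δ' A σ u ht S
    cases ht with | cpair ht hu =>
    obtain ⟨e, r, n, _⟩ := ih ht S
    obtain ⟨e', r', n', _⟩ := ih' hu S
    exact ⟨_, .cpair r r', .cpair n n', nofun⟩
  | copow _ _ ih ih' =>
    intro Γ Γ' Δ Δ' A σ u ht S
    cases ht with | copow ht hu =>
    obtain ⟨e, r, n, _⟩ := ih ht S.none
    obtain ⟨e', r', n', _⟩ := ih' hu S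
    exact ⟨_, .copow r r', .copow n n', nofun⟩
  | vlam _ ih =>
    intro Γ Γ' Δ Δ' A σ u ht S
    cases ht with | vlam _ ht =>
    obtain ⟨e, r, n, _⟩ := ih ht (S.lift _)
    exact ⟨_, .vlam (Y := .unit) r, .vlam n, nofun⟩
  | clam _ ih =>
    intro Γ Γ' Δ Δ' A σ u ht S
    cases ht with | clam _ ht =>
    obtain ⟨e, r, n, _⟩ := ih ht (S.lift _)
    exact ⟨_, .clam (Y := .unit) r, .clam n, nofun⟩
  | llam _ ih =>
    intro Γ Γ' Δ Δ' A σ u ht S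
    cases ht with | llam _ ht =>
    obtain ⟨e, r, n, _⟩ := ih ht (S.svar _)
    exact ⟨_, .llam (Y := .cunit) r, .llam n, nofun⟩
  | bang _ ih =>
    intro Γ Γ' Δ Δ' A σ u ht S
    cases ht with | bang ht =>
    obtain ⟨e, r, n, _⟩ := ih ht S
    exact ⟨_, .bang r, .bang n, nofun⟩
  | cinl _ ih =>
    intro Γ Γ' Δ Δ' A σ u ht S
    cases ht with | cinl ht =>
    obtain ⟨e, r, n, _⟩ := ih ht S
    exact ⟨_, .cinl r, .cinl n, nofun⟩
  | cinr _ ih =>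
    intro Γ Γ' Δ Δ' A σ u ht S
    cases ht with | cinr ht =>
    obtain ⟨e, r, n, _⟩ := ih ht S
    exact ⟨_, .cinr r, .cinr n, nofun⟩
  | ilet _ _ ih ih' =>
    intro Γ Γ' Δ Δ' A σ u ht S
    cases ht with | ilet ht hu =>
    obtain ⟨e, r, _, o⟩ := ih ht S
    obtain ⟨a, ra, na, _⟩ := ih' hu S.none
    obtain ⟨e', r', n'⟩ := (o rfl).fr H (F := .ilet a) (r.ty (ht.full S.ty S.st))
      (.ilet (ra.ty (hu.full S.ty S.none.st))) na
    exact ⟨e', (Red.ilet r ra).trans r', n', nofun⟩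
  | banglet _ _ ih ih' =>
    intro Γ Γ' Δ Δ' A σ u ht S
    cases ht with | banglet ht hu =>
    have S' := S.none.lift
    obtain ⟨e, r, _, o⟩ := ih ht S
    obtain ⟨a, ra, na, _⟩ := ih' hu (S' _)
    obtain ⟨e', r', n'⟩ := (o rfl).fr H (F := .banglet a) (r.ty (ht.full S.ty S.st))
      (.banglet (ra.ty (hu.full (S' _).ty (S' _).st))) na
    exact ⟨e', (Red.banglet r ra).trans r', n', nofun⟩
  | copowlet _ _ ih ih' =>
    intro Γ Γ' Δ Δ' A σ u ht S
    cases ht with | @copowlet _ _ _ _ X Y _ ht hu =>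
    have S' := (S.svar Y).lift X
    obtain ⟨e, r, _, o⟩ := ih ht S
    obtain ⟨a, ra, na, _⟩ := ih' hu S'
    obtain ⟨e', r', n'⟩ := (o rfl).fr H (F := .copowlet a) (r.ty (ht.full S.ty S.st))
      (.copowlet (ra.ty (hu.full S'.ty S'.st))) na
    exact ⟨e', (Red.copowlet r ra).trans r', n', nofun⟩
  | ccase _ _ _ ih ih' ih'' =>
    intro Γ Γ' Δ Δ' A σ u ht S
    cases ht with | @ccase _ _ _ _ _ X Y _ ht hu hv =>
    have S' := S.svar X
    have S'' := S.svar Y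
    obtain ⟨e, r, _, o⟩ := ih ht S
    obtain ⟨a, ra, na, _⟩ := ih' hu S'
    obtain ⟨c, rc, nc, _⟩ := ih'' hv S''
    obtain ⟨e', r', n'⟩ := (o rfl).fr H (F := .ccase a c) (r.ty (ht.full S.ty S.st))
      (.ccase (ra.ty (hu.full S'.ty S'.st)) (rc.ty (hv.full S''.ty S''.st)))
      ⟨na, nc⟩
    exact ⟨e', (Red.ccase r ra rc).trans r', n', nofun⟩
  | cimage _ ih =>
    intro Γ Γ' Δ Δ' A σ u ht S
    cases ht with | @cimage _ _ _ _ A _ ht =>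
    obtain ⟨e, r, _, o⟩ := ih ht S
    obtain ⟨e', r', n'⟩ := (o rfl).fr H (F := .cimage .cunit) (r.ty (ht.full S.ty S.st))
      (.cimage (A := A) nofun) trivial
    exact ⟨e', (Red.cimage r).trans r', n', nofun⟩

theorem HSub.all (k : ℕ) : HSub k := by
  induction k using Nat.strong_induction_on with
  | _ k ih => exact HSub.of_lt ih

theorem Nf.ok {e : Tm} (h : Nf false e) (A : VType) : Ok A.size e A := .inr ⟨h, le_rfl⟩

/-- Weak normalization. -/
theorem Ty.exists_nf {Γ Δ t A} (h : Ty false Γ Δ t A) : ∃ e, Red t e ∧ Nf false e := by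
  have H : ∀ k, ∀ j < k, HSub j := fun _ j _ => HSub.all j
  induction h with
  | var => exact ⟨_, .refl _, .ne (.var _)⟩
  | svar => exact ⟨_, .refl _, .ne .svar⟩
  | unit => exact ⟨_, .refl _, .unit⟩
  | cunit => exact ⟨_, .refl _, .cunit⟩
  | top => exact ⟨_, .refl _, .top⟩
  | vpair _ _ ih ih' =>
    obtain ⟨e, r, n⟩ := ih
    obtain ⟨e', r', n'⟩ := ih'
    exact ⟨_, .vpair r r', .vpair n n'⟩
  | cpair _ _ ih ih' =>
    obtain ⟨e, r, n⟩ := ih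
    obtain ⟨e', r', n'⟩ := ih'
    exact ⟨_, .cpair r r', .cpair n n'⟩
  | copow _ _ ih ih' =>
    obtain ⟨e, r, n⟩ := ih
    obtain ⟨e', r', n'⟩ := ih'
    exact ⟨_, .copow r r', .copow n n'⟩
  | vlam _ _ ih => obtain ⟨e, r, n⟩ := ih; exact ⟨_, .vlam (Y := .unit) r, .vlam n⟩
  | clam _ _ ih => obtain ⟨e, r, n⟩ := ih; exact ⟨_, .clam (Y := .unit) r, .clam n⟩
  | llam _ _ ih => obtain ⟨e, r, n⟩ := ih; exact ⟨_, .llam (Y := .cunit) r, .llam n⟩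
  | bang _ ih => obtain ⟨e, r, n⟩ := ih; exact ⟨_, .bang r, .bang n⟩
  | cinl _ ih => obtain ⟨e, r, n⟩ := ih; exact ⟨_, .cinl r, .cinl n⟩
  | cinr _ ih => obtain ⟨e, r, n⟩ := ih; exact ⟨_, .cinr r, .cinr n⟩
  | vfst h ih =>
    obtain ⟨e, r, n⟩ := ih
    obtain ⟨e', r', o⟩ := (n.ok _).vfst (r.ty h)
    exact ⟨_, (Red.vfst r).trans r', o.nf⟩
  | vsnd h ih =>
    obtain ⟨e, r, n⟩ := ih
    obtain ⟨e', r', o⟩ := (n.ok _).vsnd (r.ty h)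
    exact ⟨_, (Red.vsnd r).trans r', o.nf⟩
  | cfst h ih =>
    obtain ⟨e, r, n⟩ := ih
    obtain ⟨e', r', o⟩ := (n.ok _).cfst (H _) (r.ty h)
    exact ⟨_, (Red.cfst r).trans r', o.nf⟩
  | csnd h ih =>
    obtain ⟨e, r, n⟩ := ih
    obtain ⟨e', r', o⟩ := (n.ok _).csnd (H _) (r.ty h)
    exact ⟨_, (Red.csnd r).trans r', o.nf⟩
  | vapp h h' ih ih' =>
    obtain ⟨e, r, n⟩ := ih
    obtain ⟨a, ra, na⟩ := ih'
    obtain ⟨e', r', o⟩ := (n.ok _).vapp (H _) (r.ty h) (ra.ty h') na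
    exact ⟨_, (Red.vapp r ra).trans r', o.nf⟩
  | capp h h' ih ih' =>
    obtain ⟨e, r, n⟩ := ih
    obtain ⟨a, ra, na⟩ := ih'
    obtain ⟨e', r', o⟩ := (n.ok _).capp (H _) (r.ty h) (ra.ty h') na
    exact ⟨_, (Red.capp r ra).trans r', o.nf⟩
  | lapp h h' ih ih' =>
    obtain ⟨e, r, n⟩ := ih
    obtain ⟨a, ra, na⟩ := ih'
    obtain ⟨e', r', o⟩ := (n.ok _).lapp (H _) (r.ty h) (ra.ty h') na
    exact ⟨_, (Red.lapp r ra).trans r', o.nf⟩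
  | ilet h h' ih ih' =>
    obtain ⟨e, r, n⟩ := ih
    obtain ⟨a, ra, na⟩ := ih'
    obtain ⟨e', r', o⟩ := (n.ok _).fr (H _) (r.ty h) (F := .ilet a) (.ilet (ra.ty h')) na
    exact ⟨_, (Red.ilet r ra).trans r', o⟩
  | banglet h h' ih ih' =>
    obtain ⟨e, r, n⟩ := ih
    obtain ⟨a, ra, na⟩ := ih'
    obtain ⟨e', r', o⟩ := (n.ok _).fr (H _) (r.ty h) (F := .banglet a) (.banglet (ra.ty h')) na
    exact ⟨_, (Red.banglet r ra).trans r', o⟩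
  | copowlet h h' ih ih' =>
    obtain ⟨e, r, n⟩ := ih
    obtain ⟨a, ra, na⟩ := ih'
    obtain ⟨e', r', o⟩ := (n.ok _).fr (H _) (r.ty h) (F := .copowlet a) (.copowlet (ra.ty h')) na
    exact ⟨_, (Red.copowlet r ra).trans r', o⟩
  | ccase h h' h'' ih ih' ih'' =>
    obtain ⟨e, r, n⟩ := ih
    obtain ⟨a, ra, na⟩ := ih'
    obtain ⟨c, rc, nc⟩ := ih''
    obtain ⟨e', r', o⟩ := (n.ok _).fr (H _) (r.ty h) (F := .ccase a c)
      (.ccase (ra.ty h') (rc.ty h'')) ⟨na, nc⟩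
    exact ⟨_, (Red.ccase r ra rc).trans r', o⟩
  | @cimage _ _ _ _ A _ h ih =>
    obtain ⟨e, r, n⟩ := ih
    obtain ⟨e', r', o⟩ := (n.ok _).fr (H _) (r.ty h) (F := .cimage .cunit)
      (.cimage (A := A) nofun) trivial
    exact ⟨_, (Red.cimage r).trans r', o⟩

/-- Coherence: two annotations of the same term are provably equal. -/
theorem Deriv.coherence {Γ Δ s t A} (d : Deriv Γ Δ s A) (d' : Deriv Γ Δ t A)
    (e : Tm.erase s = Tm.erase t) : EEq Γ Δ s t A := by
  obtain ⟨n, r, hn⟩ := (d.ty (b := false)).exists_nf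
  obtain ⟨s', e1, q1⟩ := r.run d rfl
  obtain ⟨t', e2, q2⟩ := r.run d' e.symm
  exact q1.trans (((hn.unique q1.ty.2.toDeriv q2.ty.2.toDeriv e1 e2).2 rfl).trans q2.symm)

end EEC

namespace EEC

/-- Provable equality of well-typed terms up to the choice of type annotations. -/
def Q (Γ : List VType) (Δ : Option CType) (t t' : Tm) (A : VType) : Prop :=
  ∃ s s', Tm.erase s = Tm.erase t ∧ Tm.erase s' = Tm.erase t' ∧ EEq Γ Δ s s' A

theorem EEq.q {Γ Δ t t' A} (h : EEq Γ Δ t t' A) : Q Γ Δ t t' A := ⟨t, t', rfl, rfl, h⟩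

namespace Q

variable {Γ : List VType} {Δ : Option CType} {t t' u : Tm} {A B : VType} {C D E : CType}

theorem of_erase {s s' : Tm} (h : Q Γ Δ s s' A) (e : Tm.erase s = Tm.erase t)
    (e' : Tm.erase s' = Tm.erase t') : Q Γ Δ t t' A := by
  obtain ⟨x, y, a, b, q⟩ := h
  exact ⟨x, y, a.trans e, b.trans e', q⟩

theorem refl (h : Ty false Γ Δ t A) : Q Γ Δ t t A := by
  obtain ⟨s, e, ⟨d⟩⟩ := h.lift
  exact ⟨s, s, e, e, .refl d⟩

theorem symm (h : Q Γ Δ t t' A) : Q Γ Δ t' t A := by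
  obtain ⟨s, s', e, e', q⟩ := h
  exact ⟨s', s, e', e, q.symm⟩

theorem trans (h : Q Γ Δ t t' A) (h' : Q Γ Δ t' u A) : Q Γ Δ t u A := by
  obtain ⟨x, y, a, b, q⟩ := h
  obtain ⟨z, w, c, d, r⟩ := h'
  exact ⟨x, w, a, d,
    q.trans ((q.ty.2.toDeriv.coherence r.ty.1.toDeriv (b.trans c.symm)).trans r)⟩

theorem left (h : Q Γ Δ t t' A) : Ty false Γ Δ t A := by
  obtain ⟨x, y, a, b, q⟩ := h
  exact q.ty.1.of_erase_eq a.symm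

theorem right (h : Q Γ Δ t t' A) : Ty false Γ Δ t' A := h.symm.left

/-- On annotated terms, equality up to annotations is provable equality. -/
theorem eeq (h : Q Γ Δ t t' A) (d : Deriv Γ Δ t A) (d' : Deriv Γ Δ t' A) : EEq Γ Δ t t' A := by
  obtain ⟨x, y, a, b, q⟩ := h
  exact (d.coherence q.ty.1.toDeriv a.symm).trans (q.trans (q.ty.2.toDeriv.coherence d' b))

theorem of_red (h : Red t t') (ht : Ty false Γ Δ t A) : Q Γ Δ t t' A := by
  obtain ⟨s, e, ⟨d⟩⟩ := ht.lift
  obtain ⟨s', e', q⟩ := h.run d e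
  exact ⟨s, s', e, e', q⟩

theorem red (h : Q Γ Δ t t' A) (r : Red t' u) : Q Γ Δ t u A := h.trans (.of_red r h.right)

theorem expand (h : Q Γ Δ t t' A) {s} (r : Red s t') (hs : Ty false Γ Δ s A) : Q Γ Δ t s A :=
  h.trans (of_red r hs).symm

theorem vpair {s s' t t' : Tm} (h0 : Q Γ none s s' A) (h1 : Q Γ none t t' B) :
    Q Γ none (.vpair s t) (.vpair s' t') (.prod A B) := by
  obtain ⟨_, _, a0, b0, q0⟩ := h0
  obtain ⟨_, _, a1, b1, q1⟩ := h1
  exact ⟨_, _, by simp [Tm.erase, a0, a1], by simp [Tm.erase, b0, b1],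
    .vpair_cong q0 q1⟩

theorem vfst {s s' : Tm} (h0 : Q Γ none s s' (.prod A B)) :
    Q Γ none (.vfst s) (.vfst s') A := by
  obtain ⟨_, _, a0, b0, q0⟩ := h0
  exact ⟨_, _, by simp [Tm.erase, a0], by simp [Tm.erase, b0],
    .vfst_cong q0⟩

theorem vsnd {s s' : Tm} (h0 : Q Γ none s s' (.prod A B)) :
    Q Γ none (.vsnd s) (.vsnd s') B := by
  obtain ⟨_, _, a0, b0, q0⟩ := h0
  exact ⟨_, _, by simp [Tm.erase, a0], by simp [Tm.erase, b0],
    .vsnd_cong q0⟩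

theorem vapp {s s' t t' : Tm} (h0 : Q Γ none s s' (.arr A B)) (h1 : Q Γ none t t' A) :
    Q Γ none (.vapp s t) (.vapp s' t') B := by
  obtain ⟨_, _, a0, b0, q0⟩ := h0
  obtain ⟨_, _, a1, b1, q1⟩ := h1
  exact ⟨_, _, by simp [Tm.erase, a0, a1], by simp [Tm.erase, b0, b1],
    .vapp_cong q0 q1⟩

theorem cpair {s s' t t' : Tm} (h0 : Q Γ Δ s s' (.comp C)) (h1 : Q Γ Δ t t' (.comp D)) :
    Q Γ Δ (.cpair s t) (.cpair s' t') (.comp (.cand C D)) := by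
  obtain ⟨_, _, a0, b0, q0⟩ := h0
  obtain ⟨_, _, a1, b1, q1⟩ := h1
  exact ⟨_, _, by simp [Tm.erase, a0, a1], by simp [Tm.erase, b0, b1],
    .cpair_cong q0 q1⟩

theorem cfst {s s' : Tm} (h0 : Q Γ Δ s s' (.comp (.cand C D))) :
    Q Γ Δ (.cfst s) (.cfst s') (.comp C) := by
  obtain ⟨_, _, a0, b0, q0⟩ := h0
  exact ⟨_, _, by simp [Tm.erase, a0], by simp [Tm.erase, b0],
    .cfst_cong q0⟩

theorem csnd {s s' : Tm} (h0 : Q Γ Δ s s' (.comp (.cand C D))) :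
    Q Γ Δ (.csnd s) (.csnd s') (.comp D) := by
  obtain ⟨_, _, a0, b0, q0⟩ := h0
  exact ⟨_, _, by simp [Tm.erase, a0], by simp [Tm.erase, b0],
    .csnd_cong q0⟩

theorem capp {s s' t t' : Tm} (h0 : Q Γ Δ s s' (.comp (.carr A C))) (h1 : Q Γ none t t' A) :
    Q Γ Δ (.capp s t) (.capp s' t') (.comp C) := by
  obtain ⟨_, _, a0, b0, q0⟩ := h0
  obtain ⟨_, _, a1, b1, q1⟩ := h1
  exact ⟨_, _, by simp [Tm.erase, a0, a1], by simp [Tm.erase, b0, b1],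
    .capp_cong q0 q1⟩

theorem ilet {s s' t t' : Tm} (h0 : Q Γ Δ s s' (.comp .iunit)) (h1 : Q Γ none t t' (.comp C)) :
    Q Γ Δ (.ilet s t) (.ilet s' t') (.comp C) := by
  obtain ⟨_, _, a0, b0, q0⟩ := h0
  obtain ⟨_, _, a1, b1, q1⟩ := h1
  exact ⟨_, _, by simp [Tm.erase, a0, a1], by simp [Tm.erase, b0, b1],
    .ilet_cong q0 q1⟩

theorem bang {s s' : Tm} (h0 : Q Γ none s s' A) :
    Q Γ none (.bang s) (.bang s') (.comp (.bang A)) := by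
  obtain ⟨_, _, a0, b0, q0⟩ := h0
  exact ⟨_, _, by simp [Tm.erase, a0], by simp [Tm.erase, b0],
    .bang_cong q0⟩

theorem banglet {s s' t t' : Tm} (h0 : Q Γ Δ s s' (.comp (.bang A))) (h1 : Q (A :: Γ) none t t' (.comp C)) :
    Q Γ Δ (.banglet s t) (.banglet s' t') (.comp C) := by
  obtain ⟨_, _, a0, b0, q0⟩ := h0
  obtain ⟨_, _, a1, b1, q1⟩ := h1
  exact ⟨_, _, by simp [Tm.erase, a0, a1], by simp [Tm.erase, b0, b1],
    .banglet_cong q0 q1⟩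

theorem copow {s s' t t' : Tm} (h0 : Q Γ none s s' A) (h1 : Q Γ Δ t t' (.comp C)) :
    Q Γ Δ (.copow s t) (.copow s' t') (.comp (.copow A C)) := by
  obtain ⟨_, _, a0, b0, q0⟩ := h0
  obtain ⟨_, _, a1, b1, q1⟩ := h1
  exact ⟨_, _, by simp [Tm.erase, a0, a1], by simp [Tm.erase, b0, b1],
    .copow_cong q0 q1⟩

theorem copowlet {s s' t t' : Tm} (h0 : Q Γ Δ s s' (.comp (.copow A C))) (h1 : Q (A :: Γ) (some C) t t' (.comp D)) :
    Q Γ Δ (.copowlet s t) (.copowlet s' t') (.comp D) := by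
  obtain ⟨_, _, a0, b0, q0⟩ := h0
  obtain ⟨_, _, a1, b1, q1⟩ := h1
  exact ⟨_, _, by simp [Tm.erase, a0, a1], by simp [Tm.erase, b0, b1],
    .copowlet_cong q0 q1⟩

theorem cinl {s s' : Tm} (h0 : Q Γ Δ s s' (.comp C)) :
    Q Γ Δ (.cinl s) (.cinl s') (.comp (.csum C D)) := by
  obtain ⟨_, _, a0, b0, q0⟩ := h0
  exact ⟨_, _, by simp [Tm.erase, a0], by simp [Tm.erase, b0],
    .cinl_cong q0⟩

theorem cinr {s s' : Tm} (h0 : Q Γ Δ s s' (.comp D)) :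
    Q Γ Δ (.cinr s) (.cinr s') (.comp (.csum C D)) := by
  obtain ⟨_, _, a0, b0, q0⟩ := h0
  exact ⟨_, _, by simp [Tm.erase, a0], by simp [Tm.erase, b0],
    .cinr_cong q0⟩

theorem ccase {s s' t t' u u' : Tm} (h0 : Q Γ Δ s s' (.comp (.csum C D))) (h1 : Q Γ (some C) t t' (.comp E)) (h2 : Q Γ (some D) u u' (.comp E)) :
    Q Γ Δ (.ccase s t u) (.ccase s' t' u') (.comp E) := by
  obtain ⟨_, _, a0, b0, q0⟩ := h0
  obtain ⟨_, _, a1, b1, q1⟩ := h1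
  obtain ⟨_, _, a2, b2, q2⟩ := h2
  exact ⟨_, _, by simp [Tm.erase, a0, a1, a2], by simp [Tm.erase, b0, b1, b2],
    .ccase_cong q0 q1 q2⟩

theorem lapp {s s' t t' : Tm} (h0 : Q Γ none s s' (.lin C D)) (h1 : Q Γ Δ t t' (.comp C)) :
    Q Γ Δ (.lapp s t) (.lapp s' t') (.comp D) := by
  obtain ⟨_, _, a0, b0, q0⟩ := h0
  obtain ⟨_, _, a1, b1, q1⟩ := h1
  exact ⟨_, _, by simp [Tm.erase, a0, a1], by simp [Tm.erase, b0, b1],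
    .lapp_cong q0 q1⟩

theorem vlam {s s' : Tm} {X Y : VType} (h0 : Q (A :: Γ) none s s' B) :
    Q Γ none (.vlam X s) (.vlam Y s') (.arr A B) := by
  obtain ⟨_, _, a0, b0, q0⟩ := h0
  exact ⟨_, _, by simp [Tm.erase, a0], by simp [Tm.erase, b0],
    .vlam_cong q0⟩

theorem clam {s s' : Tm} {X Y : VType} (h0 : Q (A :: Γ) Δ s s' (.comp C)) :
    Q Γ Δ (.clam X s) (.clam Y s') (.comp (.carr A C)) := by
  obtain ⟨_, _, a0, b0, q0⟩ := h0
  exact ⟨_, _, by simp [Tm.erase, a0], by simp [Tm.erase, b0],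
    .clam_cong q0⟩

theorem llam {s s' : Tm} {X Y : CType} (h0 : Q Γ (some C) s s' (.comp D)) :
    Q Γ none (.llam X s) (.llam Y s') (.lin C D) := by
  obtain ⟨_, _, a0, b0, q0⟩ := h0
  exact ⟨_, _, by simp [Tm.erase, a0], by simp [Tm.erase, b0],
    .llam_cong q0⟩

theorem cimage {s s' : Tm} {X Y : CType} (h0 : Q Γ Δ s s' (.comp .czero)) :
    Q Γ Δ (.cimage X s) (.cimage Y s') (.comp C) := by
  obtain ⟨_, _, a0, b0, q0⟩ := h0
  exact ⟨_, _, by simp [Tm.erase, a0], by simp [Tm.erase, b0],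
    .cimage_cong q0⟩

theorem unit_eta (h : Ty false Γ none t .unit) : Q Γ none t .unit .unit := by
  obtain ⟨s, e, ⟨d⟩⟩ := h.lift
  exact (EEq.unit_eta d).q.of_erase e rfl

theorem cunit_eta (h : Ty false Γ Δ t (.comp .cunit)) : Q Γ Δ t .cunit (.comp .cunit) := by
  obtain ⟨s, e, ⟨d⟩⟩ := h.lift
  exact (EEq.cunit_eta d).q.of_erase e rfl

theorem vpair_eta (h : Ty false Γ none t (.prod A B)) :
    Q Γ none (.vpair (.vfst t) (.vsnd t)) t (.prod A B) := by
  obtain ⟨s, e, ⟨d⟩⟩ := h.lift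
  exact (EEq.vpair_eta d).q.of_erase (by simp [Tm.erase, e]) e

theorem cpair_eta (h : Ty false Γ Δ t (.comp (.cand C D))) :
    Q Γ Δ (.cpair (.cfst t) (.csnd t)) t (.comp (.cand C D)) := by
  obtain ⟨s, e, ⟨d⟩⟩ := h.lift
  exact (EEq.cpair_eta d).q.of_erase (by simp [Tm.erase, e]) e

theorem vlam_eta (h : Ty false Γ none t (.arr A B)) (X : VType) :
    Q Γ none (.vlam X (.vapp (Tm.shift t) (.var 0))) t (.arr A B) := by
  obtain ⟨s, e, ⟨d⟩⟩ := h.lift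
  exact (EEq.vlam_eta d).q.of_erase (by simp [Tm.erase, Tm.erase_shift, e]) e

theorem clam_eta (h : Ty false Γ Δ t (.comp (.carr A C))) (X : VType) :
    Q Γ Δ (.clam X (.capp (Tm.shift t) (.var 0))) t (.comp (.carr A C)) := by
  obtain ⟨s, e, ⟨d⟩⟩ := h.lift
  exact (EEq.clam_eta d).q.of_erase (by simp [Tm.erase, Tm.erase_shift, e]) e

theorem llam_eta (h : Ty false Γ none t (.lin C D)) (X : CType) :
    Q Γ none (.llam X (.lapp t .svar)) t (.lin C D) := by
  obtain ⟨s, e, ⟨d⟩⟩ := h.lift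
  exact (EEq.llam_eta d).q.of_erase (by simp [Tm.erase, e]) e

theorem ilet_eta {e : Tm} (h : Ty false Γ Δ t (.comp .iunit))
    (he : Ty false Γ (some .iunit) e (.comp C)) :
    Q Γ Δ (.ilet t (Tm.ssubst .top e)) (Tm.ssubst t e) (.comp C) := by
  obtain ⟨s, a, ⟨d⟩⟩ := h.lift
  obtain ⟨s', a', ⟨d'⟩⟩ := he.lift
  exact (EEq.ilet_eta d d').q.of_erase (by simp [Tm.erase, Tm.erase_ssubst, a, a'])
    (by simp [Tm.erase_ssubst, a, a'])

theorem bang_eta {e : Tm} (h : Ty false Γ Δ t (.comp (.bang A)))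
    (he : Ty false Γ (some (.bang A)) e (.comp C)) :
    Q Γ Δ (.banglet t (Tm.ssubst (.bang (.var 0)) (Tm.shift e))) (Tm.ssubst t e) (.comp C) := by
  obtain ⟨s, a, ⟨d⟩⟩ := h.lift
  obtain ⟨s', a', ⟨d'⟩⟩ := he.lift
  exact (EEq.bang_eta d d').q.of_erase
    (by simp [Tm.erase, Tm.erase_ssubst, Tm.erase_shift, a, a'])
    (by simp [Tm.erase_ssubst, a, a'])

theorem copow_eta {e : Tm} (h : Ty false Γ Δ t (.comp (.copow A D)))
    (he : Ty false Γ (some (.copow A D)) e (.comp C)) :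
    Q Γ Δ (.copowlet t (Tm.ssubst (.copow (.var 0) .svar) (Tm.shift e))) (Tm.ssubst t e)
      (.comp C) := by
  obtain ⟨s, a, ⟨d⟩⟩ := h.lift
  obtain ⟨s', a', ⟨d'⟩⟩ := he.lift
  exact (EEq.copow_eta d d').q.of_erase
    (by simp [Tm.erase, Tm.erase_ssubst, Tm.erase_shift, a, a'])
    (by simp [Tm.erase_ssubst, a, a'])

theorem csum_eta {e : Tm} (h : Ty false Γ Δ t (.comp (.csum C D)))
    (he : Ty false Γ (some (.csum C D)) e (.comp E)) :
    Q Γ Δ (.ccase t (Tm.ssubst (.cinl .svar) e) (Tm.ssubst (.cinr .svar) e)) (Tm.ssubst t e)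
      (.comp E) := by
  obtain ⟨s, a, ⟨d⟩⟩ := h.lift
  obtain ⟨s', a', ⟨d'⟩⟩ := he.lift
  exact (EEq.csum_eta d d').q.of_erase (by simp [Tm.erase, Tm.erase_ssubst, a, a'])
    (by simp [Tm.erase_ssubst, a, a'])

theorem ilet_comm {e s : Tm} (he : Ty false Γ (some C) e (.comp D))
    (h : Ty false Γ Δ s (.comp .iunit)) (ht : Ty false Γ none t (.comp C)) :
    Q Γ Δ (Tm.ssubst (.ilet s t) e) (.ilet s (Tm.ssubst t e)) (.comp D) := by
  obtain ⟨e', a, ⟨d⟩⟩ := he.lift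
  obtain ⟨s', a', ⟨d'⟩⟩ := h.lift
  obtain ⟨t', a'', ⟨d''⟩⟩ := ht.lift
  exact (EEq.ilet_comm d.ty d'.ty d''.ty).q.of_erase
    (by simp [Tm.erase, Tm.erase_ssubst, a, a', a''])
    (by simp [Tm.erase, Tm.erase_ssubst, a, a', a''])

theorem copowlet_comm {e s : Tm} (he : Ty false Γ (some C) e (.comp D))
    (h : Ty false Γ Δ s (.comp (.copow A E))) (ht : Ty false (A :: Γ) (some E) t (.comp C)) :
    Q Γ Δ (Tm.ssubst (.copowlet s t) e) (.copowlet s (Tm.ssubst t (Tm.shift e))) (.comp D) := by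
  obtain ⟨e', a, ⟨d⟩⟩ := he.lift
  obtain ⟨s', a', ⟨d'⟩⟩ := h.lift
  obtain ⟨t', a'', ⟨d''⟩⟩ := ht.lift
  exact (EEq.copowlet_comm d.ty d'.ty d''.ty).q.of_erase
    (by simp [Tm.erase, Tm.erase_ssubst, a, a', a''])
    (by simp [Tm.erase, Tm.erase_ssubst, Tm.erase_shift, a, a', a''])

theorem cimage_comm {e s : Tm} {X Y : CType} (he : Ty false Γ (some C) e (.comp D))
    (h : Ty false Γ Δ s (.comp .czero)) :
    Q Γ Δ (Tm.ssubst (.cimage X s) e) (.cimage Y s) (.comp D) := by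
  obtain ⟨e', a, ⟨d⟩⟩ := he.lift
  obtain ⟨s', a', ⟨d'⟩⟩ := h.lift
  exact (EEq.cimage_comm d.ty d'.ty).q.of_erase
    (by simp [Tm.erase, Tm.erase_ssubst, a, a']) (by simp [Tm.erase, a'])

theorem ccase_comm {e s : Tm} {C' D' : CType} (he : Ty false Γ (some C) e (.comp D))
    (h : Ty false Γ Δ s (.comp (.csum C' D'))) (ht : Ty false Γ (some C') t (.comp C))
    (hu : Ty false Γ (some D') u (.comp C)) :
    Q Γ Δ (Tm.ssubst (.ccase s t u) e) (.ccase s (Tm.ssubst t e) (Tm.ssubst u e))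
      (.comp D) := by
  obtain ⟨e', a, ⟨d⟩⟩ := he.lift
  obtain ⟨s', a', ⟨d'⟩⟩ := h.lift
  obtain ⟨t', a'', ⟨d''⟩⟩ := ht.lift
  obtain ⟨u', b, ⟨f⟩⟩ := hu.lift
  exact (EEq.ccase_comm d.ty d'.ty d''.ty f.ty).q.of_erase
    (by simp [Tm.erase, Tm.erase_ssubst, a, a', a'', b])
    (by simp [Tm.erase, Tm.erase_ssubst, a, a', a'', b])

theorem full {Γ' : List VType} {Δ' : Option CType} {σ : ℕ → Tm} (h : Q Γ Δ t t' A)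
    (hσ : TySub false Γ Γ' σ) (hs : ∀ n, Tm.SFree (σ n)) (hu : TyStoup false Γ' Δ Δ' u) :
    Q Γ' Δ' (Tm.full σ u t) (Tm.full σ u t') A := by
  obtain ⟨x, y, a, b, q⟩ := h
  have H : ∀ n, ∃ s, Tm.erase s = Tm.erase (σ n) ∧ Tm.SFree s ∧
      ∀ X, Γ[n]? = some X → Ty true Γ' none s X := by
    intro n
    rcases hn : Γ[n]? with _ | X
    · exact ⟨_, rfl, hs n, nofun⟩
    · obtain ⟨s, e, ⟨d⟩⟩ := (hσ n X hn).lift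
      refine ⟨s, e, d.sfree, ?_⟩
      rintro _ ⟨⟩
      exact d.ty
  choose τ e1 e2 e3 using H
  obtain ⟨v, ev, hv⟩ : ∃ v, Tm.erase v = Tm.erase u ∧ TyStoup true Γ' Δ Δ' v := by
    rcases Δ with _ | X
    · exact ⟨_, rfl, hu⟩
    · obtain ⟨s, e, ⟨d⟩⟩ := Ty.lift hu
      exact ⟨s, e, d.ty⟩
  refine (q.full e2 e3 hv).q.of_erase ?_ ?_ <;> simp [Tm.erase_full, e1, ev, a, b]

theorem ssubst {e e' : Tm} (he : Q Γ (some C) e e' (.comp D)) (h : Q Γ Δ t t' (.comp C)) :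
    Q Γ Δ (Tm.ssubst t e) (Tm.ssubst t' e') (.comp D) := by
  have h1 : Q Γ Δ (Tm.ssubst t e) (Tm.ssubst t e') (.comp D) := by
    simp only [Tm.ssubst_eq_full]
    exact he.full .var .var h.left
  refine h1.trans ?_
  obtain ⟨x, a, ⟨d⟩⟩ := he.right.lift
  obtain ⟨y, z, b, c, q⟩ := h
  exact (EEq.ssubst_right d.ty q).q.of_erase (by simp [Tm.erase_ssubst, a, b])
    (by simp [Tm.erase_ssubst, a, c])

end Q

end EEC

namespace EEC

namespace Tm

/-- Abstract over the stoup variable when the source judgement has an empty stoup. -/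
def wrap : Bool → Tm → Tm
  | true, x => x
  | false, x => .llam .cunit x

/-- Apply the translation of a term to a continuation. -/
def plug : Bool → Tm → Tm → Tm
  | true, x, v => ssubst v x
  | false, x, v => .lapp x v

/-- The CPS translation of raw terms, up to type annotations; the flag records
whether the stoup is inhabited. -/
def cpsE : Bool → Tm → Tm
  | _, .var n => .var n
  | _, .svar => .svar
  | _, .unit => .unit
  | _, .vpair t u => .vpair (cpsE false t) (cpsE false u)
  | _, .vfst t => .vfst (cpsE false t)
  | _, .vsnd t => .vsnd (cpsE false t)
  | _, .vlam _ t => .vlam .unit (cpsE false t)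
  | _, .vapp s t => .vapp (cpsE false s) (cpsE false t)
  | b, .cunit => wrap b (.cimage .cunit .svar)
  | b, .cpair t u => wrap b (.ccase .svar (plug b (cpsE b t) .svar) (plug b (cpsE b u) .svar))
  | b, .cfst t => wrap b (plug b (cpsE b t) (.cinl .svar))
  | b, .csnd t => wrap b (plug b (cpsE b t) (.cinr .svar))
  | b, .clam _ t => wrap b (.copowlet .svar (plug b (cpsE b t) .svar))
  | b, .capp s t => wrap b (plug b (cpsE b s) (.copow (cpsE false t) .svar))
  | _, .top => .llam .cunit .svar
  | b, .ilet t u => wrap b (plug b (cpsE b t) (.lapp (cpsE false u) .svar))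
  | _, .bang t => .llam .cunit (.capp .svar (cpsE false t))
  | b, .banglet t u =>
      wrap b (plug b (cpsE b t) (.clam .unit (.lapp (cpsE false u) .svar)))
  | b, .copow t u => wrap b (plug b (cpsE b u) (.capp .svar (cpsE false t)))
  | b, .copowlet s t => wrap b (plug b (cpsE b s) (.clam .unit (cpsE true t)))
  | b, .cimage _ t => wrap b (plug b (cpsE b t) .cunit)
  | b, .cinl t => wrap b (plug b (cpsE b t) (.cfst .svar))
  | b, .cinr t => wrap b (plug b (cpsE b t) (.csnd .svar))
  | b, .ccase s t u => wrap b (plug b (cpsE b s) (.cpair (cpsE true t) (cpsE true u)))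
  | _, .llam _ t => .llam .cunit (cpsE true t)
  | b, .lapp s t => wrap b (plug b (cpsE b t) (.lapp (cpsE false s) .svar))

@[simp] theorem ssubst_svar (t : Tm) : ssubst .svar t = t := by
  rw [ssubst_eq_full, full_var_svar]

theorem erase_wrap (b : Bool) (x : Tm) : erase (wrap b x) = wrap b (erase x) := by
  cases b <;> rfl

theorem erase_plug (b : Bool) (x v : Tm) : erase (plug b x v) = plug b (erase x) (erase v) := by
  cases b
  · rfl
  · exact erase_ssubst ..

theorem erase_cpsE (b : Bool) (t : Tm) : erase (cpsE b t) = cpsE b t := by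
  induction t generalizing b <;>
    simp only [erase, cpsE, erase_wrap, erase_plug, *]

theorem cpsE_erase (b : Bool) (t : Tm) : cpsE b (erase t) = cpsE b t := by
  induction t generalizing b <;> simp only [erase, cpsE, *]

theorem rename_ssubst (f : ℕ → ℕ) (u t : Tm) :
    rename f (ssubst u t) = ssubst (rename f u) (rename f t) := by
  simp only [ssubst_eq_full, rename_full, full_rename, rename]

theorem rename_wrap (f : ℕ → ℕ) (b : Bool) (x : Tm) :
    rename f (wrap b x) = wrap b (rename f x) := by
  cases b <;> rfl

theorem rename_plug (f : ℕ → ℕ) (b : Bool) (x v : Tm) :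
    rename f (plug b x v) = plug b (rename f x) (rename f v) := by
  cases b
  · rfl
  · exact rename_ssubst ..

theorem cpsE_rename (f : ℕ → ℕ) (b : Bool) (t : Tm) :
    cpsE b (rename f t) = rename f (cpsE b t) := by
  induction t generalizing b f <;>
    simp only [rename, cpsE, rename_wrap, rename_plug, *]

theorem cpsE_shift (b : Bool) (t : Tm) : cpsE b (shift t) = shift (cpsE b t) := cpsE_rename ..

end Tm

theorem erase_cps (R : CType) {Γ Δ t A} (d : Deriv Γ Δ t A) :
    Tm.erase (cps R d) = Tm.cpsE Δ.isSome t := by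
  induction d with
  | cunit Γ Δ | cpair Γ Δ | cfst Γ Δ | csnd Γ Δ | clam Γ Δ | capp Γ Δ | ilet Γ Δ | banglet Γ Δ | copow Γ Δ | copowlet Γ Δ | cimage Γ Δ | cinl Γ Δ | cinr Γ Δ | ccase Γ Δ | lapp Γ Δ =>
    cases Δ <;> simp_all [cps, Tm.cpsE, Tm.erase, Tm.wrap, Tm.plug, Tm.erase_ssubst]
  | _ => simp_all [cps, Tm.cpsE, Tm.erase]

/-- The typing of the CPS translation of a judgement. -/
def CpsTy (b : Bool) (R : CType) (Γ : List VType) : Option CType → Tm → VType → Prop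
  | none, x, A => Ty b (cpsCtx R Γ) none x (cpsV R A)
  | some D, x, .comp B => Ty b (cpsCtx R Γ) (some (cpsC R B)) x (.comp (cpsC R D))
  | some _, _, _ => False

end EEC

namespace EEC

theorem Deriv.cps_ty (R : CType) {Γ Δ t A} (d : Deriv Γ Δ t A) :
    CpsTy true R Γ Δ (cps R d) A := by
  induction d with
  | var Γ n A h => exact .var (by simp [cpsCtx, h])
  | svar => exact .svar
  | unit => exact .unit
  | vpair _ _ _ _ _ _ _ ih ih' => exact .vpair ih ih'
  | vfst _ _ _ _ _ ih => exact .vfst ih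
  | vsnd _ _ _ _ _ ih => exact .vsnd ih
  | vlam _ _ _ _ _ ih => exact .vlam (fun _ => rfl) ih
  | vapp _ _ _ _ _ _ _ ih ih' => exact .vapp ih ih'
  | top => exact .llam (fun _ => rfl) .svar
  | bang _ _ _ _ ih => exact .llam (fun _ => rfl) (.capp .svar ih)
  | llam _ _ _ _ _ ih => exact .llam (fun _ => rfl) ih
  | cunit Γ Δ =>
    cases Δ
    · exact .llam (fun _ => rfl) (.cimage (fun _ => rfl) .svar)
    · exact .cimage (fun _ => rfl) .svar
  | cpair Γ Δ _ _ _ _ _ _ ih ih' =>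
    cases Δ
    · exact .llam (fun _ => rfl) (.ccase .svar (.lapp ih .svar) (.lapp ih' .svar))
    · exact .ccase .svar ih ih'
  | cfst Γ Δ _ _ _ _ ih =>
    cases Δ
    · exact .llam (fun _ => rfl) (.lapp ih (.cinl .svar))
    · exact ih.ssubst (.cinl .svar)
  | csnd Γ Δ _ _ _ _ ih =>
    cases Δ
    · exact .llam (fun _ => rfl) (.lapp ih (.cinr .svar))
    · exact ih.ssubst (.cinr .svar)
  | clam Γ Δ _ _ _ _ ih =>
    cases Δ
    · exact .llam (fun _ => rfl) (.copowlet .svar (.lapp ih .svar))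
    · exact .copowlet .svar ih
  | capp Γ Δ _ _ _ _ _ _ ih ih' =>
    cases Δ
    · exact .llam (fun _ => rfl) (.lapp ih (.copow ih' .svar))
    · exact ih.ssubst (.copow ih' .svar)
  | ilet Γ Δ _ _ _ _ _ ih ih' =>
    cases Δ
    · exact .llam (fun _ => rfl) (.lapp ih (.lapp ih' .svar))
    · exact ih.ssubst (.lapp ih' .svar)
  | banglet Γ Δ _ _ _ _ _ _ ih ih' =>
    cases Δ
    · exact .llam (fun _ => rfl) (.lapp ih (.clam (fun _ => rfl) (.lapp ih' .svar)))
    · exact ih.ssubst (.clam (fun _ => rfl) (.lapp ih' .svar))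
  | copow Γ Δ _ _ _ _ _ _ ih ih' =>
    cases Δ
    · exact .llam (fun _ => rfl) (.lapp ih' (.capp .svar ih))
    · exact ih'.ssubst (.capp .svar ih)
  | copowlet Γ Δ _ _ _ _ _ _ _ ih ih' =>
    cases Δ
    · exact .llam (fun _ => rfl) (.lapp ih (.clam (fun _ => rfl) ih'))
    · exact ih.ssubst (.clam (fun _ => rfl) ih')
  | cimage Γ Δ _ _ _ ih =>
    cases Δ
    · exact .llam (fun _ => rfl) (.lapp ih .cunit)
    · exact ih.ssubst .cunit
  | cinl Γ Δ _ _ _ _ ih =>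
    cases Δ
    · exact .llam (fun _ => rfl) (.lapp ih (.cfst .svar))
    · exact ih.ssubst (.cfst .svar)
  | cinr Γ Δ _ _ _ _ ih =>
    cases Δ
    · exact .llam (fun _ => rfl) (.lapp ih (.csnd .svar))
    · exact ih.ssubst (.csnd .svar)
  | ccase Γ Δ _ _ _ _ _ _ _ _ _ ih ih' ih'' =>
    cases Δ
    · exact .llam (fun _ => rfl) (.lapp ih (.cpair ih' ih''))
    · exact ih.ssubst (.cpair ih' ih'')
  | lapp Γ Δ _ _ _ _ _ _ ih ih' =>
    cases Δ
    · exact .llam (fun _ => rfl) (.lapp ih' (.lapp ih .svar))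
    · exact ih'.ssubst (.lapp ih .svar)

end EEC

namespace EEC

theorem CpsTy.of_erase_eq {b : Bool} {R : CType} {Γ Δ x y A} (h : CpsTy b R Γ Δ x A)
    (e : Tm.erase y = Tm.erase x) : CpsTy false R Γ Δ y A := by
  match Δ, A, h with
  | none, _, h => exact Ty.of_erase_eq h e
  | some _, .comp _, h => exact Ty.of_erase_eq h e

theorem Ty.cpsTy {b : Bool} (R : CType) {Γ Δ t A} (h : Ty b Γ Δ t A) :
    CpsTy false R Γ Δ (Tm.cpsE Δ.isSome t) A := by
  obtain ⟨s, e, ⟨d⟩⟩ := h.lift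
  refine (d.cps_ty R).of_erase_eq ?_
  rw [erase_cps, Tm.erase_cpsE, ← Tm.cpsE_erase, ← e, Tm.cpsE_erase]

theorem Ty.cpsV {b : Bool} (R : CType) {Γ t A} (h : Ty b Γ none t A) :
    Ty false (cpsCtx R Γ) none (Tm.cpsE false t) (cpsV R A) := h.cpsTy R

theorem Ty.cpsC {b : Bool} (R : CType) {Γ D t B} (h : Ty b Γ (some D) t (.comp B)) :
    Ty false (cpsCtx R Γ) (some (cpsC R B)) (Tm.cpsE true t) (.comp (cpsC R D)) := h.cpsTy R

namespace Tm

theorem ssubst_ssubst (u v t : Tm) : ssubst u (ssubst v t) = ssubst (ssubst u v) t := by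
  simp only [ssubst_eq_full]
  exact full_full SFree.var _ _ _ _

theorem SFree.ssubst_self {t : Tm} (h : SFree t) (u : Tm) : ssubst u t = t := by
  rw [ssubst_eq_full, h.full_eq]

end Tm

/-- The translation of stoup terms turns composition into composition in the opposite order. -/
theorem Ty.cpsE_ssubst (R : CType) {Γ Δ s A} (hs : Ty false Γ Δ s A) {B D X u}
    (eΔ : Δ = some B) (eA : A = .comp X) (hu : Ty false Γ (some D) u (.comp B)) :
    Q (cpsCtx R Γ) (some (EEC.cpsC R X)) (Tm.cpsE true (Tm.ssubst u s))
      (Tm.ssubst (Tm.cpsE true s) (Tm.cpsE true u)) (.comp (EEC.cpsC R D)) := by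
  have plug : ∀ {Γ D B Y Z : _} {u t v : Tm}, Ty false Γ (some D) u (.comp B) →
      Q (cpsCtx R Γ) (some (EEC.cpsC R Y)) (Tm.cpsE true (Tm.ssubst u t))
        (Tm.ssubst (Tm.cpsE true t) (Tm.cpsE true u)) (.comp (EEC.cpsC R D)) →
      Ty false (cpsCtx R Γ) (some Z) v (.comp (EEC.cpsC R Y)) →
      Q (cpsCtx R Γ) (some Z) (Tm.ssubst v (Tm.cpsE true (Tm.ssubst u t)))
        (Tm.ssubst (Tm.ssubst v (Tm.cpsE true t)) (Tm.cpsE true u)) (.comp (EEC.cpsC R D)) := by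
    intro Γ D B Y Z u t v hu q hv
    rw [← Tm.ssubst_ssubst]
    exact q.ssubst (.refl hv)
  induction hs generalizing B D X u with
  | var | unit | vpair | vfst | vsnd | vlam | vapp | top | bang | llam => cases eΔ
  | svar =>
    cases eΔ; cases eA
    simpa [Tm.ssubst, Tm.cpsE] using Q.refl (hu.cpsC R)
  | cunit => 
    cases eΔ; cases eA
    exact (Q.cimage_comm (hu.cpsC R) .svar).symm
  | cpair ht hu' ih ih' =>
    cases eΔ; cases eA
    simp only [Tm.ssubst, Tm.cpsE, Tm.wrap, Tm.plug, Tm.ssubst_svar]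
    exact (Q.ccase (.refl .svar) (ih rfl rfl hu) (ih' rfl rfl hu)).trans
      (Q.ccase_comm (hu.cpsC R) .svar (ht.cpsC R) (hu'.cpsC R)).symm
  | clam _ ht ih =>
    cases eΔ; cases eA
    simp only [Tm.ssubst, Tm.cpsE, Tm.wrap, Tm.plug, Tm.ssubst_svar]
    have := ih rfl rfl (hu.shift _)
    rw [Tm.cpsE_shift] at this
    exact (Q.copowlet (.refl .svar) this).trans
      (Q.copowlet_comm (hu.cpsC R) .svar (ht.cpsC R)).symm
  | cfst ht ih =>
    cases eΔ; cases eA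
    exact plug hu (ih rfl rfl hu) (.cinl .svar)
  | csnd ht ih =>
    cases eΔ; cases eA
    exact plug hu (ih rfl rfl hu) (.cinr .svar)
  | cinl ht ih =>
    cases eΔ; cases eA
    exact plug hu (ih rfl rfl hu) (.cfst .svar)
  | cinr ht ih =>
    cases eΔ; cases eA
    exact plug hu (ih rfl rfl hu) (.csnd .svar)
  | cimage _ ht ih =>
    cases eΔ; cases eA
    exact plug hu (ih rfl rfl hu) .cunit
  | capp ht hv ih =>
    cases eΔ; cases eA
    rw [Tm.ssubst, hv.sfree.ssubst_self]
    exact plug hu (ih rfl rfl hu) (.copow (hv.cpsV R) .svar)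
  | ilet ht hv ih =>
    cases eΔ; cases eA
    rw [Tm.ssubst, hv.sfree.ssubst_self]
    exact plug hu (ih rfl rfl hu) (.lapp (hv.cpsV R) .svar)
  | banglet ht hv ih =>
    cases eΔ; cases eA
    rw [Tm.ssubst, hv.sfree.ssubst_self]
    exact plug hu (ih rfl rfl hu) (.clam nofun (.lapp (hv.cpsV R) .svar))
  | copow hv ht _ ih =>
    cases eΔ; cases eA
    rw [Tm.ssubst, hv.sfree.ssubst_self]
    exact plug hu (ih rfl rfl hu) (.capp .svar (hv.cpsV R))
  | copowlet ht hv ih =>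
    cases eΔ; cases eA
    exact plug hu (ih rfl rfl hu) (.clam nofun (hv.cpsC R))
  | ccase ht hv hw ih =>
    cases eΔ; cases eA
    exact plug hu (ih rfl rfl hu) (.cpair (hv.cpsC R) (hw.cpsC R))
  | lapp hv ht _ ih =>
    cases eΔ; cases eA
    rw [Tm.ssubst, hv.sfree.ssubst_self]
    exact plug hu (ih rfl rfl hu) (.lapp (hv.cpsV R) .svar)

end EEC

namespace EEC

/-- The double CPS translation of a term of computation type, as a term with inhabited stoup. -/
def Tm.dcps (b : Bool) (t : Tm) : Tm := cpsE true (plug b (cpsE b t) .svar)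

/-- The translation of a stoup, the empty one being sent to the result type. -/
def cpsStoup (R : CType) : Option CType → CType
  | none => R
  | some D => cpsC R D

theorem Tm.dcps_false (t : Tm) : dcps false t = .lapp (cpsE false (cpsE false t)) .svar := rfl

theorem Tm.dcps_true (t : Tm) : dcps true t = cpsE true (cpsE true t) := by
  simp [dcps, plug]

section

variable {R : CType} {Γ : List VType} {Δ : Option CType} {s t u v : Tm} {A B C : CType} {X : VType}

theorem Ty.plug (h : Ty false Γ Δ t (.comp B)) (hv : Ty false (cpsCtx R Γ) (some A) v
    (.comp (EEC.cpsC R B))) :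
    Ty false (cpsCtx R Γ) (some A) (Tm.plug Δ.isSome (Tm.cpsE Δ.isSome t) v)
      (.comp (cpsStoup R Δ)) := by
  cases Δ with
  | none => exact .lapp (h.cpsV R) hv
  | some D => exact (h.cpsC R).ssubst hv

theorem Ty.dcps (h : Ty false Γ Δ t (.comp B)) :
    Ty false (cpsCtx R (cpsCtx R Γ)) (some (EEC.cpsC R (cpsStoup R Δ)))
      (Tm.dcps Δ.isSome t) (.comp (EEC.cpsC R (EEC.cpsC R B))) :=
  (h.plug .svar).cpsC R

namespace Q

theorem dcps_wrap {x : Tm} (h : Tm.cpsE Δ.isSome t = Tm.wrap Δ.isSome x)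
    (hx : Ty false (cpsCtx R Γ) (some (EEC.cpsC R B)) x (.comp (cpsStoup R Δ))) :
    Q (cpsCtx R (cpsCtx R Γ)) (some (EEC.cpsC R (cpsStoup R Δ))) (Tm.dcps Δ.isSome t)
      (Tm.cpsE true x) (.comp (EEC.cpsC R (EEC.cpsC R B))) := by
  have hE := hx.cpsC R
  cases Δ with
  | none =>
    simp only [Option.isSome_none] at h ⊢
    rw [Tm.dcps_false, h]
    have := Q.of_red (.llam_beta .cunit (Tm.cpsE true x) .svar) (.lapp (.llam nofun hE) .svar)
    rwa [Tm.ssubst_svar] at this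
  | some D =>
    simp only [Option.isSome_some] at h ⊢
    rw [Tm.dcps_true, h]
    exact .refl hE

theorem dcps_plug {T : Tm}
    (e : Tm.cpsE Δ.isSome T = Tm.wrap Δ.isSome (Tm.plug Δ.isSome (Tm.cpsE Δ.isSome t) v))
    (h : Ty false Γ Δ t (.comp B))
    (hv : Ty false (cpsCtx R Γ) (some (EEC.cpsC R A)) v (.comp (EEC.cpsC R B))) :
    Q (cpsCtx R (cpsCtx R Γ)) (some (EEC.cpsC R (cpsStoup R Δ))) (Tm.dcps Δ.isSome T)
      (Tm.ssubst (Tm.dcps Δ.isSome t) (Tm.cpsE true v)) (.comp (EEC.cpsC R (EEC.cpsC R A))) := by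
  refine (dcps_wrap e (h.plug hv)).trans ?_
  have : Tm.plug Δ.isSome (Tm.cpsE Δ.isSome t) v =
      Tm.ssubst v (Tm.plug Δ.isSome (Tm.cpsE Δ.isSome t) .svar) := by
    cases Δ with
    | none => simp [Tm.plug, Tm.ssubst, (h.cpsV R).sfree.ssubst_self]
    | some D => simp [Tm.plug]
  rw [this]
  exact (h.plug .svar).cpsE_ssubst R rfl rfl hv

theorem dcps_cfst (h : Ty false Γ Δ t (.comp (.cand A B))) :
    Q (cpsCtx R (cpsCtx R Γ)) (some (EEC.cpsC R (cpsStoup R Δ))) (Tm.dcps Δ.isSome (.cfst t))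
      (.cfst (Tm.dcps Δ.isSome t)) (.comp (EEC.cpsC R (EEC.cpsC R A))) := by
  have := dcps_plug (R := R) (A := A) (T := .cfst t) rfl h (.cinl .svar)
  simpa [Tm.cpsE, Tm.wrap, Tm.plug, Tm.ssubst] using this

theorem dcps_csnd (h : Ty false Γ Δ t (.comp (.cand A B))) :
    Q (cpsCtx R (cpsCtx R Γ)) (some (EEC.cpsC R (cpsStoup R Δ))) (Tm.dcps Δ.isSome (.csnd t))
      (.csnd (Tm.dcps Δ.isSome t)) (.comp (EEC.cpsC R (EEC.cpsC R B))) := by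
  have := dcps_plug (R := R) (A := B) (T := .csnd t) rfl h (.cinr .svar)
  simpa [Tm.cpsE, Tm.wrap, Tm.plug, Tm.ssubst] using this

theorem dcps_cinl (h : Ty false Γ Δ t (.comp A)) :
    Q (cpsCtx R (cpsCtx R Γ)) (some (EEC.cpsC R (cpsStoup R Δ))) (Tm.dcps Δ.isSome (.cinl t))
      (.cinl (Tm.dcps Δ.isSome t)) (.comp (EEC.cpsC R (EEC.cpsC R (.csum A B)))) := by
  have := dcps_plug (R := R) (A := (.csum A B)) (T := .cinl t) rfl h (.cfst .svar)
  simpa [Tm.cpsE, Tm.wrap, Tm.plug, Tm.ssubst] using this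

theorem dcps_cinr (h : Ty false Γ Δ t (.comp B)) :
    Q (cpsCtx R (cpsCtx R Γ)) (some (EEC.cpsC R (cpsStoup R Δ))) (Tm.dcps Δ.isSome (.cinr t))
      (.cinr (Tm.dcps Δ.isSome t)) (.comp (EEC.cpsC R (EEC.cpsC R (.csum A B)))) := by
  have := dcps_plug (R := R) (A := (.csum A B)) (T := .cinr t) rfl h (.csnd .svar)
  simpa [Tm.cpsE, Tm.wrap, Tm.plug, Tm.ssubst] using this

theorem dcps_cimage (Y : CType) (h : Ty false Γ Δ t (.comp .czero)) :
    Q (cpsCtx R (cpsCtx R Γ)) (some (EEC.cpsC R (cpsStoup R Δ))) (Tm.dcps Δ.isSome (.cimage Y t))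
      (.cimage .cunit (Tm.dcps Δ.isSome t)) (.comp (EEC.cpsC R (EEC.cpsC R A))) := by
  have := dcps_plug (R := R) (A := A) (T := .cimage Y t) rfl h .cunit
  simpa [Tm.cpsE, Tm.wrap, Tm.plug, Tm.ssubst] using this

theorem dcps_capp (h : Ty false Γ Δ s (.comp (.carr X B))) (h' : Ty false Γ none t X) :
    Q (cpsCtx R (cpsCtx R Γ)) (some (EEC.cpsC R (cpsStoup R Δ))) (Tm.dcps Δ.isSome (.capp s t))
      (.capp (Tm.dcps Δ.isSome s) (Tm.cpsE false (Tm.cpsE false t))) (.comp (EEC.cpsC R (EEC.cpsC R B))) := by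
  have := dcps_plug (R := R) (A := B) (T := .capp s t) rfl h (.copow (h'.cpsV R) .svar)
  simpa [Tm.cpsE, Tm.wrap, Tm.plug, Tm.ssubst, ((h'.cpsV R).cpsV R).sfree.ssubst_self] using this

theorem dcps_ilet (h : Ty false Γ Δ t (.comp .iunit)) (h' : Ty false Γ none u (.comp A)) :
    Q (cpsCtx R (cpsCtx R Γ)) (some (EEC.cpsC R (cpsStoup R Δ))) (Tm.dcps Δ.isSome (.ilet t u))
      (.lapp (Tm.cpsE false (Tm.cpsE false u)) (Tm.dcps Δ.isSome t)) (.comp (EEC.cpsC R (EEC.cpsC R A))) := by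
  have := dcps_plug (R := R) (A := A) (T := .ilet t u) rfl h (.lapp (h'.cpsV R) .svar)
  simpa [Tm.cpsE, Tm.wrap, Tm.plug, Tm.ssubst, ((h'.cpsV R).cpsV R).sfree.ssubst_self] using this

theorem dcps_lapp (h' : Ty false Γ none s (.lin A B)) (h : Ty false Γ Δ t (.comp A)) :
    Q (cpsCtx R (cpsCtx R Γ)) (some (EEC.cpsC R (cpsStoup R Δ))) (Tm.dcps Δ.isSome (.lapp s t))
      (.lapp (Tm.cpsE false (Tm.cpsE false s)) (Tm.dcps Δ.isSome t)) (.comp (EEC.cpsC R (EEC.cpsC R B))) := by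
  have := dcps_plug (R := R) (A := B) (T := .lapp s t) rfl h (.lapp (h'.cpsV R) .svar)
  simpa [Tm.cpsE, Tm.wrap, Tm.plug, Tm.ssubst, ((h'.cpsV R).cpsV R).sfree.ssubst_self] using this

theorem dcps_copow (h' : Ty false Γ none t X) (h : Ty false Γ Δ u (.comp B)) :
    Q (cpsCtx R (cpsCtx R Γ)) (some (EEC.cpsC R (cpsStoup R Δ))) (Tm.dcps Δ.isSome (.copow t u))
      (.copow (Tm.cpsE false (Tm.cpsE false t)) (Tm.dcps Δ.isSome u)) (.comp (EEC.cpsC R (EEC.cpsC R (.copow X B)))) := by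
  have := dcps_plug (R := R) (A := (.copow X B)) (T := .copow t u) rfl h (.capp .svar (h'.cpsV R))
  simpa [Tm.cpsE, Tm.wrap, Tm.plug, Tm.ssubst, ((h'.cpsV R).cpsV R).sfree.ssubst_self] using this

theorem dcps_banglet (h : Ty false Γ Δ t (.comp (.bang X))) (h' : Ty false (X :: Γ) none u (.comp B)) :
    Q (cpsCtx R (cpsCtx R Γ)) (some (EEC.cpsC R (cpsStoup R Δ))) (Tm.dcps Δ.isSome (.banglet t u))
      (.copowlet (Tm.dcps Δ.isSome t) (.lapp (Tm.cpsE false (Tm.cpsE false u)) .svar)) (.comp (EEC.cpsC R (EEC.cpsC R B))) := by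
  have := dcps_plug (R := R) (A := B) (T := .banglet t u) rfl h (.clam nofun (.lapp (h'.cpsV R) .svar))
  simpa [Tm.cpsE, Tm.wrap, Tm.plug, Tm.ssubst] using this

theorem dcps_copowlet (h : Ty false Γ Δ s (.comp (.copow X B))) (h' : Ty false (X :: Γ) (some B) t (.comp C)) :
    Q (cpsCtx R (cpsCtx R Γ)) (some (EEC.cpsC R (cpsStoup R Δ))) (Tm.dcps Δ.isSome (.copowlet s t))
      (.copowlet (Tm.dcps Δ.isSome s) (Tm.cpsE true (Tm.cpsE true t))) (.comp (EEC.cpsC R (EEC.cpsC R C))) := by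
  have := dcps_plug (R := R) (A := C) (T := .copowlet s t) rfl h (.clam nofun (h'.cpsC R))
  simpa [Tm.cpsE, Tm.wrap, Tm.plug, Tm.ssubst] using this

theorem dcps_ccase (h : Ty false Γ Δ s (.comp (.csum A B))) (ht : Ty false Γ (some A) t (.comp C))
    (hu : Ty false Γ (some B) u (.comp C)) :
    Q (cpsCtx R (cpsCtx R Γ)) (some (EEC.cpsC R (cpsStoup R Δ))) (Tm.dcps Δ.isSome (.ccase s t u))
      (.ccase (Tm.dcps Δ.isSome s) (Tm.cpsE true (Tm.cpsE true t)) (Tm.cpsE true (Tm.cpsE true u))) (.comp (EEC.cpsC R (EEC.cpsC R C))) := by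
  have := dcps_plug (R := R) (A := C) (T := .ccase s t u) rfl h (.cpair (ht.cpsC R) (hu.cpsC R))
  simpa [Tm.cpsE, Tm.wrap, Tm.plug, Tm.ssubst] using this

theorem dcps_cpair (h : Ty false Γ Δ t (.comp A)) (h' : Ty false Γ Δ u (.comp B)) :
    Q (cpsCtx R (cpsCtx R Γ)) (some (EEC.cpsC R (cpsStoup R Δ))) (Tm.dcps Δ.isSome (.cpair t u))
      (.cpair (Tm.dcps Δ.isSome t) (Tm.dcps Δ.isSome u)) (.comp (EEC.cpsC R (EEC.cpsC R (.cand A B)))) := by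
  have := dcps_wrap (R := R) (Γ := Γ) (B := (.cand A B)) (t := .cpair t u) rfl (.ccase .svar (h.plug .svar) (h'.plug .svar))
  simpa [Tm.cpsE, Tm.wrap, Tm.plug, Tm.ssubst, Tm.dcps] using this

theorem dcps_clam (Y : VType) (h : Ty false (X :: Γ) Δ t (.comp B)) :
    Q (cpsCtx R (cpsCtx R Γ)) (some (EEC.cpsC R (cpsStoup R Δ))) (Tm.dcps Δ.isSome (.clam Y t))
      (.clam .unit (Tm.dcps Δ.isSome t)) (.comp (EEC.cpsC R (EEC.cpsC R (.carr X B)))) := by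
  have := dcps_wrap (R := R) (Γ := Γ) (B := (.carr X B)) (t := .clam Y t) rfl (.copowlet .svar (h.plug .svar))
  simpa [Tm.cpsE, Tm.wrap, Tm.plug, Tm.ssubst, Tm.dcps] using this

theorem dcps_top  :
    Q (cpsCtx R (cpsCtx R Γ)) (some (EEC.cpsC R (R))) (Tm.dcps false (.top))
      (.svar) (.comp (EEC.cpsC R (EEC.cpsC R .iunit))) := by
  have := dcps_wrap (Δ := none) (R := R) (Γ := Γ) (B := .iunit) (t := .top) rfl .svar
  simpa [Tm.cpsE, Tm.wrap, Tm.plug, Tm.ssubst, cpsStoup] using this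

theorem dcps_bang (h : Ty false Γ none t X) :
    Q (cpsCtx R (cpsCtx R Γ)) (some (EEC.cpsC R (R))) (Tm.dcps false (.bang t))
      (.copow (Tm.cpsE false (Tm.cpsE false t)) .svar) (.comp (EEC.cpsC R (EEC.cpsC R (.bang X)))) := by
  have := dcps_wrap (Δ := none) (R := R) (Γ := Γ) (B := (.bang X)) (t := .bang t) rfl (.capp .svar (h.cpsV R))
  simpa [Tm.cpsE, Tm.wrap, Tm.plug, Tm.ssubst, cpsStoup] using this

end Q

end

end EEC

namespace EEC

namespace Tm

/-- Terms invariant under all substitutions. -/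
def Closed (t : Tm) : Prop := ∀ σ u, full σ u t = t

namespace Closed

theorem ssubst {t : Tm} (h : Closed t) (u : Tm) : Tm.ssubst u t = t := by
  rw [ssubst_eq_full, h]

theorem rename {t : Tm} (h : Closed t) (f : ℕ → ℕ) : Tm.rename f t = t := by
  rw [rename_eq_full, h]

end Closed

end Tm

/-- `g` is a left inverse of the closed linear map `f`. -/
structure RetC (A A' : CType) (f g : Tm) : Prop where
  ty : ∀ Γ, Ty false Γ none f (.lin A A')
  ty' : ∀ Γ, Ty false Γ none g (.lin A' A)
  closed : f.Closed
  closed' : g.Closed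
  inv : ∀ {Γ Δ x}, Ty false Γ Δ x (.comp A) → Q Γ Δ (.lapp g (.lapp f x)) x (.comp A)

/-- `g` is a left inverse of the closed function `f`. -/
structure RetV (A A' : VType) (f g : Tm) : Prop where
  ty : ∀ Γ, Ty false Γ none f (.arr A A')
  ty' : ∀ Γ, Ty false Γ none g (.arr A' A)
  closed : f.Closed
  closed' : g.Closed
  inv : ∀ {Γ x}, Ty false Γ none x A → Q Γ none (.vapp g (.vapp f x)) x A

namespace RetC

variable {A A' B B' X Y : CType} {V V' W W' : VType} {f g f' g' : Tm}

theorem id : RetC A A (.llam X .svar) (.llam Y .svar) where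
  ty _ := .llam nofun .svar
  ty' _ := .llam nofun .svar
  closed _ _ := rfl
  closed' _ _ := rfl
  inv hx := .of_red ((Red.llam_beta _ _ _).trans (Red.llam_beta _ _ _))
    (.lapp (.llam nofun .svar) (.lapp (.llam nofun .svar) hx))

theorem cunit : RetC .cunit .cunit (.llam X .cunit) (.llam Y .cunit) where
  ty _ := .llam nofun .cunit
  ty' _ := .llam nofun .cunit
  closed _ _ := rfl
  closed' _ _ := rfl
  inv hx := (Q.cunit_eta (.lapp (.llam nofun .cunit) (.lapp (.llam nofun .cunit) hx))).trans
    (Q.cunit_eta hx).symm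

theorem cand_beta (X : CType) (hf : f.Closed) (hf' : f'.Closed) (x : Tm) :
    Red (.lapp (.llam X (.cpair (.lapp f (.cfst .svar)) (.lapp f' (.csnd .svar)))) x)
      (.cpair (.lapp f (.cfst x)) (.lapp f' (.csnd x))) := by
  simpa [Tm.ssubst, hf.ssubst, hf'.ssubst] using
    Red.llam_beta X (.cpair (.lapp f (.cfst .svar)) (.lapp f' (.csnd .svar))) x

theorem carr_beta (X : CType) (W : VType) (hf : f.Closed) (hg : g.Closed) (x : Tm) :
    Red (.lapp (.llam X (.clam W (.lapp f (.capp .svar (.vapp g (.var 0)))))) x)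
      (.clam W (.lapp f (.capp (Tm.shift x) (.vapp g (.var 0))))) := by
  simpa [Tm.ssubst, hf.ssubst, hg.ssubst] using
    Red.llam_beta X (.clam W (.lapp f (.capp .svar (.vapp g (.var 0))))) x

theorem capp_carr_beta (W : VType) (hf : f.Closed) (hg : g.Closed) (x a : Tm) :
    Red (.capp (.clam W (.lapp f (.capp (Tm.shift x) (.vapp g (.var 0))))) a)
      (.lapp f (.capp x (.vapp g a))) := by
  have := Red.clam_beta W (.lapp f (.capp (Tm.shift x) (.vapp g (.var 0)))) a
  simpa [Tm.subst0_eq_full, Tm.full, hf _ _, hg _ _] using this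

theorem copow_beta (X : CType) (hf : f.Closed) (hf' : f'.Closed) (x : Tm) :
    Red (.lapp (.llam X (.copowlet .svar (.copow (.vapp f (.var 0)) (.lapp f' .svar)))) x)
      (.copowlet x (.copow (.vapp f (.var 0)) (.lapp f' .svar))) :=
  Red.llam_beta ..

theorem csum_beta (X : CType) (x : Tm) :
    Red (.lapp (.llam X (.ccase .svar (.cinl (.lapp f .svar)) (.cinr (.lapp f' .svar)))) x)
      (.ccase x (.cinl (.lapp f .svar)) (.cinr (.lapp f' .svar))) :=
  Red.llam_beta ..

theorem bang_beta (X : CType) (x : Tm) :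
    Red (.lapp (.llam X (.copowlet .svar (.ilet .svar (.bang (.vapp f (.var 0)))))) x)
      (.copowlet x (.ilet .svar (.bang (.vapp f (.var 0))))) :=
  Red.llam_beta ..

theorem bang_beta' (X : CType) (hg : g.Closed) (x : Tm) :
    Red (.lapp (.llam X (.banglet .svar (.copow (.vapp g (.var 0)) .top))) x)
      (.banglet x (.copow (.vapp g (.var 0)) .top)) := by
  simpa [Tm.ssubst, hg.ssubst] using
    Red.llam_beta X (.banglet .svar (.copow (.vapp g (.var 0)) .top)) x

theorem cand (h : RetC A A' f g) (h' : RetC B B' f' g') :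
    RetC (.cand A B) (.cand A' B')
      (.llam X (.cpair (.lapp f (.cfst .svar)) (.lapp f' (.csnd .svar))))
      (.llam Y (.cpair (.lapp g (.cfst .svar)) (.lapp g' (.csnd .svar)))) := by
  have ty : ∀ {A A' B B' X f f'}, (∀ Γ, Ty false Γ none f (.lin A A')) →
      (∀ Γ, Ty false Γ none f' (.lin B B')) → ∀ Γ, Ty false Γ none
        (.llam X (.cpair (.lapp f (.cfst .svar)) (.lapp f' (.csnd .svar))))
        (.lin (.cand A B) (.cand A' B')) := fun hf hf' Γ =>
    .llam nofun (.cpair (.lapp (hf Γ) (.cfst .svar)) (.lapp (hf' Γ) (.csnd .svar)))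
  refine ⟨ty h.ty h'.ty, ty h.ty' h'.ty', ?_, ?_, ?_⟩
  · intro σ u; simp [Tm.full, h.closed _ _, h'.closed _ _]
  · intro σ u; simp [Tm.full, h.closed' _ _, h'.closed' _ _]
  · intro Γ Δ x hx
    refine (Q.of_red ?_ (.lapp (ty h.ty' h'.ty' Γ) (.lapp (ty h.ty h'.ty Γ) hx))).trans
      ((Q.cpair (h.inv (.cfst hx)) (h'.inv (.csnd hx))).trans (.cpair_eta hx))
    refine (cand_beta Y h.closed' h'.closed' _).trans (.cpair (.lapp (.refl _) ?_)
      (.lapp (.refl _) ?_))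
    · exact (Red.cfst (cand_beta X h.closed h'.closed _)).trans (.cfst_beta ..)
    · exact (Red.csnd (cand_beta X h.closed h'.closed _)).trans (.csnd_beta ..)

theorem carr (h : RetV V V' f g) (h' : RetC B B' f' g') :
    RetC (.carr V B) (.carr V' B')
      (.llam X (.clam W (.lapp f' (.capp .svar (.vapp g (.var 0))))))
      (.llam Y (.clam W' (.lapp g' (.capp .svar (.vapp f (.var 0)))))) := by
  have ty : ∀ {V V' B B' X W f' g}, (∀ Γ, Ty false Γ none g (.arr V' V)) →
      (∀ Γ, Ty false Γ none f' (.lin B B')) → ∀ Γ, Ty false Γ none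
        (.llam X (.clam W (.lapp f' (.capp .svar (.vapp g (.var 0))))))
        (.lin (.carr V B) (.carr V' B')) := fun hg hf' Γ =>
    .llam nofun (.clam nofun (.lapp (hf' _) (.capp .svar (.vapp (hg _) (.var rfl)))))
  refine ⟨ty h.ty' h'.ty, ty h.ty h'.ty', ?_, ?_, ?_⟩
  · intro σ u; simp [Tm.full, h.closed' _ _, h'.closed _ _]
  · intro σ u; simp [Tm.full, h.closed _ _, h'.closed' _ _]
  · intro Γ Δ x hx
    have hx' := hx.shift V
    have v0 : Ty false (V :: Γ) none (.var 0) V := .var rfl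
    have tF := ty (X := X) (W := W) h.ty' h'.ty
    refine (Q.of_red ?_ (.lapp (ty h.ty h'.ty' Γ) (.lapp (tF Γ) hx))).trans
      ((Q.clam (X := W') (Y := W') ((h'.inv (.capp hx' (.vapp (h.ty' _) (.vapp (h.ty _) v0)))).trans
        (.capp (.refl hx') (h.inv v0)))).trans (.clam_eta hx W'))
    refine (carr_beta Y W' h'.closed' h.closed _).trans (.clam (.lapp (.refl _) ?_))
    have e : Tm.shift (.lapp (.llam X (.clam W (.lapp f' (.capp .svar (.vapp g (.var 0)))))) x) =
      .lapp (.llam X (.clam W (.lapp f' (.capp .svar (.vapp g (.var 0)))))) (Tm.shift x) := by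
      simp [Tm.shift, Tm.rename, h'.closed.rename, h.closed'.rename]
    rw [e]
    exact (Red.capp (carr_beta X W h'.closed h.closed' _) (.refl _)).trans
      (capp_carr_beta W h'.closed h.closed' _ _)

theorem copow (h : RetV V V' f g) (h' : RetC B B' f' g') :
    RetC (.copow V B) (.copow V' B')
      (.llam X (.copowlet .svar (.copow (.vapp f (.var 0)) (.lapp f' .svar))))
      (.llam Y (.copowlet .svar (.copow (.vapp g (.var 0)) (.lapp g' .svar)))) := by
  have ty : ∀ {V V' B B' X f f'}, (∀ Γ, Ty false Γ none f (.arr V V')) →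
      (∀ Γ, Ty false Γ none f' (.lin B B')) → ∀ Γ, Ty false Γ none
        (.llam X (.copowlet .svar (.copow (.vapp f (.var 0)) (.lapp f' .svar))))
        (.lin (.copow V B) (.copow V' B')) := fun hf hf' Γ =>
    .llam nofun (.copowlet .svar (.copow (.vapp (hf _) (.var rfl)) (.lapp (hf' _) .svar)))
  refine ⟨ty h.ty h'.ty, ty h.ty' h'.ty', ?_, ?_, ?_⟩
  · intro σ u; simp [Tm.full, h.closed _ _, h'.closed _ _]
  · intro σ u; simp [Tm.full, h.closed' _ _, h'.closed' _ _]
  · intro Γ Δ x hx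
    have v0 : Ty false (V :: Γ) none (.var 0) V := .var rfl
    refine (Q.of_red ?_ (.lapp (ty h.ty' h'.ty' Γ) (.lapp (ty h.ty h'.ty Γ) hx))).trans
      ((Q.copowlet (.refl hx) (Q.copow (h.inv v0) (h'.inv .svar))).trans ?_)
    · refine (copow_beta Y h.closed' h'.closed' _).trans
        ((Red.copowlet (copow_beta X h.closed h'.closed _) (.refl _)).trans
        ((Red.copowlet_comm (.copowlet _) _ _).trans (.copowlet (.refl _) ?_)))
      have := Red.copow_beta (.vapp f (.var 0)) (.lapp f' .svar)
        (.copow (.vapp g (.var 0)) (.lapp g' .svar))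
      simpa [Tm.subst0_eq_full, Tm.ssubst_eq_full, Tm.full, h.closed' _ _, h'.closed' _ _, h.closed _ _,
        h'.closed _ _, Fr.app, Fr.shift, Tm.rename, h.closed'.rename, h'.closed'.rename] using this
    · exact Q.copow_eta hx .svar

theorem csum (h : RetC A A' f g) (h' : RetC B B' f' g') :
    RetC (.csum A B) (.csum A' B')
      (.llam X (.ccase .svar (.cinl (.lapp f .svar)) (.cinr (.lapp f' .svar))))
      (.llam Y (.ccase .svar (.cinl (.lapp g .svar)) (.cinr (.lapp g' .svar)))) := by
  have ty : ∀ {A A' B B' X f f'}, (∀ Γ, Ty false Γ none f (.lin A A')) →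
      (∀ Γ, Ty false Γ none f' (.lin B B')) → ∀ Γ, Ty false Γ none
        (.llam X (.ccase .svar (.cinl (.lapp f .svar)) (.cinr (.lapp f' .svar))))
        (.lin (.csum A B) (.csum A' B')) := fun hf hf' Γ =>
    .llam nofun (.ccase .svar (.cinl (.lapp (hf _) .svar)) (.cinr (.lapp (hf' _) .svar)))
  refine ⟨ty h.ty h'.ty, ty h.ty' h'.ty', ?_, ?_, ?_⟩
  · intro σ u; simp [Tm.full, h.closed _ _, h'.closed _ _]
  · intro σ u; simp [Tm.full, h.closed' _ _, h'.closed' _ _]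
  · intro Γ Δ x hx
    refine (Q.of_red ?_ (.lapp (ty h.ty' h'.ty' Γ) (.lapp (ty h.ty h'.ty Γ) hx))).trans
      ((Q.ccase (.refl hx) (Q.cinl (h.inv .svar)) (Q.cinr (h'.inv .svar))).trans ?_)
    · refine (csum_beta Y _).trans ((Red.ccase (csum_beta X _) (.refl _) (.refl _)).trans
        ((Red.ccase_comm (.ccase _ _) _ _ _).trans (.ccase (.refl _) ?_ ?_)))
      · have := Red.csum_beta_inl (.lapp f .svar) (.cinl (.lapp g .svar)) (.cinr (.lapp g' .svar))
        simpa [Tm.ssubst, h.closed'.ssubst, h'.closed'.ssubst, Fr.app] using this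
      · have := Red.csum_beta_inr (.lapp f' .svar) (.cinl (.lapp g .svar)) (.cinr (.lapp g' .svar))
        simpa [Tm.ssubst, h.closed'.ssubst, h'.closed'.ssubst, Fr.app] using this
    · exact Q.csum_eta hx .svar

theorem bang (h : RetV V V' f g) :
    RetC (.bang V) (.copow V' .iunit)
      (.llam X (.banglet .svar (.copow (.vapp f (.var 0)) .top)))
      (.llam Y (.copowlet .svar (.ilet .svar (.bang (.vapp g (.var 0)))))) := by
  have tf : ∀ Γ, Ty false Γ none (.llam X (.banglet .svar (.copow (.vapp f (.var 0)) .top)))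
    (.lin (.bang V) (.copow V' .iunit)) := fun Γ =>
    .llam nofun (.banglet .svar (.copow (.vapp (h.ty _) (.var rfl)) .top))
  have tg : ∀ Γ, Ty false Γ none (.llam Y (.copowlet .svar (.ilet .svar (.bang (.vapp g (.var 0))))))
    (.lin (.copow V' .iunit) (.bang V)) := fun Γ =>
    .llam nofun (.copowlet .svar (.ilet .svar (.bang (.vapp (h.ty' _) (.var rfl)))))
  refine ⟨tf, tg, ?_, ?_, ?_⟩
  · intro σ u; simp [Tm.full, h.closed _ _]
  · intro σ u; simp [Tm.full, h.closed' _ _]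
  · intro Γ Δ x hx
    have v0 : Ty false (V :: Γ) none (.var 0) V := .var rfl
    refine (Q.of_red ?_ (.lapp (tg Γ) (.lapp (tf Γ) hx))).trans
      ((Q.banglet (.refl hx) (Q.bang (h.inv v0))).trans ?_)
    · refine (bang_beta Y _).trans ((Red.copowlet (bang_beta' X h.closed _) (.refl _)).trans
        ((Red.banglet_comm (.copowlet _) _ _).trans (.banglet (.refl _) ?_)))
      refine Red.trans ?_ (Red.ilet_beta _)
      have := Red.copow_beta (.vapp f (.var 0)) .top (.ilet .svar (.bang (.vapp g (.var 0))))
      simpa [Tm.subst0_eq_full, Tm.ssubst_eq_full, Tm.full, h.closed' _ _, h.closed _ _, Fr.app,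
        Fr.shift, Tm.rename, h.closed'.rename] using this
    · exact Q.bang_eta hx .svar

theorem bang' (h : RetV V' V g f) :
    RetC (.copow V' .iunit) (.bang V)
      (.llam Y (.copowlet .svar (.ilet .svar (.bang (.vapp g (.var 0))))))
      (.llam X (.banglet .svar (.copow (.vapp f (.var 0)) .top))) := by
  have tf : ∀ Γ, Ty false Γ none (.llam X (.banglet .svar (.copow (.vapp f (.var 0)) .top)))
    (.lin (.bang V) (.copow V' .iunit)) := fun Γ =>
    .llam nofun (.banglet .svar (.copow (.vapp (h.ty' _) (.var rfl)) .top))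
  have tg : ∀ Γ, Ty false Γ none (.llam Y (.copowlet .svar (.ilet .svar (.bang (.vapp g (.var 0))))))
    (.lin (.copow V' .iunit) (.bang V)) := fun Γ =>
    .llam nofun (.copowlet .svar (.ilet .svar (.bang (.vapp (h.ty _) (.var rfl)))))
  refine ⟨tg, tf, ?_, ?_, ?_⟩
  · intro σ u; simp [Tm.full, h.closed _ _]
  · intro σ u; simp [Tm.full, h.closed' _ _]
  · intro Γ Δ x hx
    have v0 : Ty false (V' :: Γ) none (.var 0) V' := .var rfl
    have e : Q (V' :: Γ) (some .iunit)
        (.ilet .svar (.copow (.vapp f (.vapp g (.var 0))) .top)) (.copow (.var 0) .svar)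
        (.comp (.copow V' .iunit)) :=
      (Q.ilet (.refl .svar) (Q.copow (h.inv v0) (.refl .top))).trans
        (Q.ilet_eta (e := .copow (.var 0) .svar) .svar (.copow v0 .svar))
    refine (Q.of_red ?_ (.lapp (tf Γ) (.lapp (tg Γ) hx))).trans
      ((Q.copowlet (.refl hx) e).trans ?_)
    · refine (bang_beta' X h.closed' _).trans ((Red.banglet (bang_beta Y _) (.refl _)).trans
        ((Red.copowlet_comm (.banglet _) _ _).trans (.copowlet (.refl _)
        ((Red.ilet_comm (Fr.shift (.banglet _)) _ _).trans (.ilet (.refl _) ?_)))))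
      have := Red.bang_beta (.vapp g (.var 0)) (.copow (.vapp f (.var 0)) .top)
      simpa [Tm.subst0_eq_full, Tm.full, h.closed' _ _, h.closed _ _, Fr.app,
        Fr.shift, Tm.rename, h.closed'.rename, Tm.liftN] using this
    · exact Q.copow_eta hx .svar

end RetC

end EEC

namespace EEC

namespace RetV

variable {A A' B B' : CType} {V V' W W' X Y X' Y' : VType} {C D : CType} {f g f' g' : Tm}

theorem id : RetV V V (.vlam X (.var 0)) (.vlam Y (.var 0)) where
  ty _ := .vlam nofun (.var rfl)
  ty' _ := .vlam nofun (.var rfl)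
  closed _ _ := rfl
  closed' _ _ := rfl
  inv hx := .of_red ((Red.vlam_beta _ _ _).trans (Red.vlam_beta _ _ _))
    (.vapp (.vlam nofun (.var rfl)) (.vapp (.vlam nofun (.var rfl)) hx))

theorem unit : RetV .unit .unit (.vlam X .unit) (.vlam Y .unit) where
  ty _ := .vlam nofun .unit
  ty' _ := .vlam nofun .unit
  closed _ _ := rfl
  closed' _ _ := rfl
  inv hx := (Q.unit_eta (.vapp (.vlam nofun .unit) (.vapp (.vlam nofun .unit) hx))).trans
    (Q.unit_eta hx).symm

theorem prod_beta (X : VType) (hf : f.Closed) (hf' : f'.Closed) (x : Tm) :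
    Red (.vapp (.vlam X (.vpair (.vapp f (.vfst (.var 0))) (.vapp f' (.vsnd (.var 0))))) x)
      (.vpair (.vapp f (.vfst x)) (.vapp f' (.vsnd x))) := by
  simpa [Tm.subst0_eq_full, Tm.full, hf _ _, hf' _ _] using
    Red.vlam_beta X (.vpair (.vapp f (.vfst (.var 0))) (.vapp f' (.vsnd (.var 0)))) x

theorem arr_beta (X Y : VType) (hf : f.Closed) (hg : g.Closed) (x : Tm) :
    Red (.vapp (.vlam X (.vlam Y (.vapp f (.vapp (.var 1) (.vapp g (.var 0)))))) x)
      (.vlam Y (.vapp f (.vapp (Tm.shift x) (.vapp g (.var 0))))) := by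
  simpa [Tm.subst0_eq_full, Tm.full, hf _ _, hg _ _] using
    Red.vlam_beta X (.vlam Y (.vapp f (.vapp (.var 1) (.vapp g (.var 0))))) x

theorem vapp_arr_beta (Y : VType) (hf : f.Closed) (hg : g.Closed) (x a : Tm) :
    Red (.vapp (.vlam Y (.vapp f (.vapp (Tm.shift x) (.vapp g (.var 0))))) a)
      (.vapp f (.vapp x (.vapp g a))) := by
  simpa [Tm.subst0_eq_full, Tm.full, hf _ _, hg _ _] using
    Red.vlam_beta Y (.vapp f (.vapp (Tm.shift x) (.vapp g (.var 0)))) a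

theorem lin_beta (X : VType) (C : CType) (hf : f.Closed) (hg : g.Closed) (x : Tm) :
    Red (.vapp (.vlam X (.llam C (.lapp f (.lapp (.var 0) (.lapp g .svar))))) x)
      (.llam C (.lapp f (.lapp x (.lapp g .svar)))) := by
  simpa [Tm.subst0_eq_full, Tm.full, hf _ _, hg _ _] using
    Red.vlam_beta X (.llam C (.lapp f (.lapp (.var 0) (.lapp g .svar)))) x

theorem lapp_lin_beta (C : CType) (hf : f.Closed) (hg : g.Closed) {x : Tm} (hx : x.SFree) (a : Tm) :
    Red (.lapp (.llam C (.lapp f (.lapp x (.lapp g .svar)))) a)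
      (.lapp f (.lapp x (.lapp g a))) := by
  simpa [Tm.ssubst, hf.ssubst, hg.ssubst, hx.ssubst_self] using
    Red.llam_beta C (.lapp f (.lapp x (.lapp g .svar))) a

theorem comp_beta (X : VType) (hf : f.Closed) (x : Tm) :
    Red (.vapp (.vlam X (.lapp f (.lapp (.var 0) .top))) x) (.lapp f (.lapp x .top)) := by
  simpa [Tm.subst0_eq_full, Tm.full, hf _ _] using
    Red.vlam_beta X (.lapp f (.lapp (.var 0) .top)) x

theorem comp_beta' (X : VType) (C : CType) (hg : g.Closed) (x : Tm) :
    Red (.vapp (.vlam X (.llam C (.ilet .svar (.lapp g (.var 0))))) x)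
      (.llam C (.ilet .svar (.lapp g x))) := by
  simpa [Tm.subst0_eq_full, Tm.full, hg _ _] using
    Red.vlam_beta X (.llam C (.ilet .svar (.lapp g (.var 0)))) x

theorem lapp_comp_beta' (C : CType) (hg : g.Closed) {x : Tm} (hx : x.SFree) (a : Tm) :
    Red (.lapp (.llam C (.ilet .svar (.lapp g x))) a) (.ilet a (.lapp g x)) := by
  simpa [Tm.ssubst, hg.ssubst, hx.ssubst_self] using
    Red.llam_beta C (.ilet .svar (.lapp g x)) a

theorem prod (h : RetV V V' f g) (h' : RetV W W' f' g') :
    RetV (.prod V W) (.prod V' W')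
      (.vlam X (.vpair (.vapp f (.vfst (.var 0))) (.vapp f' (.vsnd (.var 0)))))
      (.vlam Y (.vpair (.vapp g (.vfst (.var 0))) (.vapp g' (.vsnd (.var 0))))) := by
  have ty : ∀ {V V' W W' X f f'}, (∀ Γ, Ty false Γ none f (.arr V V')) →
      (∀ Γ, Ty false Γ none f' (.arr W W')) → ∀ Γ, Ty false Γ none
        (.vlam X (.vpair (.vapp f (.vfst (.var 0))) (.vapp f' (.vsnd (.var 0)))))
        (.arr (.prod V W) (.prod V' W')) := fun hf hf' Γ =>
    .vlam nofun (.vpair (.vapp (hf _) (.vfst (.var rfl))) (.vapp (hf' _) (.vsnd (.var rfl))))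
  refine ⟨ty h.ty h'.ty, ty h.ty' h'.ty', ?_, ?_, ?_⟩
  · intro σ u; simp [Tm.full, h.closed _ _, h'.closed _ _]
  · intro σ u; simp [Tm.full, h.closed' _ _, h'.closed' _ _]
  · intro Γ x hx
    refine (Q.of_red ?_ (.vapp (ty h.ty' h'.ty' Γ) (.vapp (ty h.ty h'.ty Γ) hx))).trans
      ((Q.vpair (h.inv (.vfst hx)) (h'.inv (.vsnd hx))).trans (.vpair_eta hx))
    refine (prod_beta Y h.closed' h'.closed' _).trans (.vpair (.vapp (.refl _) ?_)
      (.vapp (.refl _) ?_))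
    · exact (Red.vfst (prod_beta X h.closed h'.closed _)).trans (.vfst_beta ..)
    · exact (Red.vsnd (prod_beta X h.closed h'.closed _)).trans (.vsnd_beta ..)

theorem arr (h : RetV V V' f g) (h' : RetV W W' f' g') :
    RetV (.arr V W) (.arr V' W')
      (.vlam X (.vlam X' (.vapp f' (.vapp (.var 1) (.vapp g (.var 0))))))
      (.vlam Y (.vlam Y' (.vapp g' (.vapp (.var 1) (.vapp f (.var 0)))))) := by
  have ty : ∀ {V V' W W' X X' f' g}, (∀ Γ, Ty false Γ none g (.arr V' V)) →
      (∀ Γ, Ty false Γ none f' (.arr W W')) → ∀ Γ, Ty false Γ none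
        (.vlam X (.vlam X' (.vapp f' (.vapp (.var 1) (.vapp g (.var 0))))))
        (.arr (.arr V W) (.arr V' W')) := fun hg hf' Γ =>
    .vlam nofun (.vlam nofun (.vapp (hf' _) (.vapp (.var rfl) (.vapp (hg _) (.var rfl)))))
  refine ⟨ty h.ty' h'.ty, ty h.ty h'.ty', ?_, ?_, ?_⟩
  · intro σ u; simp [Tm.full, h.closed' _ _, h'.closed _ _]
  · intro σ u; simp [Tm.full, h.closed _ _, h'.closed' _ _]
  · intro Γ x hx
    have hx' := hx.shift V
    have v0 : Ty false (V :: Γ) none (.var 0) V := .var rfl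
    have tF := ty (X := X) (X' := X') h.ty' h'.ty
    refine (Q.of_red ?_ (.vapp (ty h.ty h'.ty' Γ) (.vapp (tF Γ) hx))).trans
      ((Q.vlam (X := Y') (Y := Y') ((h'.inv (.vapp hx' (.vapp (h.ty' _) (.vapp (h.ty _) v0)))).trans
        (.vapp (.refl hx') (h.inv v0)))).trans (.vlam_eta hx Y'))
    refine (arr_beta Y Y' h'.closed' h.closed _).trans (.vlam (.vapp (.refl _) ?_))
    have e : Tm.shift (.vapp (.vlam X (.vlam X' (.vapp f' (.vapp (.var 1) (.vapp g (.var 0)))))) x) =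
      .vapp (.vlam X (.vlam X' (.vapp f' (.vapp (.var 1) (.vapp g (.var 0)))))) (Tm.shift x) := by
      simp [Tm.shift, Tm.rename, h'.closed.rename, h.closed'.rename, Tm.liftN]
    rw [e]
    exact (Red.vapp (arr_beta X X' h'.closed h.closed' _) (.refl _)).trans
      (vapp_arr_beta X' h'.closed h.closed' _ _)

theorem lin (h : RetC A A' f g) (h' : RetC B B' f' g') :
    RetV (.lin A B) (.lin A' B')
      (.vlam X (.llam C (.lapp f' (.lapp (.var 0) (.lapp g .svar)))))
      (.vlam Y (.llam D (.lapp g' (.lapp (.var 0) (.lapp f .svar))))) := by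
  have ty : ∀ {A A' B B' X C f' g}, (∀ Γ, Ty false Γ none g (.lin A' A)) →
      (∀ Γ, Ty false Γ none f' (.lin B B')) → ∀ Γ, Ty false Γ none
        (.vlam X (.llam C (.lapp f' (.lapp (.var 0) (.lapp g .svar)))))
        (.arr (.lin A B) (.lin A' B')) := fun hg hf' Γ =>
    .vlam nofun (.llam nofun (.lapp (hf' _) (.lapp (.var rfl) (.lapp (hg _) .svar))))
  refine ⟨ty h.ty' h'.ty, ty h.ty h'.ty', ?_, ?_, ?_⟩
  · intro σ u; simp [Tm.full, h.closed' _ _, h'.closed _ _]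
  · intro σ u; simp [Tm.full, h.closed _ _, h'.closed' _ _]
  · intro Γ x hx
    have tF := ty (X := X) (C := C) h.ty' h'.ty
    refine (Q.of_red ?_ (.vapp (ty h.ty h'.ty' Γ) (.vapp (tF Γ) hx))).trans
      ((Q.llam (X := D) (Y := D) ((h'.inv (.lapp hx (.lapp (h.ty' _) (.lapp (h.ty _) .svar)))).trans
        (.lapp (.refl hx) (h.inv .svar)))).trans (.llam_eta hx D))
    refine (lin_beta Y D h'.closed' h.closed _).trans (.llam (.lapp (.refl _) ?_))
    exact (Red.lapp (lin_beta X C h'.closed h.closed' _) (.refl _)).trans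
      (lapp_lin_beta C h'.closed h.closed' hx.sfree _)

theorem comp (h : RetC A A' f g) :
    RetV (.lin .iunit A) (.comp A')
      (.vlam X (.lapp f (.lapp (.var 0) .top)))
      (.vlam Y (.llam C (.ilet .svar (.lapp g (.var 0))))) where
  ty Γ := .vlam nofun (.lapp (h.ty _) (.lapp (.var rfl) .top))
  ty' Γ := .vlam nofun (.llam nofun (.ilet .svar (.lapp (h.ty' _) (.var rfl))))
  closed σ u := by simp [Tm.full, h.closed _ _]
  closed' σ u := by simp [Tm.full, h.closed' _ _]
  inv {Γ x} hx := by
    refine (Q.of_red ((comp_beta' Y C h.closed' _).trans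
      (.llam (.ilet (.refl _) (.lapp (.refl _) (comp_beta X h.closed x)))))
      (.vapp (.vlam nofun (.llam nofun (.ilet .svar (.lapp (h.ty' _) (.var rfl)))))
      (.vapp (.vlam nofun (.lapp (h.ty _) (.lapp (.var rfl) .top))) hx))).trans
      ((Q.llam (X := C) (Y := C) ?_).trans (.llam_eta hx C))
    refine (Q.ilet (.refl .svar) (h.inv (.lapp hx .top))).trans ?_
    have := Q.ilet_eta (e := .lapp x .svar) (Ty.svar (b := false) (Γ := Γ) (A := .iunit))
      (.lapp hx .svar)
    simpa [Tm.ssubst, hx.sfree.ssubst_self] using this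

theorem comp' (h : RetC A' A g f) :
    RetV (.comp A') (.lin .iunit A)
      (.vlam Y (.llam C (.ilet .svar (.lapp g (.var 0)))))
      (.vlam X (.lapp f (.lapp (.var 0) .top))) where
  ty' Γ := .vlam nofun (.lapp (h.ty' _) (.lapp (.var rfl) .top))
  ty Γ := .vlam nofun (.llam nofun (.ilet .svar (.lapp (h.ty _) (.var rfl))))
  closed' σ u := by simp [Tm.full, h.closed' _ _]
  closed σ u := by simp [Tm.full, h.closed _ _]
  inv {Γ x} hx := by
    refine (Q.of_red ((comp_beta X h.closed' _).trans (.lapp (.refl _)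
      ((Red.lapp (comp_beta' Y C h.closed _) (.refl _)).trans
      ((lapp_comp_beta' C h.closed hx.sfree _).trans (.ilet_beta _)))))
      (.vapp (.vlam nofun (.lapp (h.ty' _) (.lapp (.var rfl) .top)))
      (.vapp (.vlam nofun (.llam nofun (.ilet .svar (.lapp (h.ty _) (.var rfl))))) hx))).trans
      (h.inv hx)

end RetV
end EEC

namespace EEC

/-- The double CPS translation leaves the base types and the result type's translation in place. -/
structure CpsResult (R : CType) : Prop where
  self : cpsC R R = .iunit
  base : ∀ a, cpsC R (cpsC R (.base a)) = .base a

theorem CpsResult.of_base_or_iunit {R : CType}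
    (hR : (∃ a : ℕ, R = CType.base a) ∨ R = CType.iunit) : CpsResult R := by
  rcases hR with ⟨b, rfl⟩ | rfl
  · refine ⟨by simp [cpsC], fun a => ?_⟩
    by_cases h : b = a <;> simp [cpsC, h]
  · exact ⟨by simp [cpsC], fun a => by simp [cpsC]⟩

mutual

theorem CpsResult.iotaV {R : CType} (h : CpsResult R) : (A : VType) →
    RetV (cpsV R (cpsV R A)) A (iotaV R A) (iotaVinv R A) ∧
      RetV A (cpsV R (cpsV R A)) (iotaVinv R A) (EEC.iotaV R A)
  | .base a => by
    simp only [cpsV, EEC.iotaV, EEC.iotaVinv]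
    exact ⟨.id, .id⟩
  | .unit => by
    simp only [cpsV, EEC.iotaV, EEC.iotaVinv]
    exact ⟨.unit, .unit⟩
  | .prod A B => by
    have ⟨a, a'⟩ := h.iotaV A
    have ⟨b, b'⟩ := h.iotaV B
    simp only [cpsV, EEC.iotaV, EEC.iotaVinv]
    exact ⟨.prod a b, .prod a' b'⟩
  | .arr A B => by
    have ⟨a, a'⟩ := h.iotaV A
    have ⟨b, b'⟩ := h.iotaV B
    simp only [cpsV, EEC.iotaV, EEC.iotaVinv]
    exact ⟨.arr a b, .arr a' b'⟩
  | .comp A => by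
    have ⟨a, a'⟩ := h.iotaC A
    simp only [cpsV, EEC.iotaV, EEC.iotaVinv, h.self]
    exact ⟨.comp a, .comp' a'⟩
  | .lin A B => by
    have ⟨a, a'⟩ := h.iotaC A
    have ⟨b, b'⟩ := h.iotaC B
    simp only [cpsV, EEC.iotaV, EEC.iotaVinv]
    exact ⟨.lin a b, .lin a' b'⟩

theorem CpsResult.iotaC {R : CType} (h : CpsResult R) : (A : CType) →
    RetC (cpsC R (cpsC R A)) A (iotaC R A) (iotaCinv R A) ∧
      RetC A (cpsC R (cpsC R A)) (iotaCinv R A) (EEC.iotaC R A)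
  | .base a => by
    simp only [EEC.iotaC, EEC.iotaCinv, h.base]
    exact ⟨.id, .id⟩
  | .cunit => by
    simp only [cpsC, EEC.iotaC, EEC.iotaCinv]
    exact ⟨.cunit, .cunit⟩
  | .cand A B => by
    have ⟨a, a'⟩ := h.iotaC A
    have ⟨b, b'⟩ := h.iotaC B
    simp only [cpsC, EEC.iotaC, EEC.iotaCinv]
    exact ⟨.cand a b, .cand a' b'⟩
  | .carr A B => by
    have ⟨a, a'⟩ := h.iotaV A
    have ⟨b, b'⟩ := h.iotaC B
    simp only [cpsC, EEC.iotaC, EEC.iotaCinv]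
    exact ⟨.carr a b, .carr a' b'⟩
  | .iunit => by
    simp only [cpsC, EEC.iotaC, EEC.iotaCinv, h.self]
    exact ⟨.id, .id⟩
  | .bang A => by
    have ⟨a, a'⟩ := h.iotaV A
    simp only [cpsC, EEC.iotaC, EEC.iotaCinv, h.self]
    exact ⟨.bang' a, .bang a'⟩
  | .copow A B => by
    have ⟨a, a'⟩ := h.iotaV A
    have ⟨b, b'⟩ := h.iotaC B
    simp only [cpsC, EEC.iotaC, EEC.iotaCinv]
    exact ⟨.copow a b, .copow a' b'⟩
  | .czero => by
    simp only [cpsC, EEC.iotaC, EEC.iotaCinv]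
    exact ⟨.id, .id⟩
  | .csum A B => by
    have ⟨a, a'⟩ := h.iotaC A
    have ⟨b, b'⟩ := h.iotaC B
    simp only [cpsC, EEC.iotaC, EEC.iotaCinv]
    exact ⟨.csum a b, .csum a' b'⟩

end

mutual

theorem CpsResult.ty_iotaV {R : CType} (h : CpsResult R) : (A : VType) → (Γ : List VType) →
    Ty true Γ none (EEC.iotaV R A) (.arr (cpsV R (cpsV R A)) A) ∧
      Ty true Γ none (iotaVinv R A) (.arr A (cpsV R (cpsV R A)))
  | .base a, Γ => by
    simp only [cpsV, EEC.iotaV, EEC.iotaVinv]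
    exact ⟨.vlam (fun _ => rfl) (.var rfl), .vlam (fun _ => rfl) (.var rfl)⟩
  | .unit, Γ => by
    simp only [cpsV, EEC.iotaV, EEC.iotaVinv]
    exact ⟨.vlam (fun _ => rfl) .unit, .vlam (fun _ => rfl) .unit⟩
  | .prod A B, Γ => by
    have a := h.ty_iotaV A
    have b := h.ty_iotaV B
    simp only [cpsV, EEC.iotaV, EEC.iotaVinv]
    exact ⟨.vlam (fun _ => rfl) (.vpair (.vapp (a _).1 (.vfst (.var rfl)))
        (.vapp (b _).1 (.vsnd (.var rfl)))),
      .vlam (fun _ => rfl) (.vpair (.vapp (a _).2 (.vfst (.var rfl)))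
        (.vapp (b _).2 (.vsnd (.var rfl))))⟩
  | .arr A B, Γ => by
    have a := h.ty_iotaV A
    have b := h.ty_iotaV B
    simp only [cpsV, EEC.iotaV, EEC.iotaVinv]
    exact ⟨.vlam (fun _ => rfl) (.vlam (fun _ => rfl) (.vapp (b _).1 (.vapp (.var rfl)
        (.vapp (a _).2 (.var rfl))))),
      .vlam (fun _ => rfl) (.vlam (fun _ => rfl) (.vapp (b _).2 (.vapp (.var rfl)
        (.vapp (a _).1 (.var rfl)))))⟩
  | .comp A, Γ => by
    have a := h.ty_iotaC A
    simp only [cpsV, EEC.iotaV, EEC.iotaVinv, h.self]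
    exact ⟨.vlam (fun _ => rfl) (.lapp (a _).1 (.lapp (.var rfl) .top)),
      .vlam (fun _ => rfl) (.llam (fun _ => rfl) (.ilet .svar (.lapp (a _).2 (.var rfl))))⟩
  | .lin A B, Γ => by
    have a := h.ty_iotaC A
    have b := h.ty_iotaC B
    simp only [cpsV, EEC.iotaV, EEC.iotaVinv]
    exact ⟨.vlam (fun _ => rfl) (.llam (fun _ => rfl) (.lapp (b _).1 (.lapp (.var rfl)
        (.lapp (a _).2 .svar)))),
      .vlam (fun _ => rfl) (.llam (fun _ => rfl) (.lapp (b _).2 (.lapp (.var rfl)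
        (.lapp (a _).1 .svar))))⟩

theorem CpsResult.ty_iotaC {R : CType} (h : CpsResult R) : (A : CType) → (Γ : List VType) →
    Ty true Γ none (EEC.iotaC R A) (.lin (cpsC R (cpsC R A)) A) ∧
      Ty true Γ none (iotaCinv R A) (.lin A (cpsC R (cpsC R A)))
  | .base a, Γ => by
    simp only [EEC.iotaC, EEC.iotaCinv, h.base]
    exact ⟨.llam (fun _ => rfl) .svar, .llam (fun _ => rfl) .svar⟩
  | .cunit, Γ => by
    simp only [cpsC, EEC.iotaC, EEC.iotaCinv]
    exact ⟨.llam (fun _ => rfl) .cunit, .llam (fun _ => rfl) .cunit⟩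
  | .cand A B, Γ => by
    have a := h.ty_iotaC A
    have b := h.ty_iotaC B
    simp only [cpsC, EEC.iotaC, EEC.iotaCinv]
    exact ⟨.llam (fun _ => rfl) (.cpair (.lapp (a _).1 (.cfst .svar)) (.lapp (b _).1 (.csnd .svar))),
      .llam (fun _ => rfl) (.cpair (.lapp (a _).2 (.cfst .svar)) (.lapp (b _).2 (.csnd .svar)))⟩
  | .carr A B, Γ => by
    have a := h.ty_iotaV A
    have b := h.ty_iotaC B
    simp only [cpsC, EEC.iotaC, EEC.iotaCinv]
    exact ⟨.llam (fun _ => rfl) (.clam (fun _ => rfl) (.lapp (b _).1 (.capp .svar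
        (.vapp (a _).2 (.var rfl))))),
      .llam (fun _ => rfl) (.clam (fun _ => rfl) (.lapp (b _).2 (.capp .svar
        (.vapp (a _).1 (.var rfl)))))⟩
  | .iunit, Γ => by
    simp only [cpsC, EEC.iotaC, EEC.iotaCinv, h.self]
    exact ⟨.llam (fun _ => rfl) .svar, .llam (fun _ => rfl) .svar⟩
  | .bang A, Γ => by
    have a := h.ty_iotaV A
    simp only [cpsC, EEC.iotaC, EEC.iotaCinv, h.self]
    exact ⟨.llam (fun _ => rfl) (.copowlet .svar (.ilet .svar (.bang
        (.vapp (a _).1 (.var rfl))))),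
      .llam (fun _ => rfl) (.banglet .svar (.copow (.vapp (a _).2 (.var rfl)) .top))⟩
  | .copow A B, Γ => by
    have a := h.ty_iotaV A
    have b := h.ty_iotaC B
    simp only [cpsC, EEC.iotaC, EEC.iotaCinv]
    exact ⟨.llam (fun _ => rfl) (.copowlet .svar (.copow (.vapp (a _).1 (.var rfl))
        (.lapp (b _).1 .svar))),
      .llam (fun _ => rfl) (.copowlet .svar (.copow (.vapp (a _).2 (.var rfl))
        (.lapp (b _).2 .svar)))⟩
  | .czero, Γ => by
    simp only [cpsC, EEC.iotaC, EEC.iotaCinv]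
    exact ⟨.llam (fun _ => rfl) .svar, .llam (fun _ => rfl) .svar⟩
  | .csum A B, Γ => by
    have a := h.ty_iotaC A
    have b := h.ty_iotaC B
    simp only [cpsC, EEC.iotaC, EEC.iotaCinv]
    exact ⟨.llam (fun _ => rfl) (.ccase .svar (.cinl (.lapp (a _).1 .svar))
        (.cinr (.lapp (b _).1 .svar))),
      .llam (fun _ => rfl) (.ccase .svar (.cinl (.lapp (a _).2 .svar))
        (.cinr (.lapp (b _).2 .svar)))⟩

end

end EEC

namespace EEC

/-- The substitution replacing each variable of `Γ` by its image under `ι⁻¹`. -/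
def iotaEnv (R : CType) (Γ : List VType) (n : ℕ) : Tm :=
  match Γ[n]? with
  | some C => .vapp (iotaVinv R C) (.var n)
  | none => .var n

/-- The argument substituted for the stoup variable of a doubly translated term. -/
def iotaStoup (R : CType) : Option CType → Tm
  | none => .top
  | some D => .lapp (iotaCinv R D) .svar

/-- The double translation of a computation, transported to the original context. -/
def dblC (R : CType) (Γ : List VType) (Δ : Option CType) (t : Tm) : Tm :=
  Tm.full (iotaEnv R Γ) (iotaStoup R Δ) (Tm.dcps Δ.isSome t)

/-- The double translation of a value, transported to the original context. -/
def dblV (R : CType) (Γ : List VType) (t : Tm) : Tm :=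
  Tm.full (iotaEnv R Γ) .svar (Tm.cpsE false (Tm.cpsE false t))

namespace Tm

theorem subst0_rename_full {σ : ℕ → Tm} (hs : ∀ n, SFree (σ n)) {u : Tm}
    (hu : ∀ σ, full σ .svar u = u) (a t : Tm) :
    subst0 a (rename (liftN Nat.succ) (full (liftS σ) u t)) =
      full (fun n => match n with | 0 => a | m + 1 => shift (σ m)) u t := by
  rw [rename_full, subst0_eq_full, full_full, rename_eq_full, hu, hu]
  · congr 1
    funext n
    cases n with
    | zero => simp [full, rename, liftN]
    | succ n =>
      simp only [liftS_succ, shift, rename_rename, full_rename]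
      rw [rename_eq_full Nat.succ]
      congr 1
  · exact fun n => (SFree.liftS hs n).rename _

theorem ssubst_full_svar {σ : ℕ → Tm} (hs : ∀ n, SFree (σ n)) (u t : Tm) :
    ssubst u (full σ .svar t) = full σ u t := by
  rw [ssubst_eq_full, full_full hs]
  congr 1
  funext n
  exact (hs n).full_eq u

end Tm

theorem iotaSubst_eq (R : CType) (Γ : List VType) (t : Tm) :
    iotaSubst R Γ t = Tm.full (iotaEnv R Γ) .svar t :=
  Tm.psubst_eq_full ..

theorem iotaEnv_sfree (R : CType) (Γ : List VType) (hR : CpsResult R) (n : ℕ) :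
    (iotaEnv R Γ n).SFree := by
  unfold iotaEnv
  split
  · intro σ u v
    simp [Tm.full, (hR.iotaV _).1.closed' _ _]
  · exact fun σ u v => rfl

namespace CpsResult

variable {R : CType} {Γ : List VType} {Δ : Option CType} {s t t' u : Tm}
  {A X Y : VType} {B C D : CType}

theorem iotaEnv_cons (hR : CpsResult R) (A : VType) (Γ : List VType) :
    iotaEnv R (A :: Γ) = fun n => match n with
      | 0 => .vapp (iotaVinv R A) (.var 0)
      | m + 1 => Tm.shift (iotaEnv R Γ m) := by
  funext n
  cases n with
  | zero => rfl
  | succ n =>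
    simp only [iotaEnv, List.getElem?_cons_succ]
    split
    · simp [Tm.shift, Tm.rename, (hR.iotaV _).1.closed'.rename]
    · rfl

theorem tySub (hR : CpsResult R) (Γ : List VType) :
    TySub false (cpsCtx R (cpsCtx R Γ)) Γ (iotaEnv R Γ) := by
  intro n A hn
  simp only [cpsCtx, List.map_map, List.getElem?_map, Option.map_eq_some_iff] at hn
  obtain ⟨B, hB, rfl⟩ := hn
  simp only [iotaEnv, hB]
  exact .vapp ((hR.iotaV B).1.ty' Γ) (.var hB)

theorem tyStoup (hR : CpsResult R) (Γ : List VType) (Δ : Option CType) :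
    TyStoup false Γ (some (cpsC R (cpsStoup R Δ))) Δ (iotaStoup R Δ) := by
  cases Δ with
  | none =>
    simp only [cpsStoup, TyStoup, hR.self]
    exact .top
  | some D => exact .lapp ((hR.iotaC D).1.ty' Γ) .svar

theorem full_iotaStoup (hR : CpsResult R) (Δ : Option CType) (σ : ℕ → Tm) :
    Tm.full σ .svar (iotaStoup R Δ) = iotaStoup R Δ := by
  cases Δ with
  | none => rfl
  | some D => simp [iotaStoup, Tm.full, (hR.iotaC D).1.closed' _ _]

theorem shift_iotaStoup (hR : CpsResult R) (Δ : Option CType) :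
    Tm.shift (iotaStoup R Δ) = iotaStoup R Δ := by
  rw [Tm.shift, Tm.rename_eq_full, hR.full_iotaStoup]

theorem subst0_dbl (hR : CpsResult R) (A : VType) (Γ : List VType) {w : Tm}
    (hw : ∀ σ, Tm.full σ .svar w = w) (t : Tm) :
    Tm.subst0 (.vapp (iotaVinv R A) (.var 0))
        (Tm.rename (Tm.liftN Nat.succ) (Tm.full (Tm.liftS (iotaEnv R Γ)) w t)) =
      Tm.full (iotaEnv R (A :: Γ)) w t := by
  rw [Tm.subst0_rename_full (iotaEnv_sfree R Γ hR) hw, hR.iotaEnv_cons]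

theorem ssubst_subst0_dbl (hR : CpsResult R) (A : VType) (Γ : List VType) (u t : Tm) :
    Tm.ssubst u (Tm.subst0 (.vapp (iotaVinv R A) (.var 0))
        (Tm.rename (Tm.liftN Nat.succ) (Tm.full (Tm.liftS (iotaEnv R Γ)) .svar t))) =
      Tm.full (iotaEnv R (A :: Γ)) u t := by
  rw [hR.subst0_dbl A Γ fun _ => rfl, Tm.ssubst_full_svar (iotaEnv_sfree R _ hR)]

theorem transport (hR : CpsResult R)
    (h : Q (cpsCtx R (cpsCtx R Γ)) (some (cpsC R (cpsStoup R Δ))) t t' X) :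
    Q Γ Δ (Tm.full (iotaEnv R Γ) (iotaStoup R Δ) t) (Tm.full (iotaEnv R Γ) (iotaStoup R Δ) t') X :=
  h.full (hR.tySub Γ) (iotaEnv_sfree R Γ hR) (hR.tyStoup Γ Δ)

theorem ty_dblC (hR : CpsResult R) (h : Ty false Γ Δ t (.comp B)) :
    Ty false Γ Δ (dblC R Γ Δ t) (.comp (cpsC R (cpsC R B))) :=
  (h.dcps (R := R)).full (hR.tySub Γ) (hR.tyStoup Γ Δ)

theorem ty_dblV (hR : CpsResult R) (h : Ty false Γ none t A) :
    Ty false Γ none (dblV R Γ t) (cpsV R (cpsV R A)) :=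
  ((h.cpsV R).cpsV R).full (hR.tySub Γ) rfl

theorem dblC_none (h : Ty false Γ none t A) :
    dblC R Γ none t = .lapp (dblV R Γ t) .top := by
  simp only [dblC, iotaStoup, dblV, Option.isSome_none, Tm.dcps_false, Tm.full]
  rw [((h.cpsV R).cpsV R).sfree _ _ .svar]

end CpsResult

/-- The double translation of `t` agrees with `ι⁻¹` applied to `t`. -/
structure Inverts (R : CType) (Γ : List VType) (Δ : Option CType) (t : Tm) (A : VType) : Prop where
  value : Δ = none → Q Γ none (dblV R Γ t) (.vapp (iotaVinv R A) t) (cpsV R (cpsV R A))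
  comp : ∀ B, A = .comp B →
    Q Γ Δ (dblC R Γ Δ t) (.lapp (iotaCinv R B) t) (.comp (cpsC R (cpsC R B)))

namespace Inverts

variable {R : CType} {Γ : List VType} {Δ : Option CType} {t : Tm}
  {A : VType} {B : CType}

theorem of_value (hR : CpsResult R) (h : Ty false Γ none t A)
    (q : Q Γ none (dblV R Γ t) (.vapp (iotaVinv R A) t) (cpsV R (cpsV R A))) :
    Inverts R Γ none t A where
  value _ := q
  comp B e := by
    subst e
    have ⟨a, a'⟩ := hR.iotaC B
    rw [CpsResult.dblC_none h]
    simp only [cpsV, hR.self] at q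
    refine (Q.lapp q (.refl .top)).red ?_
    rw [iotaVinv]
    exact (Red.lapp (RetV.comp_beta' _ _ a.closed' _) (.refl _)).trans
      ((RetV.lapp_comp_beta' _ a.closed' h.sfree _).trans (.ilet_beta _))

theorem of_comp (hR : CpsResult R) (h : Ty false Γ Δ t (.comp B))
    (q : Q Γ Δ (dblC R Γ Δ t) (.lapp (iotaCinv R B) t) (.comp (cpsC R (cpsC R B)))) :
    Inverts R Γ Δ t (.comp B) where
  comp B' e := by cases e; exact q
  value e := by
    subst e
    have ⟨a, a'⟩ := hR.iotaC B
    have ⟨v, v'⟩ := hR.iotaV (.comp B)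
    have hd := hR.ty_dblV h
    rw [CpsResult.dblC_none h] at q
    have r : Red (.vapp (iotaV R (.comp B)) (dblV R Γ t))
        (.lapp (iotaC R B) (.lapp (dblV R Γ t) .top)) := by
      rw [iotaV]
      exact RetV.comp_beta _ a.closed _
    have e := (Q.of_red r (.vapp (v.ty Γ) hd)).trans
      ((Q.lapp (.refl (a.ty Γ)) q).trans (a'.inv h))
    exact (v.inv hd).symm.trans (.vapp (.refl (v.ty' Γ)) e)

theorem of_value_iota (hR : CpsResult R) (h : Ty false Γ none t A)
    (q : Q Γ none (.vapp (iotaV R A) (dblV R Γ t)) t A) : Inverts R Γ none t A :=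
  have ⟨v, _⟩ := hR.iotaV A
  of_value hR h ((v.inv (hR.ty_dblV h)).symm.trans (.vapp (.refl (v.ty' Γ)) q))

theorem of_comp_iota (hR : CpsResult R) (h : Ty false Γ Δ t (.comp B))
    (q : Q Γ Δ (.lapp (iotaC R B) (dblC R Γ Δ t)) t (.comp B)) : Inverts R Γ Δ t (.comp B) :=
  have ⟨a, _⟩ := hR.iotaC B
  of_comp hR h ((a.inv (hR.ty_dblC h)).symm.trans (.lapp (.refl (a.ty' Γ)) q))

theorem value_iota (hR : CpsResult R) (h : Ty false Γ none t A) (i : Inverts R Γ none t A) :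
    Q Γ none (.vapp (iotaV R A) (dblV R Γ t)) t A :=
  have ⟨v, v'⟩ := hR.iotaV A
  (Q.vapp (.refl (v.ty Γ)) (i.value rfl)).trans (v'.inv h)

theorem comp_iota (hR : CpsResult R) (h : Ty false Γ Δ t (.comp B))
    (i : Inverts R Γ Δ t (.comp B)) :
    Q Γ Δ (.lapp (iotaC R B) (dblC R Γ Δ t)) t (.comp B) :=
  have ⟨a, a'⟩ := hR.iotaC B
  (Q.lapp (.refl (a.ty Γ)) (i.comp B rfl)).trans (a'.inv h)

end Inverts

end EEC

namespace EEC

namespace Q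

variable {Γ : List VType} {Δ : Option CType} {s t u f : Tm} {A : VType} {C D E E' : CType}

theorem banglet_comm {e : Tm} (he : Ty false Γ (some C) e (.comp D))
    (h : Ty false Γ Δ s (.comp (.bang A))) (ht : Ty false (A :: Γ) none t (.comp C)) :
    Q Γ Δ (Tm.ssubst (.banglet s t) e) (.banglet s (Tm.ssubst t (Tm.shift e))) (.comp D) := by
  obtain ⟨e', a, ⟨d⟩⟩ := he.lift
  obtain ⟨s', a', ⟨d'⟩⟩ := h.lift
  obtain ⟨t', a'', ⟨d''⟩⟩ := ht.lift
  exact (EEq.banglet_comm d.ty d'.ty d''.ty).q.of_erase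
    (by simp [Tm.erase, Tm.erase_ssubst, a, a', a''])
    (by simp [Tm.erase, Tm.erase_ssubst, Tm.erase_shift, a, a', a''])

theorem lapp_ilet (hf : Ty false Γ none f (.lin C D)) (h : Ty false Γ Δ s (.comp .iunit))
    (ht : Ty false Γ none t (.comp C)) :
    Q Γ Δ (.lapp f (.ilet s t)) (.ilet s (.lapp f t)) (.comp D) := by
  simpa [Tm.ssubst, hf.sfree.ssubst_self] using ilet_comm (.lapp hf .svar) h ht

theorem lapp_banglet (hf : Ty false Γ none f (.lin C D)) (hc : f.Closed)
    (h : Ty false Γ Δ s (.comp (.bang A))) (ht : Ty false (A :: Γ) none t (.comp C)) :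
    Q Γ Δ (.lapp f (.banglet s t)) (.banglet s (.lapp f t)) (.comp D) := by
  simpa [Tm.ssubst, hc.ssubst, Tm.shift, Tm.rename, hc.rename] using
    banglet_comm (.lapp hf .svar) h ht

theorem lapp_copowlet (hf : Ty false Γ none f (.lin C D)) (hc : f.Closed)
    (h : Ty false Γ Δ s (.comp (.copow A E))) (ht : Ty false (A :: Γ) (some E) t (.comp C)) :
    Q Γ Δ (.lapp f (.copowlet s t)) (.copowlet s (.lapp f t)) (.comp D) := by
  simpa [Tm.ssubst, hc.ssubst, Tm.shift, Tm.rename, hc.rename] using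
    copowlet_comm (.lapp hf .svar) h ht

theorem lapp_cimage {X Y : CType} (hf : Ty false Γ none f (.lin C D))
    (h : Ty false Γ Δ s (.comp .czero)) :
    Q Γ Δ (.lapp f (.cimage X s)) (.cimage Y s) (.comp D) := by
  simpa [Tm.ssubst, hf.sfree.ssubst_self] using cimage_comm (X := X) (Y := Y) (.lapp hf .svar) h

theorem lapp_ccase (hf : Ty false Γ none f (.lin C D)) (h : Ty false Γ Δ s (.comp (.csum E E')))
    (ht : Ty false Γ (some E) t (.comp C)) (hu : Ty false Γ (some E') u (.comp C)) :
    Q Γ Δ (.lapp f (.ccase s t u)) (.ccase s (.lapp f t) (.lapp f u)) (.comp D) := by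
  simpa [Tm.ssubst, hf.sfree.ssubst_self] using ccase_comm (.lapp hf .svar) h ht hu

end Q

namespace Inverts

variable {R : CType} {Γ : List VType} {Δ : Option CType} {s t u : Tm}
  {A B X : VType} {C D E : CType}

theorem var (hR : CpsResult R) {n : ℕ} (h : Γ[n]? = some A) : Inverts R Γ none (.var n) A := by
  refine of_value hR (.var h) ?_
  have : dblV R Γ (.var n) = .vapp (iotaVinv R A) (.var n) := by
    simp [dblV, Tm.cpsE, Tm.full, iotaEnv, h]
  rw [this]
  exact .refl (.vapp ((hR.iotaV A).1.ty' Γ) (.var h))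

theorem svar (hR : CpsResult R) : Inverts R Γ (some C) .svar (.comp C) :=
  of_comp hR .svar (.refl (.lapp ((hR.iotaC C).1.ty' Γ) .svar))

theorem unit (hR : CpsResult R) : Inverts R Γ none .unit .unit :=
  of_value hR .unit (Q.unit_eta (.vapp ((hR.iotaV .unit).1.ty' Γ) .unit)).symm

theorem vpair (hR : CpsResult R) (ht : Ty false Γ none t A) (hu : Ty false Γ none u B)
    (i : Inverts R Γ none t A) (j : Inverts R Γ none u B) :
    Inverts R Γ none (.vpair t u) (.prod A B) := by
  refine of_value hR (.vpair ht hu) ((Q.vpair (i.value rfl) (j.value rfl)).expand ?_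
    (.vapp ((hR.iotaV (.prod A B)).1.ty' Γ) (.vpair ht hu)))
  rw [iotaVinv]
  exact (RetV.prod_beta _ (hR.iotaV A).1.closed' (hR.iotaV B).1.closed' _).trans
    (.vpair (.vapp (.refl _) (.vfst_beta ..)) (.vapp (.refl _) (.vsnd_beta ..)))

theorem vfst (hR : CpsResult R) (ht : Ty false Γ none t (.prod A B))
    (i : Inverts R Γ none t (.prod A B)) : Inverts R Γ none (.vfst t) A := by
  refine of_value hR (.vfst ht) ((Q.vfst (i.value rfl)).red ?_)
  rw [iotaVinv]
  exact (Red.vfst (RetV.prod_beta _ (hR.iotaV A).1.closed' (hR.iotaV B).1.closed' _)).trans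
    (.vfst_beta ..)

theorem vsnd (hR : CpsResult R) (ht : Ty false Γ none t (.prod A B))
    (i : Inverts R Γ none t (.prod A B)) : Inverts R Γ none (.vsnd t) B := by
  refine of_value hR (.vsnd ht) ((Q.vsnd (i.value rfl)).red ?_)
  rw [iotaVinv]
  exact (Red.vsnd (RetV.prod_beta _ (hR.iotaV A).1.closed' (hR.iotaV B).1.closed' _)).trans
    (.vsnd_beta ..)

theorem vapp (hR : CpsResult R) (hs : Ty false Γ none s (.arr A B)) (ht : Ty false Γ none t A)
    (i : Inverts R Γ none s (.arr A B)) (j : Inverts R Γ none t A) :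
    Inverts R Γ none (.vapp s t) B := by
  have ⟨a, a'⟩ := hR.iotaV A
  have ⟨b, b'⟩ := hR.iotaV B
  refine of_value hR (.vapp hs ht) (((Q.vapp (i.value rfl) (j.value rfl)).red ?_).trans
    (.vapp (.refl (b.ty' Γ)) (.vapp (.refl hs) (a'.inv ht))))
  rw [iotaVinv]
  exact (Red.vapp (RetV.arr_beta _ _ b.closed' a.closed _) (.refl _)).trans
    (RetV.vapp_arr_beta _ b.closed' a.closed _ _)

theorem vlam (hR : CpsResult R) (ht : Ty false (A :: Γ) none t B)
    (i : Inverts R (A :: Γ) none t B) : Inverts R Γ none (.vlam X t) (.arr A B) := by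
  have ⟨a, a'⟩ := hR.iotaV A
  have ⟨b, b'⟩ := hR.iotaV B
  have hT : Ty false Γ none (.vlam X t) (.arr A B) := .vlam nofun ht
  refine of_value_iota hR hT ((Q.of_red ?_ (.vapp ((hR.iotaV (.arr A B)).1.ty Γ)
    (hR.ty_dblV hT))).trans (.vlam (X := A) (i.value_iota hR ht)))
  rw [iotaV]
  refine (RetV.arr_beta _ _ b.closed a.closed' _).trans (.vlam (.vapp (.refl _) ?_))
  refine (Red.vlam_beta ..).trans (.of_eq ?_)
  exact hR.subst0_dbl A Γ (fun _ => rfl) _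

theorem cunit (hR : CpsResult R) : Inverts R Γ Δ .cunit (.comp .cunit) :=
  have hd : Ty false Γ Δ (dblC R Γ Δ .cunit) (.comp .cunit) := hR.ty_dblC (B := .cunit) .cunit
  of_comp hR .cunit ((Q.cunit_eta hd).trans
    (Q.cunit_eta (.lapp ((hR.iotaC .cunit).1.ty' Γ) .cunit)).symm)

theorem cpair (hR : CpsResult R) (ht : Ty false Γ Δ t (.comp C)) (hu : Ty false Γ Δ u (.comp D))
    (i : Inverts R Γ Δ t (.comp C)) (j : Inverts R Γ Δ u (.comp D)) :
    Inverts R Γ Δ (.cpair t u) (.comp (.cand C D)) := by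
  have q := hR.transport (Q.dcps_cpair ht hu)
  refine of_comp hR (.cpair ht hu) ((q.trans (Q.cpair (i.comp _ rfl) (j.comp _ rfl))).expand ?_
    (.lapp ((hR.iotaC (.cand C D)).1.ty' Γ) (.cpair ht hu)))
  rw [iotaCinv]
  exact (RetC.cand_beta _ (hR.iotaC C).1.closed' (hR.iotaC D).1.closed' _).trans
    (.cpair (.lapp (.refl _) (.cfst_beta ..)) (.lapp (.refl _) (.csnd_beta ..)))

theorem cfst (hR : CpsResult R) (ht : Ty false Γ Δ t (.comp (.cand C D)))
    (i : Inverts R Γ Δ t (.comp (.cand C D))) : Inverts R Γ Δ (.cfst t) (.comp C) := by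
  have q := hR.transport (Q.dcps_cfst ht)
  refine of_comp hR (.cfst ht) ((q.trans (Q.cfst (i.comp _ rfl))).red ?_)
  rw [iotaCinv]
  exact (Red.cfst (RetC.cand_beta _ (hR.iotaC C).1.closed' (hR.iotaC D).1.closed' _)).trans
    (.cfst_beta ..)

theorem csnd (hR : CpsResult R) (ht : Ty false Γ Δ t (.comp (.cand C D)))
    (i : Inverts R Γ Δ t (.comp (.cand C D))) : Inverts R Γ Δ (.csnd t) (.comp D) := by
  have q := hR.transport (Q.dcps_csnd ht)
  refine of_comp hR (.csnd ht) ((q.trans (Q.csnd (i.comp _ rfl))).red ?_)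
  rw [iotaCinv]
  exact (Red.csnd (RetC.cand_beta _ (hR.iotaC C).1.closed' (hR.iotaC D).1.closed' _)).trans
    (.csnd_beta ..)

end Inverts

end EEC

namespace EEC

namespace Inverts

variable {R : CType} {Γ : List VType} {Δ : Option CType} {s t u : Tm}
  {A X : VType} {B C D E : CType}

theorem clam (hR : CpsResult R) (ht : Ty false (A :: Γ) Δ t (.comp C))
    (i : Inverts R (A :: Γ) Δ t (.comp C)) : Inverts R Γ Δ (.clam X t) (.comp (.carr A C)) := by
  have ⟨a, a'⟩ := hR.iotaV A
  have ⟨c, c'⟩ := hR.iotaC C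
  have hT : Ty false Γ Δ (.clam X t) (.comp (.carr A C)) := .clam nofun ht
  have q := hR.transport (Q.dcps_clam X ht)
  refine of_comp_iota hR hT ((Q.lapp (.refl ((hR.iotaC (.carr A C)).1.ty Γ)) q).trans
    ((Q.of_red ?_ (.lapp ((hR.iotaC (.carr A C)).1.ty Γ) q.right)).trans
    (.clam (X := A) (i.comp_iota hR ht))))
  rw [iotaC]
  refine (RetC.carr_beta _ _ c.closed a.closed' _).trans (.clam (.lapp (.refl _) ?_))
  refine (Red.clam_beta ..).trans (.of_eq ?_)
  rw [hR.shift_iotaStoup]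
  exact hR.subst0_dbl A Γ (hR.full_iotaStoup Δ) _

theorem capp (hR : CpsResult R) (hs : Ty false Γ Δ s (.comp (.carr A C))) (ht : Ty false Γ none t A)
    (i : Inverts R Γ Δ s (.comp (.carr A C))) (j : Inverts R Γ none t A) :
    Inverts R Γ Δ (.capp s t) (.comp C) := by
  have ⟨a, a'⟩ := hR.iotaV A
  have ⟨c, c'⟩ := hR.iotaC C
  have q := hR.transport (Q.dcps_capp hs ht)
  rw [Tm.full, ((ht.cpsV R).cpsV R).sfree _ _ .svar] at q
  refine of_comp hR (.capp hs ht) ((q.trans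
    ((Q.capp (i.comp _ rfl) (j.value rfl)).red ?_)).trans
    (.lapp (.refl (c.ty' Γ)) (.capp (.refl hs) (a'.inv ht))))
  rw [iotaCinv]
  exact (Red.capp (RetC.carr_beta _ _ c.closed' a.closed _) (.refl _)).trans
    (RetC.capp_carr_beta _ c.closed' a.closed _ _)

theorem iota_iunit (R : CType) (x : Tm) : Red (.lapp (iotaCinv R .iunit) x) x := by
  rw [iotaCinv]
  exact Red.llam_beta ..

theorem top (hR : CpsResult R) : Inverts R Γ none .top (.comp .iunit) :=
  have q := hR.transport (Γ := Γ) (Δ := none) Q.dcps_top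
  of_comp hR .top (q.expand (iota_iunit R .top) (.lapp ((hR.iotaC .iunit).1.ty' Γ) .top))

theorem ilet (hR : CpsResult R) (ht : Ty false Γ Δ t (.comp .iunit))
    (hu : Ty false Γ none u (.comp C)) (i : Inverts R Γ Δ t (.comp .iunit))
    (j : Inverts R Γ none u (.comp C)) : Inverts R Γ Δ (.ilet t u) (.comp C) := by
  have ⟨c, c'⟩ := hR.iotaC C
  have q := hR.transport (Q.dcps_ilet ht hu)
  rw [Tm.full, ((hu.cpsV R).cpsV R).sfree _ _ .svar] at q
  have j' := j.value rfl
  simp only [cpsV] at j'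
  refine of_comp hR (.ilet ht hu) ((q.trans ((Q.lapp j' (i.comp _ rfl)).red ?_)).trans
    (Q.lapp_ilet (c.ty' Γ) ht hu).symm)
  rw [iotaVinv]
  exact (Red.lapp (RetV.comp_beta' _ _ c.closed' _) (iota_iunit R t)).trans
    (RetV.lapp_comp_beta' _ c.closed' hu.sfree _)

theorem bang (hR : CpsResult R) (ht : Ty false Γ none t A) (i : Inverts R Γ none t A) :
    Inverts R Γ none (.bang t) (.comp (.bang A)) := by
  have ⟨a, a'⟩ := hR.iotaV A
  have q := hR.transport (Γ := Γ) (Δ := none) (Q.dcps_bang ht)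
  rw [Tm.full, ((ht.cpsV R).cpsV R).sfree _ _ .svar] at q
  have q' : Q Γ none (Tm.full (iotaEnv R Γ) (iotaStoup R none) .svar) .top
      (.comp (cpsC R R)) := by
    rw [hR.self]
    exact .refl .top
  refine of_comp hR (.bang ht) ((q.trans (Q.copow (i.value rfl) q')).expand ?_
    (.lapp ((hR.iotaC (.bang A)).1.ty' Γ) (.bang ht)))
  rw [iotaCinv]
  refine (RetC.bang_beta' _ a.closed' _).trans ?_
  have := Red.bang_beta t (.copow (.vapp (iotaVinv R A) (.var 0)) .top)
  simpa [Tm.subst0_eq_full, Tm.full, a.closed' _ _] using this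

theorem banglet (hR : CpsResult R) (ht : Ty false Γ Δ t (.comp (.bang A)))
    (hu : Ty false (A :: Γ) none u (.comp C)) (i : Inverts R Γ Δ t (.comp (.bang A)))
    (j : Inverts R (A :: Γ) none u (.comp C)) : Inverts R Γ Δ (.banglet t u) (.comp C) := by
  have ⟨a, a'⟩ := hR.iotaV A
  have ⟨c, c'⟩ := hR.iotaC C
  have q := hR.transport (Q.dcps_banglet ht hu)
  have e : Red (.copowlet (.lapp (iotaCinv R (.bang A)) t)
      (Tm.full (Tm.liftS (iotaEnv R Γ)) .svar (Tm.dcps false u)))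
      (.banglet t (dblC R (A :: Γ) none u)) := by
    rw [iotaCinv]
    refine (Red.copowlet (RetC.bang_beta' _ a.closed' _) (.refl _)).trans
      ((Red.banglet_comm (.copowlet _) _ _).trans (.banglet (.refl _) ?_))
    refine (Red.copow_beta ..).trans (.of_eq ?_)
    exact hR.ssubst_subst0_dbl A Γ _ _
  refine of_comp hR (.banglet ht hu) ((q.trans ((Q.copowlet (i.comp _ rfl) (.refl ?_)).red e)).trans
    ((Q.banglet (.refl ht) (j.comp _ rfl)).trans
    (Q.lapp_banglet (c.ty' Γ) c.closed' ht hu).symm))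
  exact (hu.dcps (R := R)).full ((hR.tySub Γ).lift _) .svar

theorem copow (hR : CpsResult R) (ht : Ty false Γ none t A) (hu : Ty false Γ Δ u (.comp C))
    (i : Inverts R Γ none t A) (j : Inverts R Γ Δ u (.comp C)) :
    Inverts R Γ Δ (.copow t u) (.comp (.copow A C)) := by
  have ⟨a, a'⟩ := hR.iotaV A
  have ⟨c, c'⟩ := hR.iotaC C
  have q := hR.transport (Q.dcps_copow ht hu)
  rw [Tm.full, ((ht.cpsV R).cpsV R).sfree _ _ .svar] at q
  refine of_comp hR (.copow ht hu) ((q.trans (Q.copow (i.value rfl) (j.comp _ rfl))).expand ?_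
    (.lapp ((hR.iotaC (.copow A C)).1.ty' Γ) (.copow ht hu)))
  rw [iotaCinv]
  refine (RetC.copow_beta _ a.closed' c.closed' _).trans ?_
  have := Red.copow_beta t u (.copow (.vapp (iotaVinv R A) (.var 0)) (.lapp (iotaCinv R C) .svar))
  have ts := ht.sfree.full_eq u
  simpa [Tm.subst0_eq_full, Tm.ssubst_eq_full, Tm.full, a.closed' _ _, c.closed' _ _, ts] using this

theorem copowlet (hR : CpsResult R) (hs : Ty false Γ Δ s (.comp (.copow A D)))
    (ht : Ty false (A :: Γ) (some D) t (.comp C)) (i : Inverts R Γ Δ s (.comp (.copow A D)))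
    (j : Inverts R (A :: Γ) (some D) t (.comp C)) : Inverts R Γ Δ (.copowlet s t) (.comp C) := by
  have ⟨a, a'⟩ := hR.iotaV A
  have ⟨c, c'⟩ := hR.iotaC C
  have ⟨d, d'⟩ := hR.iotaC D
  have q := hR.transport (Q.dcps_copowlet hs ht)
  have e : Red (.copowlet (.lapp (iotaCinv R (.copow A D)) s)
      (Tm.full (Tm.liftS (iotaEnv R Γ)) .svar (Tm.cpsE true (Tm.cpsE true t))))
      (.copowlet s (dblC R (A :: Γ) (some D) t)) := by
    rw [iotaCinv]
    refine (Red.copowlet (RetC.copow_beta _ a.closed' d.closed' _) (.refl _)).trans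
      ((Red.copowlet_comm (.copowlet _) _ _).trans (.copowlet (.refl _) ?_))
    refine (Red.copow_beta ..).trans (.of_eq ?_)
    rw [dblC, Option.isSome_some, Tm.dcps_true]
    exact hR.ssubst_subst0_dbl A Γ _ _
  refine of_comp hR (.copowlet hs ht) ((q.trans ((Q.copowlet (i.comp _ rfl) (.refl ?_)).red e)).trans
    ((Q.copowlet (.refl hs) (j.comp _ rfl)).trans
    (Q.lapp_copowlet (c.ty' Γ) c.closed' hs ht).symm))
  exact ((ht.cpsC R).cpsC R).full ((hR.tySub Γ).lift _) .svar

theorem cimage (hR : CpsResult R) {Y : CType} (ht : Ty false Γ Δ t (.comp .czero))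
    (i : Inverts R Γ Δ t (.comp .czero)) : Inverts R Γ Δ (.cimage Y t) (.comp C) := by
  have q := hR.transport (Q.dcps_cimage (A := C) Y ht)
  have r : Red (.lapp (iotaCinv R .czero) t) t := by
    rw [iotaCinv]
    exact Red.llam_beta ..
  exact of_comp hR (.cimage nofun ht) ((q.trans (Q.cimage (Y := .cunit) ((i.comp _ rfl).red r))).trans
    (Q.lapp_cimage ((hR.iotaC C).1.ty' Γ) ht).symm)

theorem cinl (hR : CpsResult R) (ht : Ty false Γ Δ t (.comp C))
    (i : Inverts R Γ Δ t (.comp C)) : Inverts R Γ Δ (.cinl t) (.comp (.csum C D)) := by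
  have ⟨c, c'⟩ := hR.iotaC C
  have ⟨d, d'⟩ := hR.iotaC D
  have q := hR.transport (Q.dcps_cinl (B := D) ht)
  refine of_comp hR (.cinl ht) ((q.trans (Q.cinl (i.comp _ rfl))).expand ?_
    (.lapp ((hR.iotaC (.csum C D)).1.ty' Γ) (.cinl ht)))
  rw [iotaCinv]
  refine (RetC.csum_beta ..).trans ((Red.csum_beta_inl ..).trans (.of_eq ?_))
  simp [Tm.ssubst, c.closed'.ssubst]

theorem cinr (hR : CpsResult R) (ht : Ty false Γ Δ t (.comp D))
    (i : Inverts R Γ Δ t (.comp D)) : Inverts R Γ Δ (.cinr t) (.comp (.csum C D)) := by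
  have ⟨c, c'⟩ := hR.iotaC C
  have ⟨d, d'⟩ := hR.iotaC D
  have q := hR.transport (Q.dcps_cinr (A := C) ht)
  refine of_comp hR (.cinr ht) ((q.trans (Q.cinr (i.comp _ rfl))).expand ?_
    (.lapp ((hR.iotaC (.csum C D)).1.ty' Γ) (.cinr ht)))
  rw [iotaCinv]
  refine (RetC.csum_beta ..).trans ((Red.csum_beta_inr ..).trans (.of_eq ?_))
  simp [Tm.ssubst, d.closed'.ssubst]

theorem ccase (hR : CpsResult R) (hs : Ty false Γ Δ s (.comp (.csum C D)))
    (ht : Ty false Γ (some C) t (.comp E)) (hu : Ty false Γ (some D) u (.comp E))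
    (i : Inverts R Γ Δ s (.comp (.csum C D))) (j : Inverts R Γ (some C) t (.comp E))
    (k : Inverts R Γ (some D) u (.comp E)) : Inverts R Γ Δ (.ccase s t u) (.comp E) := by
  have ⟨c, c'⟩ := hR.iotaC C
  have ⟨d, d'⟩ := hR.iotaC D
  have ⟨e, e'⟩ := hR.iotaC E
  have q := hR.transport (Q.dcps_ccase hs ht hu)
  have r : Red (.ccase (.lapp (iotaCinv R (.csum C D)) s)
      (Tm.full (iotaEnv R Γ) .svar (Tm.cpsE true (Tm.cpsE true t)))
      (Tm.full (iotaEnv R Γ) .svar (Tm.cpsE true (Tm.cpsE true u))))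
      (.ccase s (dblC R Γ (some C) t) (dblC R Γ (some D) u)) := by
    rw [iotaCinv]
    refine (Red.ccase (RetC.csum_beta ..) (.refl _) (.refl _)).trans
      ((Red.ccase_comm (.ccase _ _) _ _ _).trans (.ccase (.refl _)
      ((Red.csum_beta_inl ..).trans (.of_eq ?_)) ((Red.csum_beta_inr ..).trans (.of_eq ?_))))
    all_goals
      rw [dblC, Option.isSome_some, Tm.dcps_true]
      exact Tm.ssubst_full_svar (iotaEnv_sfree R Γ hR) _ _
  refine of_comp hR (.ccase hs ht hu)
    ((q.trans ((Q.ccase (i.comp _ rfl) (.refl ?_) (.refl ?_)).red r)).trans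
    ((Q.ccase (.refl hs) (j.comp _ rfl) (k.comp _ rfl)).trans
    (Q.lapp_ccase (e.ty' Γ) hs ht hu).symm))
  · exact ((ht.cpsC R).cpsC R).full (hR.tySub Γ) .svar
  · exact ((hu.cpsC R).cpsC R).full (hR.tySub Γ) .svar

theorem llam (hR : CpsResult R) {Y : CType} (ht : Ty false Γ (some C) t (.comp D))
    (i : Inverts R Γ (some C) t (.comp D)) : Inverts R Γ none (.llam Y t) (.lin C D) := by
  have ⟨c, c'⟩ := hR.iotaC C
  have ⟨d, d'⟩ := hR.iotaC D
  have hT : Ty false Γ none (.llam Y t) (.lin C D) := .llam nofun ht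
  refine of_value_iota hR hT ((Q.of_red ?_ (.vapp ((hR.iotaV (.lin C D)).1.ty Γ)
    (hR.ty_dblV hT))).trans (.llam (X := C) (i.comp_iota hR ht)))
  rw [iotaV]
  refine (RetV.lin_beta _ _ d.closed c.closed' _).trans (.llam (.lapp (.refl _) ?_))
  refine (Red.llam_beta ..).trans (.of_eq ?_)
  rw [dblC, Option.isSome_some, Tm.dcps_true]
  exact Tm.ssubst_full_svar (iotaEnv_sfree R Γ hR) _ _

theorem lapp (hR : CpsResult R) (hs : Ty false Γ none s (.lin C D)) (ht : Ty false Γ Δ t (.comp C))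
    (i : Inverts R Γ none s (.lin C D)) (j : Inverts R Γ Δ t (.comp C)) :
    Inverts R Γ Δ (.lapp s t) (.comp D) := by
  have ⟨c, c'⟩ := hR.iotaC C
  have ⟨d, d'⟩ := hR.iotaC D
  have q := hR.transport (Q.dcps_lapp hs ht)
  rw [Tm.full, ((hs.cpsV R).cpsV R).sfree _ _ .svar] at q
  refine of_comp hR (.lapp hs ht) ((q.trans
    ((Q.lapp (i.value rfl) (j.comp _ rfl)).red ?_)).trans
    (.lapp (.refl (d.ty' Γ)) (.lapp (.refl hs) (c'.inv ht))))
  rw [iotaVinv]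
  exact (Red.lapp (RetV.lin_beta _ _ d.closed' c.closed _) (.refl _)).trans
    (RetV.lapp_lin_beta _ d.closed' c.closed hs.sfree _)

end Inverts

end EEC

namespace EEC

theorem Ty.inverts {R : CType} (hR : CpsResult R) {Γ : List VType} {Δ : Option CType} {t : Tm}
    {A : VType} (h : Ty false Γ Δ t A) : Inverts R Γ Δ t A := by
  induction h with
  | var h => exact .var hR h
  | svar => exact .svar hR
  | unit => exact .unit hR
  | vpair hs ht i j => exact .vpair hR hs ht i j
  | vfst ht i => exact .vfst hR ht i
  | vsnd ht i => exact .vsnd hR ht i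
  | vlam _ ht i => exact .vlam hR ht i
  | vapp hs ht i j => exact .vapp hR hs ht i j
  | cunit => exact .cunit hR
  | cpair hs ht i j => exact .cpair hR hs ht i j
  | cfst ht i => exact .cfst hR ht i
  | csnd ht i => exact .csnd hR ht i
  | clam _ ht i => exact .clam hR ht i
  | capp hs ht i j => exact .capp hR hs ht i j
  | top => exact .top hR
  | ilet hs ht i j => exact .ilet hR hs ht i j
  | bang ht i => exact .bang hR ht i
  | banglet hs ht i j => exact .banglet hR hs ht i j
  | copow hs ht i j => exact .copow hR hs ht i j
  | copowlet hs ht i j => exact .copowlet hR hs ht i j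
  | cimage _ ht i => exact .cimage hR ht i
  | cinl ht i => exact .cinl hR ht i
  | cinr ht i => exact .cinr hR ht i
  | ccase hs ht hu i j k => exact .ccase hR hs ht hu i j k
  | llam _ ht i => exact .llam hR ht i
  | lapp hs ht i j => exact .lapp hR hs ht i j

end EEC

namespace EEC

theorem CpsResult.tySub_true {R : CType} (hR : CpsResult R) (Γ : List VType) :
    TySub true (cpsCtx R (cpsCtx R Γ)) Γ (iotaEnv R Γ) := by
  intro n A hn
  simp only [cpsCtx, List.map_map, List.getElem?_map, Option.map_eq_some_iff] at hn
  obtain ⟨B, hB, rfl⟩ := hn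
  simp only [iotaEnv, hB]
  exact .vapp (hR.ty_iotaV B Γ).2 (.var hB)

theorem CpsResult.iotaSubst_lapp {R : CType} (hR : CpsResult R) (Γ : List VType) (A B : CType)
    (x : Tm) :
    iotaSubst R Γ (Tm.ssubst (.lapp (iotaCinv R A) .svar) (.lapp (EEC.iotaC R B) x)) =
      .lapp (EEC.iotaC R B) (Tm.full (iotaEnv R Γ) (iotaStoup R (some A)) x) := by
  have e : Tm.full (iotaEnv R Γ) (Tm.lapp (iotaCinv R A) .svar) (EEC.iotaC R B) = EEC.iotaC R B :=
    (hR.iotaC B).1.closed _ _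
  rw [iotaSubst_eq, Tm.ssubst_eq_full, Tm.full_full (fun _ _ _ _ => rfl)]
  simp only [Tm.full]
  rw [show Tm.full (iotaEnv R Γ) .svar (iotaCinv R A) = iotaCinv R A from
    (hR.iotaC A).1.closed' _ _, e]
  rfl

end EEC

namespace EEC

/-- **Involution property of the self-translation (stoup-term part)**
(Theorem 5.4(2)): suppose `R̲` is either a computation-type constant or the
type `I̲`.  If `Γ | z:A̲ ⊢ t : B̲` is derivable in EEC, then
`Γ | z:A̲ ⊢ t = ι_B̲[(tᶜ)ᶜ][ι_A̲⁻¹[z]/k_{k_z}][ι⁻¹(Γ)] : B̲` in the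
equational theory of EEC, where `[ι⁻¹(Γ)]` replaces each variable `xᵢ:Cᵢ`
of `Γ` by `ι_{Cᵢ}⁻¹(xᵢ)` and `k_{k_z}` is the stoup variable of the doubly
translated term. -/
theorem cps_involution_stoup (R : CType)
    (hR : (∃ a : ℕ, R = CType.base a) ∨ R = CType.iunit)
    (Γ : List VType) (t : Tm) (A B : CType)
    (dt : Deriv Γ (some A) t (.comp B))
    (dtt : Deriv (cpsCtx R Γ) (some (cpsC R B)) (cps R dt) (.comp (cpsC R A))) :
    EEq Γ (some A) t
      (iotaSubst R Γ
        (Tm.ssubst (.lapp (iotaCinv R A) .svar) (.lapp (iotaC R B) (cps R dtt))))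
      (.comp B) := by
  have hR := CpsResult.of_base_or_iunit hR
  have h : Ty false Γ (some A) t (.comp B) := dt.ty
  have q := (h.inverts hR).comp_iota hR h
  have hx : Ty true (cpsCtx R (cpsCtx R Γ)) (some (cpsC R (cpsC R A))) (cps R dtt)
    (.comp (cpsC R (cpsC R B))) := dtt.cps_ty R
  have e : Tm.erase (Tm.dcps true t) = Tm.erase (cps R dtt) := by
    rw [Tm.dcps_true, Tm.erase_cpsE, erase_cps, Option.isSome_some, ← Tm.cpsE_erase true (cps R dt), erase_cps,
      Option.isSome_some]
  rw [hR.iotaSubst_lapp]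
  refine (q.of_erase ?_ rfl).symm.eeq dt (Ty.toDeriv (.lapp (hR.ty_iotaC B Γ).1
    (hx.full (hR.tySub_true Γ) (.lapp (hR.ty_iotaC A Γ).2 .svar))))
  simp only [dblC, Option.isSome_some, Tm.erase, Tm.erase_full, e]

end EEC
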